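/- For every ε > 0 there exists a constant C(ε) such that for every squarefree integer q ≥ 1, every real X > 0, and every finite set S of pairwise SL₂(ℤ)-inequivalent elements x ∈ V̂_ℤ with 0 < |Disc(x)| < q⁸·X, one has Σ_{x∈S} |Φ̂_q(x)|/#Stab(x) ≤ C(ε)·q^{1+ε}·X. (Equivalently: the partial sums Σ_{μ_n < X} |b_q(μ_n)| of the coefficients of the dual q-nonmaximal Shintani zeta function, with absolute values taken inside each orbit sum, are bounded by C(ε)·q^{1+ε}·X.) -/

import Mathlib

open scoped Classical

noncomputable section

/-- An integral binary cubic form `a u³ + b u²v + c uv² + d v³`, recorded by its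
coefficient quadruple `(a, b, c, d)`. -/
abbrev BCF := ℤ × ℤ × ℤ × ℤ

namespace BCF

/-- The discriminant of a binary cubic form. -/
def disc (f : BCF) : ℤ :=
  f.2.1 ^ 2 * f.2.2.1 ^ 2 - 4 * f.1 * f.2.2.1 ^ 3 - 4 * f.2.1 ^ 3 * f.2.2.2
    - 27 * f.1 ^ 2 * f.2.2.2 ^ 2 + 18 * f.1 * f.2.1 * f.2.2.1 * f.2.2.2

/-- The (twisted) action of a matrix `γ` with `det γ = ±1` on binary cubic forms:
`(γ·f)(u,v) = (det γ)⁻¹ · f((u,v)·γ)`, written out on coefficients (for `det γ = ±1`,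
dividing by the determinant is the same as multiplying by it). -/
def act (γ : Matrix (Fin 2) (Fin 2) ℤ) (f : BCF) : BCF :=
  let a := f.1; let b := f.2.1; let c := f.2.2.1; let d := f.2.2.2
  let α := γ 0 0; let β := γ 1 0; let g := γ 0 1; let δ := γ 1 1
  (γ.det * (a * α ^ 3 + b * α ^ 2 * g + c * α * g ^ 2 + d * g ^ 3),
   γ.det * (3 * a * α ^ 2 * β + b * (α ^ 2 * δ + 2 * α * β * g)
      + c * (2 * α * g * δ + β * g ^ 2) + 3 * d * g ^ 2 * δ),
   γ.det * (3 * a * α * β ^ 2 + b * (2 * α * β * δ + β ^ 2 * g)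
      + c * (α * δ ^ 2 + 2 * β * g * δ) + 3 * d * g * δ ^ 2),
   γ.det * (a * β ^ 3 + b * β ^ 2 * δ + c * β * δ ^ 2 + d * δ ^ 3))

/-- `SL₂(ℤ)`-equivalence of binary cubic forms. -/
def SLeq (f g : BCF) : Prop := ∃ γ : Matrix (Fin 2) (Fin 2) ℤ, γ.det = 1 ∧ act γ f = g

/-- `GL₂(ℤ)`-equivalence of binary cubic forms. -/
def GLeq (f g : BCF) : Prop :=
  ∃ γ : Matrix (Fin 2) (Fin 2) ℤ, (γ.det = 1 ∨ γ.det = -1) ∧ act γ f = g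

/-- The Davenport–Heilbronn set `U_p`: `f` is not a multiple of `p`, and no
`GL₂(ℤ)`-transform of `f` has leading coefficient divisible by `p²` and second
coefficient divisible by `p`. -/
def inUp (p : ℕ) (f : BCF) : Prop :=
  (¬ ((p:ℤ) ∣ f.1 ∧ (p:ℤ) ∣ f.2.1 ∧ (p:ℤ) ∣ f.2.2.1 ∧ (p:ℤ) ∣ f.2.2.2)) ∧
  ∀ γ : Matrix (Fin 2) (Fin 2) ℤ, (γ.det = 1 ∨ γ.det = -1) →
    ¬ ((p:ℤ) ^ 2 ∣ (act γ f).1 ∧ (p:ℤ) ∣ (act γ f).2.1)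

/-- Membership in the dual lattice `V̂_ℤ`: the middle coefficients are divisible by 3. -/
def inDual (x : BCF) : Prop := (3:ℤ) ∣ x.2.1 ∧ (3:ℤ) ∣ x.2.2.1

/-- The pairing `[x, y] = x₄y₁ − x₃y₂/3 + x₂y₃/3 − x₁y₄` (an integer for `x ∈ V̂_ℤ`). -/
def pairQ (x y : BCF) : ℚ :=
  (x.2.2.2 * y.1 : ℤ) - ((x.2.2.1 * y.2.1 : ℤ) : ℚ) / 3
    + ((x.2.1 * y.2.2.1 : ℤ) : ℚ) / 3 - (x.1 * y.2.2.2 : ℤ)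

/-- `Φ_q`, the characteristic function of forms nonmaximal at every prime `p | q`. -/
def nonmaxAll (q : ℕ) (f : BCF) : Prop := ∀ p : ℕ, p.Prime → p ∣ q → ¬ inUp p f

/-- The cubic Gauss sum `Φ̂_q(x) = q⁻⁸ Σ_y Φ_q(y) exp(2πi [x,y]/q²)`, the sum running
over forms `y` with coefficients in `{0, …, q² − 1}`. -/
noncomputable def PhiHat (q : ℕ) (x : BCF) : ℂ :=
  ((q : ℂ) ^ 8)⁻¹ *
    ∑ y1 ∈ Finset.range (q ^ 2), ∑ y2 ∈ Finset.range (q ^ 2),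
    ∑ y3 ∈ Finset.range (q ^ 2), ∑ y4 ∈ Finset.range (q ^ 2),
      (if nonmaxAll q ((y1 : ℤ), (y2 : ℤ), (y3 : ℤ), (y4 : ℤ)) then 1 else 0) *
        Complex.exp (2 * Real.pi * Complex.I *
          ((pairQ x ((y1 : ℤ), (y2 : ℤ), (y3 : ℤ), (y4 : ℤ)) : ℚ) : ℂ) / (q : ℂ) ^ 2)

/-- The order of the stabilizer of `x` in `SL₂(ℤ)`. -/
noncomputable def stabCard (x : BCF) : ℕ :=
  Nat.card {γ : Matrix (Fin 2) (Fin 2) ℤ // γ.det = 1 ∧ act γ x = x}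

end BCF

section
namespace DCB

/-- divided binary cubic form `a u³ + 3b u²v + 3c uv² + d v³`. -/
@[ext] structure Fm where
  a : ℤ
  b : ℤ
  c : ℤ
  d : ℤ

namespace Fm
def hA (x : Fm) : ℤ := x.b ^ 2 - x.a * x.c
def hB (x : Fm) : ℤ := x.b * x.c - x.a * x.d
def hC (x : Fm) : ℤ := x.c ^ 2 - x.b * x.d
def D (x : Fm) : ℤ := x.hB ^ 2 - 4 * x.hA * x.hC
def G (x : Fm) : ℤ := 2 * x.b * x.hA - x.a * x.hB
/-- value at a point -/
def ev (x : Fm) (u v : ℤ) : ℤ := x.a * u ^ 3 + 3 * x.b * u ^ 2 * v + 3 * x.c * u * v ^ 2 + x.d * v ^ 3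
/-- `x(αU+βV, gU+δV)` -/
def T (α β g δ : ℤ) (x : Fm) : Fm where
  a := x.a * α ^ 3 + 3 * x.b * α ^ 2 * g + 3 * x.c * α * g ^ 2 + x.d * g ^ 3
  b := x.a * α ^ 2 * β + x.b * (α ^ 2 * δ + 2 * α * β * g) + x.c * (2 * α * g * δ + β * g ^ 2)
    + x.d * g ^ 2 * δ
  c := x.a * α * β ^ 2 + x.b * (2 * α * β * δ + β ^ 2 * g) + x.c * (α * δ ^ 2 + 2 * β * g * δ)
    + x.d * g * δ ^ 2
  d := x.a * β ^ 3 + 3 * x.b * β ^ 2 * δ + 3 * x.c * β * δ ^ 2 + x.d * δ ^ 3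
def smul (k : ℤ) (x : Fm) : Fm := ⟨k * x.a, k * x.b, k * x.c, k * x.d⟩
/-- divisibility of all coefficients -/
def Dv (k : ℤ) (x : Fm) : Prop := k ∣ x.a ∧ k ∣ x.b ∧ k ∣ x.c ∧ k ∣ x.d
/-- divisibility of the Hessian -/
def HDv (k : ℤ) (x : Fm) : Prop := k ∣ x.hA ∧ k ∣ x.hB ∧ k ∣ x.hC
/-- SL2 equivalence -/
def E (x y : Fm) : Prop := ∃ α β g δ : ℤ, α * δ - β * g = 1 ∧ T α β g δ x = y
end Fm
open Fm

theorem T_T (α β g δ α' β' g' δ' : ℤ) (x : Fm) :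
    T α' β' g' δ' (T α β g δ x) =
      T (α * α' + β * g') (α * β' + β * δ') (g * α' + δ * g') (g * β' + δ * δ') x := by
  ext <;> simp only [T] <;> ring

theorem T_id (x : Fm) : T 1 0 0 1 x = x := by ext <;> simp [T]

theorem T_scalar (k : ℤ) (x : Fm) : T k 0 0 k x = smul (k ^ 3) x := by
  ext <;> simp [T, smul] <;> ring

theorem hA_T (α β g δ : ℤ) (x : Fm) : (T α β g δ x).hA =
    (α * δ - β * g) ^ 2 * (x.hA * α ^ 2 + x.hB * α * g + x.hC * g ^ 2) := by
  simp only [T, hA, hB, hC]; ring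
theorem hB_T (α β g δ : ℤ) (x : Fm) : (T α β g δ x).hB =
    (α * δ - β * g) ^ 2 * (2 * x.hA * α * β + x.hB * (α * δ + β * g) + 2 * x.hC * g * δ) := by
  simp only [T, hA, hB, hC]; ring
theorem hC_T (α β g δ : ℤ) (x : Fm) : (T α β g δ x).hC =
    (α * δ - β * g) ^ 2 * (x.hA * β ^ 2 + x.hB * β * δ + x.hC * δ ^ 2) := by
  simp only [T, hA, hB, hC]; ring
theorem D_T (α β g δ : ℤ) (x : Fm) : (T α β g δ x).D = (α * δ - β * g) ^ 6 * x.D := by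
  simp only [D, hA_T, hB_T, hC_T]; ring
theorem syzygy (x : Fm) : x.G ^ 2 - x.D * x.a ^ 2 = 4 * x.hA ^ 3 := by
  simp only [G, D, hA, hB, hC]; ring

theorem E_refl (x : Fm) : E x x := ⟨1, 0, 0, 1, by norm_num, T_id x⟩
theorem E_symm {x y : Fm} (h : E x y) : E y x := by
  obtain ⟨α, β, g, δ, h1, rfl⟩ := h
  refine ⟨δ, -β, -g, α, by linarith, ?_⟩
  rw [T_T]
  have : α * δ + β * -g = 1 := by linarith
  have h2 : g * -β + δ * α = 1 := by linarith
  rw [this, h2, show α * -β + β * α = 0 by ring, show g * δ + δ * -g = 0 by ring, T_id]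
theorem E_trans {x y z : Fm} (h : E x y) (h' : E y z) : E x z := by
  obtain ⟨α, β, g, δ, h1, rfl⟩ := h
  obtain ⟨α', β', g', δ', h1', rfl⟩ := h'
  refine ⟨_, _, _, _, ?_, (T_T _ _ _ _ _ _ _ _ _).symm⟩
  have : (α * δ - β * g) * (α' * δ' - β' * g') = 1 := by rw [h1, h1']; norm_num
  linarith
theorem E_D {x y : Fm} (h : E x y) : y.D = x.D := by
  obtain ⟨α, β, g, δ, h1, rfl⟩ := h
  rw [D_T, h1]; ring

theorem smul_T (k α β g δ : ℤ) (x : Fm) : T α β g δ (smul k x) = smul k (T α β g δ x) := by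
  ext <;> simp only [T, smul] <;> ring
theorem Dv_iff {k : ℤ} {x : Fm} : Dv k x ↔ ∃ z, x = smul k z := by
  constructor
  · rintro ⟨⟨a, ha⟩, ⟨b, hb⟩, ⟨c, hc⟩, ⟨d, hd⟩⟩
    exact ⟨⟨a, b, c, d⟩, by ext <;> simp [smul, *]⟩
  · rintro ⟨z, rfl⟩; simp [Dv, smul]
theorem Dv_T {k : ℤ} {x : Fm} (h : Dv k x) (α β g δ : ℤ) : Dv k (T α β g δ x) := by
  obtain ⟨z, rfl⟩ := Dv_iff.1 h
  rw [smul_T]; exact Dv_iff.2 ⟨_, rfl⟩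
theorem HDv_T {k : ℤ} {x : Fm} (h : HDv k x) (α β g δ : ℤ) : HDv k (T α β g δ x) := by
  obtain ⟨⟨A, hA⟩, ⟨B, hB⟩, ⟨C, hC⟩⟩ := h
  refine ⟨?_, ?_, ?_⟩
  · rw [hA_T, hA, hB, hC]; exact ⟨(α * δ - β * g) ^ 2 * (A * α ^ 2 + B * α * g + C * g ^ 2), by ring⟩
  · rw [hB_T, hA, hB, hC]
    exact ⟨(α * δ - β * g) ^ 2 * (2 * A * α * β + B * (α * δ + β * g) + 2 * C * g * δ), by ring⟩
  · rw [hC_T, hA, hB, hC]; exact ⟨(α * δ - β * g) ^ 2 * (A * β ^ 2 + B * β * δ + C * δ ^ 2), by ring⟩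
theorem Dv_E {k : ℤ} {x y : Fm} (h : E x y) : Dv k x ↔ Dv k y := by
  constructor
  · intro h'; obtain ⟨α, β, g, δ, h1, rfl⟩ := h; exact Dv_T h' _ _ _ _
  · intro h'; obtain ⟨α, β, g, δ, h1, rfl⟩ := E_symm h; exact Dv_T h' _ _ _ _
theorem HDv_E {k : ℤ} {x y : Fm} (h : E x y) : HDv k x ↔ HDv k y := by
  constructor
  · intro h'; obtain ⟨α, β, g, δ, h1, rfl⟩ := h; exact HDv_T h' _ _ _ _
  · intro h'; obtain ⟨α, β, g, δ, h1, rfl⟩ := E_symm h; exact HDv_T h' _ _ _ _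
theorem hA_smul (k : ℤ) (x : Fm) : (smul k x).hA = k ^ 2 * x.hA := by simp only [smul, hA]; ring
theorem hB_smul (k : ℤ) (x : Fm) : (smul k x).hB = k ^ 2 * x.hB := by simp only [smul, hB]; ring
theorem hC_smul (k : ℤ) (x : Fm) : (smul k x).hC = k ^ 2 * x.hC := by simp only [smul, hC]; ring
theorem D_smul (k : ℤ) (x : Fm) : (smul k x).D = k ^ 4 * x.D := by
  simp only [D, hA_smul, hB_smul, hC_smul]; ring

/-- every coprime vector completes to a transformation -/
theorem exists_T_of_coprime (x : Fm) {u v : ℤ} (h : IsCoprime u v) :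
    ∃ y, E x y ∧ y.a = x.ev u v ∧ y.hA = x.hA * u ^ 2 + x.hB * u * v + x.hC * v ^ 2 := by
  obtain ⟨s, t, hst⟩ := h
  refine ⟨T u (-t) v s x, ⟨u, -t, v, s, by linarith, rfl⟩, ?_, ?_⟩
  · simp [T, ev]
  · rw [hA_T, show u * s - -t * v = 1 by linarith]; ring
/-- translations -/
theorem E_transl (x : Fm) (k : ℤ) : E x (T 1 k 0 1 x) := ⟨1, k, 0, 1, by ring, rfl⟩

/-- pairwise inequivalent finite sets -/
def Ineq (S : Finset Fm) : Prop := ∀ x ∈ S, ∀ y ∈ S, E x y → x = y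

theorem Ineq.subset {S S' : Finset Fm} (h : Ineq S) (hs : S' ⊆ S) : Ineq S' :=
  fun x hx y hy => h x (hs hx) y (hs hy)

theorem Ineq.image {S : Finset Fm} (f : Fm → Fm)
    (hf : ∀ x ∈ S, ∀ y ∈ S, E (f x) (f y) → x = y) : Ineq (S.image f) ∧ (S.image f).card = S.card := by
  constructor
  · intro x hx y hy hxy
    obtain ⟨x', hx', rfl⟩ := Finset.mem_image.1 hx
    obtain ⟨y', hy', rfl⟩ := Finset.mem_image.1 hy
    rw [hf x' hx' y' hy' hxy]
  · apply Finset.card_image_of_injOn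
    intro x hx y hy hxy
    exact hf x hx y hy (by rw [show f x = f y from hxy]; exact E_refl _)

theorem Ineq.image_E {S : Finset Fm} (hS : Ineq S) (f : Fm → Fm) (hf : ∀ x ∈ S, E x (f x)) :
    Ineq (S.image f) ∧ (S.image f).card = S.card :=
  Ineq.image f fun x hx y hy h => hS x hx y hy (E_trans (hf x hx) (E_trans h (E_symm (hf y hy))))

/-- class representatives -/
theorem exists_reps (S : Finset Fm) : ∃ R ⊆ S, Ineq R ∧ ∀ x ∈ S, ∃ r ∈ R, E r x := by
  induction S using Finset.induction_on with
  | empty => exact ⟨∅, by simp, by intro x hx; simp at hx, by simp⟩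
  | insert z S hz ih =>
    obtain ⟨R, hR, hI, hc⟩ := ih
    by_cases h : ∃ r ∈ R, E r z
    · refine ⟨R, hR.trans (Finset.subset_insert _ _), hI, ?_⟩
      intro x hx
      rcases Finset.mem_insert.1 hx with rfl | hx
      · exact h
      · exact hc x hx
    · push Not at h
      refine ⟨insert z R, Finset.insert_subset_insert _ hR, ?_, ?_⟩
      · intro x hx y hy hxy
        rcases Finset.mem_insert.1 hx with hx' | hx' <;> rcases Finset.mem_insert.1 hy with hy' | hy'
        · rw [hx', hy']
        · rw [hx'] at hxy; exact absurd (E_symm hxy) (h y hy')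
        · rw [hy'] at hxy; exact absurd hxy (h x hx')
        · exact hI x hx' y hy' hxy
      · intro x hx
        rcases Finset.mem_insert.1 hx with rfl | hx
        · exact ⟨x, by simp, E_refl _⟩
        · obtain ⟨r, hr, h⟩ := hc x hx
          exact ⟨r, by simp [hr], h⟩
end DCB

end

section
namespace DCB
open Fm

/-- small primitive values of positive definite real binary quadratic forms -/
theorem small_value (P Q R r : ℝ) (hP : 0 < P) (hr : 0 < r) (hd : 4 * P * R - Q ^ 2 = r ^ 2) :
    ∃ u v : ℤ, IsCoprime u v ∧ P * u ^ 2 + Q * u * v + R * v ^ 2 ≤ 5 / 4 * r := by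
  suffices h : ∃ u v : ℤ, (u ≠ 0 ∨ v ≠ 0) ∧ P * u ^ 2 + Q * u * v + R * v ^ 2 ≤ 5 / 4 * r by
    obtain ⟨u, v, h0, h1⟩ := h
    have hg : 0 < Int.gcd u v := by
      rw [Int.gcd_pos_iff]; exact h0
    obtain ⟨u', hu⟩ := Int.gcd_dvd_left u v
    obtain ⟨v', hv⟩ := Int.gcd_dvd_right u v
    set g := Int.gcd u v with hgdef
    have hcop : IsCoprime u' v' := by
      have h2 := Int.gcd_eq_gcd_ab u v
      refine ⟨Int.gcdA u v, Int.gcdB u v, ?_⟩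
      have hg' : (g : ℤ) ≠ 0 := by exact_mod_cast hg.ne'
      apply mul_left_cancel₀ hg'
      rw [← hgdef] at h2
      calc (g : ℤ) * (Int.gcdA u v * u' + Int.gcdB u v * v')
          = (g * u') * Int.gcdA u v + (g * v') * Int.gcdB u v := by ring
        _ = u * Int.gcdA u v + v * Int.gcdB u v := by rw [← hu, ← hv]
        _ = g * 1 := by rw [← h2]; ring
    refine ⟨u', v', hcop, ?_⟩
    have hu' : (u : ℝ) = g * u' := by exact_mod_cast hu
    have hv' : (v : ℝ) = g * v' := by exact_mod_cast hv
    have hg1 : (1 : ℝ) ≤ g := by exact_mod_cast hg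
    have hpos : 0 ≤ P * u' ^ 2 + Q * u' * v' + R * v' ^ 2 := by
      have : 0 ≤ 4 * P * (P * u' ^ 2 + Q * u' * v' + R * v' ^ 2) := by
        have : 4 * P * (P * u' ^ 2 + Q * u' * v' + R * v' ^ 2)
          = (2 * P * u' + Q * v') ^ 2 + r ^ 2 * v' ^ 2 := by rw [← hd]; ring
        rw [this]; positivity
      by_contra hn
      push Not at hn
      nlinarith
    have h3 : P * u ^ 2 + Q * u * v + R * v ^ 2 =
      (g : ℝ) ^ 2 * (P * u' ^ 2 + Q * u' * v' + R * v' ^ 2) := by rw [hu', hv']; ring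
    have hg2 : (1 : ℝ) ≤ (g : ℝ) ^ 2 := one_le_pow₀ hg1
    nlinarith
  by_cases hPr : P ≤ r
  · exact ⟨1, 0, by simp, by simp; linarith⟩
  push Not at hPr
  set w := Real.sqrt (P / r) with hw
  have hw2 : w ^ 2 = P / r := Real.sq_sqrt (by positivity)
  have hw1 : 1 ≤ w := by
    rw [hw, Real.one_le_sqrt]; rw [le_div_iff₀ hr]; linarith
  set N := ⌊w⌋₊ with hN
  have hN1 : 0 < N := Nat.floor_pos.2 hw1
  obtain ⟨j, k, hk, hkN, hjk⟩ := Real.exists_int_int_abs_mul_sub_le (Q / (2 * P)) hN1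
  refine ⟨-j, k, Or.inr hk.ne', ?_⟩
  have hNw : (N : ℝ) ≤ w := Nat.floor_le (by linarith)
  have hNw' : w < N + 1 := Nat.lt_floor_add_one w
  have hk0 : (0 : ℝ) < k := by exact_mod_cast hk
  have hkN' : (k : ℝ) ≤ w := le_trans (by exact_mod_cast hkN) hNw
  have e1 : P * ((-j : ℤ) : ℝ) ^ 2 + Q * ((-j : ℤ) : ℝ) * k + R * k ^ 2
      = P * ((k : ℝ) * (Q / (2 * P)) - j) ^ 2 + r ^ 2 * k ^ 2 / (4 * P) := by
    rw [← hd]; push_cast; field_simp; ring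
  rw [e1]
  have e2 : ((k : ℝ) * (Q / (2 * P)) - j) ^ 2 ≤ (1 / w) ^ 2 := by
    apply sq_le_sq'
    · have := (abs_le.1 hjk).1
      have h3 : 1 / ((N : ℝ) + 1) ≤ 1 / w := by gcongr
      linarith
    · have := (abs_le.1 hjk).2
      have h3 : 1 / ((N : ℝ) + 1) ≤ 1 / w := by gcongr
      linarith
  have e3 : (k : ℝ) ^ 2 ≤ P / r := by rw [← hw2]; gcongr
  have e4 : P * (1 / w) ^ 2 = r := by
    rw [one_div, inv_pow, hw2]; field_simp
  have e5 : r ^ 2 * (P / r) / (4 * P) = r / 4 := by field_simp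
  calc P * ((k : ℝ) * (Q / (2 * P)) - j) ^ 2 + r ^ 2 * k ^ 2 / (4 * P)
      ≤ P * (1 / w) ^ 2 + r ^ 2 * (P / r) / (4 * P) := by gcongr
    _ = 5 / 4 * r := by rw [e4, e5]; ring

theorem exists_root (a b c d : ℤ) (ha : a ≠ 0) :
    ∃ t : ℝ, (a : ℝ) * t ^ 3 + 3 * b * t ^ 2 + 3 * c * t + d = 0 := by
  set k : ℝ := 1 + 3 * |(b : ℝ)| + 3 * |(c : ℝ)| + |(d : ℝ)| with hk
  have hb := abs_nonneg (b : ℝ)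
  have hc := abs_nonneg (c : ℝ)
  have hd := abs_nonneg (d : ℝ)
  have hk1 : 1 ≤ k := by rw [hk]; linarith
  have key : ∀ t : ℝ, |t| = k → |3 * b * t ^ 2 + 3 * c * t + d| < k ^ 3 := by
    intro t ht
    have h1 : |3 * b * t ^ 2 + 3 * c * t + d| ≤ 3 * |(b : ℝ)| * k ^ 2 + 3 * |(c : ℝ)| * k + |(d : ℝ)| := by
      refine (abs_add_le _ _).trans ?_
      refine add_le_add ((abs_add_le _ _).trans ?_) le_rfl
      rw [abs_mul, abs_mul, abs_mul, abs_mul, abs_pow, ht]; norm_num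
    have hk2 : k ≤ k ^ 2 := by nlinarith
    have hk3 : 1 ≤ k ^ 2 := by nlinarith
    have h2 : |(c : ℝ)| * k ≤ |(c : ℝ)| * k ^ 2 := by gcongr
    have h3 : |(d : ℝ)| ≤ |(d : ℝ)| * k ^ 2 := by nlinarith
    have h4 : k ^ 3 = k ^ 2 * (1 + 3 * |(b : ℝ)| + 3 * |(c : ℝ)| + |(d : ℝ)|) := by
      rw [← hk]; ring
    nlinarith
  have h1 := key k (abs_of_nonneg (by linarith))
  have h2 := key (-k) (by rw [abs_neg]; exact abs_of_nonneg (by linarith))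
  have hcont : Continuous (fun t : ℝ => (a : ℝ) * t ^ 3 + 3 * b * t ^ 2 + 3 * c * t + d) := by fun_prop
  have hiv := intermediate_value_uIcc (a := -k) (b := k) hcont.continuousOn
  have h0 : (0 : ℝ) ∈ Set.uIcc ((a : ℝ) * (-k) ^ 3 + 3 * b * (-k) ^ 2 + 3 * c * (-k) + d)
      ((a : ℝ) * k ^ 3 + 3 * b * k ^ 2 + 3 * c * k + d) := by
    rw [abs_lt] at h1 h2
    have hk3 : 0 ≤ k ^ 3 := by positivity
    rcases lt_or_gt_of_ne ha with h | h
    · have h' : (a : ℝ) ≤ -1 := by exact_mod_cast (by omega : a ≤ -1)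
      rw [Set.mem_uIcc]; right
      constructor <;> nlinarith
    · have h' : (1 : ℝ) ≤ a := by exact_mod_cast (by omega : 1 ≤ a)
      rw [Set.mem_uIcc]; left
      constructor <;> nlinarith
  obtain ⟨t, _, ht⟩ := hiv h0
  exact ⟨t, ht⟩

theorem st2_le (s t : ℝ) (hs : 0 ≤ s) (ht : 0 ≤ t) : s * t ^ 2 ≤ (s + t) ^ 3 := by
  have h1 : 0 ≤ s * t := by positivity
  have h2 : 0 ≤ s ^ 3 := by positivity
  have h3 : 0 ≤ t ^ 3 := by positivity
  have h4 : 0 ≤ s ^ 2 * t := by positivity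
  have h5 : 0 ≤ s * t ^ 2 := by positivity
  nlinarith

set_option maxHeartbeats 1000000 in
/-- reduced representatives -/
theorem exists_red (x : Fm) (L : ℝ) (hL : 0 ≤ L) (h0 : x.D ≠ 0) (hD : |(x.D : ℝ)| ≤ L ^ 4) :
    ∃ y, E x y ∧ (y.a = 0 ∨ ((y.a : ℝ) ^ 2 ≤ 125 * L ^ 2 ∧ |(y.hA : ℝ)| ≤ 2 * L ^ 2)) := by
  by_cases ha : x.a = 0
  · exact ⟨x, E_refl x, Or.inl ha⟩
  set r := Real.sqrt |(x.D : ℝ)| with hr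
  have hDR : (x.D : ℝ) ≠ 0 := by exact_mod_cast h0
  have hr0 : 0 < r := Real.sqrt_pos.2 (abs_pos.2 hDR)
  have hr2 : r ^ 2 = |(x.D : ℝ)| := Real.sq_sqrt (abs_nonneg _)
  have hrL : r ≤ L ^ 2 := by
    rw [hr]; apply Real.sqrt_le_iff.2; exact ⟨by positivity, by rw [← pow_mul]; exact hD⟩
  rcases lt_or_gt_of_ne h0 with hneg | hpos
  · -- negative
    have hneg' : (x.D : ℝ) < 0 := by exact_mod_cast hneg
    have hApos : ∀ z : Fm, z.D < 0 → 0 ≤ z.hA := by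
      intro z hz
      have := syzygy z
      by_contra hn
      push Not at hn
      have h3 : z.hA ^ 3 < 0 := by
        have : z.hA ^ 3 = z.hA * z.hA ^ 2 := by ring
        rw [this]; exact mul_neg_of_neg_of_pos hn (sq_pos_of_ne_zero hn.ne)
      nlinarith [sq_nonneg z.G, mul_nonneg (by linarith : 0 ≤ -z.D) (sq_nonneg z.a)]
    have hA : 0 < x.hA := by
      refine lt_of_le_of_ne (hApos x hneg) ?_
      intro h
      have : x.D = x.hB ^ 2 := by simp only [D, ← h]; ring
      nlinarith [sq_nonneg x.hB]
    obtain ⟨u, v, huv, hle⟩ := small_value x.hA x.hB x.hC r (by exact_mod_cast hA) hr0 (by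
      rw [hr2, abs_of_neg hneg']; simp only [D]; push_cast; ring)
    obtain ⟨y, hE, hya, hyA⟩ := exists_T_of_coprime x huv
    refine ⟨y, hE, Or.inr ?_⟩
    have hyA' : (y.hA : ℝ) ≤ 5 / 4 * r := by rw [hyA]; push_cast; exact hle
    have hy0 : (0 : ℝ) ≤ y.hA := by exact_mod_cast hApos y (by rw [E_D hE]; exact hneg)
    have hyD : (y.D : ℝ) = - r ^ 2 := by
      rw [hr2, abs_of_neg hneg', E_D hE]; ring
    constructor
    · have hs : (y.G : ℝ) ^ 2 - y.D * y.a ^ 2 = 4 * y.hA ^ 3 := by exact_mod_cast syzygy y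
      rw [hyD] at hs
      have h4 : (y.hA : ℝ) ^ 3 ≤ (5 / 4 * r) ^ 3 := by gcongr
      have h5 : r ^ 2 * (y.a : ℝ) ^ 2 ≤ r ^ 2 * (8 * r) := by nlinarith [sq_nonneg (y.G : ℝ), pow_pos hr0 3]
      have h6 := le_of_mul_le_mul_left h5 (by positivity)
      nlinarith
    · rw [abs_of_nonneg hy0]; nlinarith
  · -- positive
    have hpos' : (0 : ℝ) < x.D := by exact_mod_cast hpos
    rw [abs_of_pos hpos'] at hr2
    obtain ⟨t, ht⟩ := exists_root x.a x.b x.c x.d ha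
    set A : ℝ := (x.a : ℝ) with hAdef
    set b : ℝ := x.b + A * t with hb
    set c : ℝ := x.c + 2 * x.b * t + A * t ^ 2 with hc
    set δ : ℝ := 4 * A * c - 3 * b ^ 2 with hδ
    have hd : (x.d : ℝ) = - (A * t ^ 3 + 3 * x.b * t ^ 2 + 3 * x.c * t) := by linarith
    have hDc : (x.D : ℝ) = c ^ 2 * δ := by
      simp only [D, Fm.hA, hB, hC]; push_cast; rw [hd, hδ, hc, hb]; ring
    have hc0 : c ≠ 0 := by
      intro h; rw [h] at hDc; simp at hDc; exact hDR (by exact_mod_cast hDc)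
    have hc2 : 0 < c ^ 2 := by positivity
    have hδ0 : 0 < δ := by
      by_contra hn; push Not at hn
      nlinarith
    have hP : 0 < c * A + δ := by
      have : 0 < 4 * (c * A) := by nlinarith [sq_nonneg b]
      linarith
    set r' := Real.sqrt 15 * r with hr'
    have h15 : Real.sqrt 15 ≤ 4 := by rw [Real.sqrt_le_iff]; norm_num
    have h15' : 0 < Real.sqrt 15 := Real.sqrt_pos.2 (by norm_num)
    have hr'2 : r' ^ 2 = 15 * (c ^ 2 * δ) := by
      rw [hr', mul_pow, Real.sq_sqrt (by norm_num), hr2, hDc]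
    -- psi in terms of (u,v)
    obtain ⟨u, v, huv, hle⟩ := small_value (c * A + δ) (3 * b * c - 2 * t * (c * A + δ))
      (3 * c ^ 2 - 3 * b * c * t + (c * A + δ) * t ^ 2) r' hP (by positivity) (by
        rw [hr'2, hδ]; ring)
    obtain ⟨y, hE, hya, hyA⟩ := exists_T_of_coprime x huv
    refine ⟨y, hE, Or.inr ?_⟩
    set U : ℝ := u - t * v with hU
    set Qv : ℝ := A * U ^ 2 + 3 * b * U * v + 3 * c * v ^ 2 with hQ
    have hcQ : 0 ≤ c * Qv := by
      have e : 12 * c ^ 2 * (c * Qv) = (c * (3 * b * U + 6 * c * v)) ^ 2 + 3 * c ^ 2 * δ * U ^ 2 := by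
        rw [hQ, hδ]; ring
      have : 0 ≤ 12 * c ^ 2 * (c * Qv) := by rw [e]; positivity
      exact nonneg_of_mul_nonneg_right this (by positivity)
    have hs0 : 0 ≤ δ * U ^ 2 := by positivity
    have hpsi : δ * U ^ 2 + c * Qv ≤ 5 * r := by
      have e : δ * U ^ 2 + c * Qv = (c * A + δ) * (u : ℝ) ^ 2 + (3 * b * c - 2 * t * (c * A + δ)) * u * v
        + (3 * c ^ 2 - 3 * b * c * t + (c * A + δ) * t ^ 2) * v ^ 2 := by
        rw [hQ, hU]; ring
      rw [e]; refine hle.trans ?_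
      rw [hr']; have := mul_le_mul_of_nonneg_right h15 hr0.le; linarith
    have hyaR : (y.a : ℝ) = U * Qv := by
      rw [hya]; simp only [ev]; push_cast; rw [hd, hQ, hU, hc, hb]; ring
    have hyAR : (y.hA : ℝ) = (c * Qv - δ * U ^ 2) / 3 := by
      rw [hyA]; simp only [Fm.hA, hB, hC]; push_cast; rw [hd, hQ, hδ, hU, hc, hb]; ring
    constructor
    · have h1 := st2_le (δ * U ^ 2) (c * Qv) hs0 hcQ
      have h2 : (δ * U ^ 2 + c * Qv) ^ 3 ≤ (5 * r) ^ 3 := by gcongr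
      have h3 : r ^ 2 * (y.a : ℝ) ^ 2 ≤ r ^ 2 * (125 * r) := by
        rw [hr2, hDc, hyaR]
        have : (5 * r) ^ 3 = (c ^ 2 * δ) * (125 * r) := by
          rw [← hDc, ← hr2]; ring
        have e6 : c ^ 2 * δ * (U * Qv) ^ 2 = δ * U ^ 2 * (c * Qv) ^ 2 := by ring
        rw [← this, e6]; exact h1.trans h2
      have h4 := le_of_mul_le_mul_left h3 (by positivity)
      linarith
    · rw [hyAR, abs_le]; constructor <;> linarith
end DCB

end

section
namespace DCB
open Fm

theorem card_spread (s : Finset ℤ) (L : ℝ) (hL : 0 ≤ L)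
    (h : ∀ x ∈ s, ∀ y ∈ s, |(x : ℝ) - y| ≤ L) : (s.card : ℝ) ≤ 1 + L := by
  rcases s.eq_empty_or_nonempty with rfl | hs
  · simp; linarith
  have h1 := h _ (s.max'_mem hs) _ (s.min'_mem hs)
  have h2 : s ⊆ Finset.Icc (s.min' hs) (s.max' hs) := by
    intro x hx
    exact Finset.mem_Icc.2 ⟨s.min'_le x hx, s.le_max' x hx⟩
  have h3 := Finset.card_le_card h2
  rw [Int.card_Icc] at h3
  have h4 : s.min' hs ≤ s.max' hs := s.min'_le _ (s.max'_mem hs)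
  have h5 : (s.card : ℤ) ≤ s.max' hs + 1 - s.min' hs := by omega
  have h6 : (s.card : ℝ) ≤ s.max' hs + 1 - s.min' hs := by exact_mod_cast h5
  have := le_abs_self ((s.max' hs : ℝ) - s.min' hs)
  linarith

/-- fiberwise bound with a sum of real bounds -/
theorem card_le_sum_fib {α β : Type*} (S : Finset α) (t : Finset β) (f : α → β)
    (w : β → ℝ) (hf : ∀ x ∈ S, f x ∈ t)
    (hw : ∀ b ∈ t, ∀ F : Finset α, (∀ x ∈ F, x ∈ S ∧ f x = b) → (F.card : ℝ) ≤ w b) :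
    (S.card : ℝ) ≤ ∑ b ∈ t, w b := by
  rw [Finset.card_eq_sum_card_fiberwise hf]
  push_cast
  exact Finset.sum_le_sum (fun b hb => hw b hb _ (fun x hx => Finset.mem_filter.1 hx))

theorem card_le_mul_fib {α β : Type*} (S : Finset α) (t : Finset β) (f : α → β)
    (w : ℝ) (hf : ∀ x ∈ S, f x ∈ t)
    (hw : ∀ b ∈ t, ∀ F : Finset α, (∀ x ∈ F, x ∈ S ∧ f x = b) → (F.card : ℝ) ≤ w) :
    (S.card : ℝ) ≤ t.card * w := by
  have := card_le_sum_fib S t f (fun _ => w) hf hw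
  simpa using this

/-- injective map to integers of bounded spread -/
theorem card_spread_map {α : Type*} (S : Finset α) (f : α → ℤ) (L : ℝ) (hL : 0 ≤ L)
    (hf : ∀ x ∈ S, ∀ y ∈ S, f x = f y → x = y)
    (h : ∀ x ∈ S, ∀ y ∈ S, |(f x : ℝ) - f y| ≤ L) : (S.card : ℝ) ≤ 1 + L := by
  rw [← Finset.card_image_of_injOn (s := S) (f := f) (fun x hx y hy => hf x hx y hy)]
  apply card_spread _ _ hL
  intro x hx y hy
  obtain ⟨x', hx', rfl⟩ := Finset.mem_image.1 hx
  obtain ⟨y', hy', rfl⟩ := Finset.mem_image.1 hy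
  exact h x' hx' y' hy'

theorem sum_inv_sq_le (N : ℕ) : ∑ k ∈ Finset.Icc 1 N, (1 : ℝ) / (k : ℝ) ^ 2 ≤ 2 := by
  have : ∑ k ∈ Finset.Icc 1 N, (1 : ℝ) / (k : ℝ) ^ 2 ≤ 2 - 2 / ((N : ℝ) + 1) := by
    induction N with
    | zero => simp
    | succ n ih =>
      rw [Finset.sum_Icc_succ_top (by omega)]; push_cast at ih ⊢
      have : 1 / ((n : ℝ) + 1) ^ 2 ≤ 2 / ((n : ℝ) + 1) - 2 / ((n : ℝ) + 1 + 1) := by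
        rw [div_sub_div _ _ (by positivity) (by positivity), div_le_div_iff₀ (by positivity) (by positivity)]
        nlinarith [(Nat.cast_nonneg n : (0 : ℝ) ≤ n)]
      linarith
  have h2 : 0 ≤ 2 / ((N : ℝ) + 1) := by positivity
  linarith

theorem count_azero_aux (S : Finset Fm) (Λ : ℕ)
    (hS : ∀ x ∈ S, x.a = 0 ∧ 0 ≤ x.c ∧ x.c < 2 * |x.b| ∧ x.D ≠ 0 ∧ |x.D| ≤ (Λ : ℤ) ^ 4)
    (hs : ∀ x ∈ S, ∀ y ∈ S, 0 < x.b * y.b) : (S.card : ℝ) ≤ 4 * (Λ : ℝ) ^ 4 := by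
  have hD : ∀ x : Fm, x.a = 0 → x.D = x.b ^ 2 * (4 * x.b * x.d - 3 * x.c ^ 2) := by
    intro x h; simp only [D, hA, hB, hC, h]; ring
  have h1 := card_le_sum_fib S (Finset.Icc 1 (Λ ^ 2)) (fun x => x.b.natAbs)
    (fun k => 2 * (k : ℝ) * (1 + (Λ : ℝ) ^ 4 / (2 * (k : ℝ) ^ 3))) (by
      intro x hx
      obtain ⟨ha, hc, hcb, hD0, hDL⟩ := hS x hx
      have hb0 : x.b ≠ 0 := by
        have := hs x hx x hx
        intro h; rw [h] at this; simp at this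
      rw [Finset.mem_Icc]
      refine ⟨Int.natAbs_pos.2 hb0, ?_⟩
      rw [hD x ha] at hD0 hDL
      have h2 : 4 * x.b * x.d - 3 * x.c ^ 2 ≠ 0 := right_ne_zero_of_mul hD0
      rw [abs_mul] at hDL
      have h3 : 1 ≤ |4 * x.b * x.d - 3 * x.c ^ 2| := Int.one_le_abs h2
      have h4 : x.b ^ 2 ≤ ((Λ : ℤ) ^ 2) ^ 2 := by
        rw [abs_of_nonneg (sq_nonneg x.b)] at hDL
        nlinarith [sq_nonneg x.b]
      have h5 := abs_le_of_sq_le_sq h4 (by positivity)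
      have h6 : ((x.b.natAbs : ℕ) : ℤ) ≤ ((Λ ^ 2 : ℕ) : ℤ) := by
        rw [Int.natCast_natAbs]; push_cast; exact h5
      exact_mod_cast h6) (by
      intro k hk F hF
      have hk1 : 1 ≤ k := (Finset.mem_Icc.1 hk).1
      have hkR : (0 : ℝ) < k := by exact_mod_cast hk1
      refine (card_le_mul_fib _ (Finset.Ico (0 : ℤ) (2 * k)) (fun x => x.c)
        (1 + (Λ : ℝ) ^ 4 / (2 * (k : ℝ) ^ 3)) ?_ ?_).trans ?_
      · intro x hx
        obtain ⟨hx, hxk⟩ := hF x hx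
        obtain ⟨ha, hc, hcb, hD0, hDL⟩ := hS x hx
        rw [Finset.mem_Ico]; refine ⟨hc, ?_⟩
        rw [← hxk, Int.natCast_natAbs]; exact hcb
      · intro c hc F' hF'
        have hsame : ∀ x ∈ F', ∀ y ∈ F',
            x.a = y.a ∧ x.b = y.b ∧ x.c = y.c := by
          intro x hx y hy
          obtain ⟨hx, hxc⟩ := hF' x hx
          obtain ⟨hy, hyc⟩ := hF' y hy
          obtain ⟨hx, hxk⟩ := hF x hx
          obtain ⟨hy, hyk⟩ := hF y hy
          refine ⟨by rw [(hS x hx).1, (hS y hy).1], ?_, by rw [hxc, hyc]⟩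
          rcases Int.natAbs_eq_natAbs_iff.1 (hxk.trans hyk.symm) with h | h
          · exact h
          · have := hs x hx y hy
            rw [h] at this; nlinarith [sq_nonneg y.b]
        apply card_spread_map _ (fun x => x.d) _ (by positivity)
        · intro x hx y hy hxy
          obtain ⟨h1, h2, h3⟩ := hsame x hx y hy
          exact Fm.ext h1 h2 h3 hxy
        · intro x hx y hy
          obtain ⟨h1, h2, h3⟩ := hsame x hx y hy
          obtain ⟨hx, hxc⟩ := hF' x hx
          obtain ⟨hy, hyc⟩ := hF' y hy
          obtain ⟨hx, hxk⟩ := hF x hx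
          obtain ⟨hy, hyk⟩ := hF y hy
          have e : x.D - y.D = 4 * x.b ^ 3 * (x.d - y.d) := by
            rw [hD x (hS x hx).1, hD y (hS y hy).1, h2, h3]; ring
          have e2 : |x.D - y.D| ≤ 2 * (Λ : ℤ) ^ 4 :=
            (abs_sub _ _).trans (by linarith [(hS x hx).2.2.2.2, (hS y hy).2.2.2.2])
          rw [e, abs_mul, abs_mul, abs_pow] at e2
          have hbk : |x.b| = (k : ℤ) := by rw [← hxk, Int.natCast_natAbs]
          rw [hbk] at e2
          have e3 : 4 * (k : ℝ) ^ 3 * |(x.d : ℝ) - y.d| ≤ 2 * (Λ : ℝ) ^ 4 := by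
            have : ((|4| * (k : ℤ) ^ 3 * |x.d - y.d| : ℤ) : ℝ) ≤ ((2 * (Λ : ℤ) ^ 4 : ℤ) : ℝ) := by
              exact_mod_cast e2
            push_cast at this
            simpa using this
          show |(x.d : ℝ) - y.d| ≤ _
          rw [le_div_iff₀ (by positivity)]
          linarith
      · rw [Int.card_Ico]
        have : (((2 * (k : ℤ) - 0).toNat : ℕ) : ℝ) = 2 * k := by
          have : (2 * (k : ℤ) - 0).toNat = 2 * k := by omega
          rw [this]; push_cast; ring
        rw [this])
  refine h1.trans ?_
  have h2 : ∀ k ∈ Finset.Icc 1 (Λ ^ 2), 2 * (k : ℝ) * (1 + (Λ : ℝ) ^ 4 / (2 * (k : ℝ) ^ 3))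
      ≤ 2 * (Λ : ℝ) ^ 2 + (Λ : ℝ) ^ 4 * (1 / (k : ℝ) ^ 2) := by
    intro k hk
    obtain ⟨hk1, hk2⟩ := Finset.mem_Icc.1 hk
    have hkR : (0 : ℝ) < k := by exact_mod_cast hk1
    have hk2' : (k : ℝ) ≤ (Λ : ℝ) ^ 2 := by exact_mod_cast hk2
    have : 2 * (k : ℝ) * (1 + (Λ : ℝ) ^ 4 / (2 * (k : ℝ) ^ 3)) = 2 * k + (Λ : ℝ) ^ 4 * (1 / (k : ℝ) ^ 2) := by
      field_simp
    rw [this]; linarith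
  refine (Finset.sum_le_sum h2).trans ?_
  rw [Finset.sum_add_distrib, Finset.sum_const, Nat.card_Icc, ← Finset.mul_sum]
  have := sum_inv_sq_le (Λ ^ 2)
  have h3 : (0 : ℝ) ≤ (Λ : ℝ) ^ 4 := by positivity
  simp only [nsmul_eq_mul, add_tsub_cancel_right]; push_cast
  nlinarith

theorem count_azero (S : Finset Fm) (Λ : ℕ)
    (hS : ∀ x ∈ S, x.a = 0 ∧ 0 ≤ x.c ∧ x.c < 2 * |x.b| ∧ x.D ≠ 0 ∧ |x.D| ≤ (Λ : ℤ) ^ 4) :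
    (S.card : ℝ) ≤ 8 * (Λ : ℝ) ^ 4 := by
  have hb : ∀ x ∈ S, x.b ≠ 0 := by
    intro x hx h
    have := hS x hx
    rw [h] at this; simp at this; omega
  have h1 := count_azero_aux (S.filter (fun x => 0 < x.b)) Λ
    (fun x hx => hS x (Finset.mem_filter.1 hx).1)
    (fun x hx y hy => mul_pos (Finset.mem_filter.1 hx).2 (Finset.mem_filter.1 hy).2)
  have h2 := count_azero_aux (S.filter (fun x => ¬ 0 < x.b)) Λ
    (fun x hx => hS x (Finset.mem_filter.1 hx).1)
    (fun x hx y hy => by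
      have hx' := Finset.mem_filter.1 hx
      have hy' := Finset.mem_filter.1 hy
      have h3 := hb x hx'.1
      have h4 := hb y hy'.1
      exact mul_pos_of_neg_of_neg (by omega) (by omega))
  have h3 := Finset.card_filter_add_card_filter_not (s := S) (fun x => 0 < x.b)
  have h4 : (S.card : ℝ) = (S.filter (fun x => 0 < x.b)).card + (S.filter (fun x => ¬ 0 < x.b)).card := by
    exact_mod_cast h3.symm
  linarith
end DCB

end

section
namespace DCB
open Fm

theorem sq_gap (g h K R : ℝ) (h1 : |g ^ 2 - K| ≤ R) (h2 : |h ^ 2 - K| ≤ R) (hs : 0 ≤ g * h) :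
    (g - h) ^ 2 ≤ 2 * R ∧ (g - h) ^ 2 * |K| ≤ 4 * R ^ 2 := by
  rw [abs_le] at h1 h2
  have hR : 0 ≤ R := by linarith
  have hst : |(g - h) * (g + h)| ≤ 2 * R := by
    rw [abs_le]; constructor <;> nlinarith
  have hle : |g - h| ≤ |g + h| := by
    apply sq_le_sq.1; nlinarith
  have hs2 : (g - h) ^ 2 ≤ 2 * R := by
    rw [← sq_abs]; rw [abs_mul] at hst
    nlinarith [abs_nonneg (g - h)]
  refine ⟨hs2, ?_⟩
  by_cases hK : |K| ≤ 2 * R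
  · have := mul_le_mul hs2 hK (abs_nonneg _) (by positivity)
    nlinarith
  · push Not at hK
    have hK0 : 0 < K := by
      by_contra hn; push Not at hn
      rw [abs_of_nonpos hn] at hK
      nlinarith [sq_nonneg g]
    rw [abs_of_pos hK0] at hK ⊢
    have ht : K ≤ (g + h) ^ 2 := by nlinarith
    have h3 : ((g - h) * (g + h)) ^ 2 ≤ (2 * R) ^ 2 := by
      rw [← sq_abs]; gcongr
    have h4 : (g - h) ^ 2 * K ≤ (g - h) ^ 2 * (g + h) ^ 2 := by gcongr
    nlinarith

theorem d_gap (x y : Fm) (L : ℝ) (h1 : |(x.D : ℝ)| ≤ L ^ 4) (h2 : |(y.D : ℝ)| ≤ L ^ 4)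
    (ha : x.a = y.a) (hb : x.b = y.b) (hc : x.c = y.c) (ha0 : x.a ≠ 0) (hs : 0 ≤ x.G * y.G) :
    (x.a : ℝ) ^ 2 * ((x.d : ℝ) - y.d) ^ 2 ≤ 2 * L ^ 4 ∧
    ((x.d : ℝ) - y.d) ^ 2 * |(x.hA : ℝ)| ^ 3 ≤ L ^ 8 := by
  have hA : y.hA = x.hA := by simp only [Fm.hA, ha, hb, hc]
  have s1 : (x.G : ℝ) ^ 2 - x.D * x.a ^ 2 = 4 * x.hA ^ 3 := by exact_mod_cast syzygy x
  have s2 : (y.G : ℝ) ^ 2 - y.D * x.a ^ 2 = 4 * x.hA ^ 3 := by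
    rw [← hA, ha]; exact_mod_cast syzygy y
  have e1 : |(x.G : ℝ) ^ 2 - 4 * x.hA ^ 3| ≤ L ^ 4 * x.a ^ 2 := by
    rw [show (x.G : ℝ) ^ 2 - 4 * x.hA ^ 3 = x.D * x.a ^ 2 by linarith, abs_mul, abs_of_nonneg (sq_nonneg (x.a : ℝ))]
    gcongr
  have e2 : |(y.G : ℝ) ^ 2 - 4 * x.hA ^ 3| ≤ L ^ 4 * x.a ^ 2 := by
    rw [show (y.G : ℝ) ^ 2 - 4 * x.hA ^ 3 = y.D * x.a ^ 2 by linarith, abs_mul, abs_of_nonneg (sq_nonneg (x.a : ℝ))]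
    gcongr
  obtain ⟨g1, g2⟩ := sq_gap _ _ _ _ e1 e2 (by exact_mod_cast hs)
  have e3 : (x.G : ℝ) - y.G = x.a ^ 2 * (x.d - y.d) := by
    have : x.G - y.G = x.a ^ 2 * (x.d - y.d) := by
      simp only [G, Fm.hA, hB, ha, hb, hc]; ring
    exact_mod_cast this
  rw [e3] at g1 g2
  have haR : (0 : ℝ) < x.a ^ 2 := by
    have : (x.a : ℝ) ≠ 0 := by exact_mod_cast ha0
    positivity
  constructor
  · have : (x.a : ℝ) ^ 2 * ((x.a : ℝ) ^ 2 * ((x.d : ℝ) - y.d) ^ 2) ≤ (x.a : ℝ) ^ 2 * (2 * L ^ 4) := by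
      nlinarith
    exact le_of_mul_le_mul_left this haR
  · have : ((x.a : ℝ) ^ 2) ^ 2 * (4 * (((x.d : ℝ) - y.d) ^ 2 * |(x.hA : ℝ)| ^ 3))
        ≤ ((x.a : ℝ) ^ 2) ^ 2 * (4 * L ^ 8) := by
      rw [abs_mul, abs_pow] at g2
      norm_num at g2
      nlinarith
    have := le_of_mul_le_mul_left this (by positivity)
    linarith

theorem sum_32 (L J : ℕ) (hL : 1 ≤ L) :
    ∑ j ∈ Finset.Icc L J, 1 / ((j : ℝ) * Real.sqrt j) ≤ 3 / Real.sqrt L := by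
  have hLR : (1 : ℝ) ≤ L := by exact_mod_cast hL
  have hsL : 0 < Real.sqrt L := Real.sqrt_pos.2 (by linarith)
  by_cases hJ : L ≤ J
  · suffices h : ∑ j ∈ Finset.Icc L J, 1 / ((j : ℝ) * Real.sqrt j) ≤ 3 / Real.sqrt L - 2 / Real.sqrt J by
      have : 0 ≤ 2 / Real.sqrt (J : ℝ) := by positivity
      linarith
    induction J, hJ using Nat.le_induction with
    | base =>
      simp only [Finset.Icc_self, Finset.sum_singleton]
      rw [← sub_div, show (3 : ℝ) - 2 = 1 by norm_num]
      gcongr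
      nlinarith
    | succ n hn ih =>
      rw [Finset.sum_Icc_succ_top (by omega)]
      have hnR : (1 : ℝ) ≤ n := by exact_mod_cast hL.trans hn
      set p := Real.sqrt (n : ℝ) with hp
      set q := Real.sqrt ((n + 1 : ℕ) : ℝ) with hq
      have hp0 : 0 < p := Real.sqrt_pos.2 (by linarith)
      have hq0 : 0 < q := Real.sqrt_pos.2 (by push_cast; linarith)
      have hp2 : p ^ 2 = n := Real.sq_sqrt (by linarith)
      have hq2 : q ^ 2 = n + 1 := by rw [hq, Real.sq_sqrt (by positivity)]; push_cast; ring
      have hpq : p ≤ q := by rw [hp, hq]; apply Real.sqrt_le_sqrt; push_cast; linarith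
      have h1 : 1 / (((n + 1 : ℕ) : ℝ) * q) ≤ 2 / p - 2 / q := by
        have e : ((n + 1 : ℕ) : ℝ) = q ^ 2 := by rw [hq2]; push_cast; ring
        have e2 : (q - p) * (q + p) = 1 := by nlinarith
        have e3 : 2 / p - 2 / q = 2 * ((q - p) * (q + p)) / (p * q * (q + p)) := by
          field_simp
        rw [e, e3, e2, div_le_div_iff₀ (by positivity) (by positivity)]
        have : p * (q + p) ≤ q * (q + q) := by gcongr
        nlinarith
      linarith
  · rw [Finset.Icc_eq_empty (by omega)]; simp; positivity

theorem sum_12 (N : ℕ) : ∑ k ∈ Finset.Icc 1 N, 1 / Real.sqrt (k : ℝ) ≤ 2 * Real.sqrt N := by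
  induction N with
  | zero => simp
  | succ n ih =>
    rw [Finset.sum_Icc_succ_top (by omega)]
    set p := Real.sqrt (n : ℝ) with hp
    set q := Real.sqrt ((n + 1 : ℕ) : ℝ) with hq
    have hp0 : 0 ≤ p := Real.sqrt_nonneg _
    have hq0 : 0 < q := Real.sqrt_pos.2 (by positivity)
    have hp2 : p ^ 2 = n := Real.sq_sqrt (by positivity)
    have hq2 : q ^ 2 = n + 1 := by rw [hq, Real.sq_sqrt (by positivity)]; push_cast; ring
    have : 1 / q ≤ 2 * q - 2 * p := by
      rw [div_le_iff₀ hq0]; nlinarith [sq_nonneg (q - p)]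
    linarith

/-- the count for fixed `a, b` -/
theorem count_ab (S : Finset Fm) (Λ k : ℕ) (hΛ : 1 ≤ Λ) (hk : 1 ≤ k)
    (hS : ∀ x ∈ S, |(x.hA : ℝ)| ≤ 2 * (Λ : ℝ) ^ 2 ∧ |(x.D : ℝ)| ≤ (Λ : ℝ) ^ 4 ∧ x.a.natAbs = k)
    (hab : ∀ x ∈ S, ∀ y ∈ S, x.a = y.a ∧ x.b = y.b)
    (hs : ∀ x ∈ S, ∀ y ∈ S, 0 ≤ x.G * y.G ∧ 0 ≤ x.hA * y.hA) :
    (S.card : ℝ) ≤ (1 + 2 * Λ) * (1 + 3 / 2 * (Λ : ℝ) ^ 2 / k) + 2 * (Λ : ℝ) ^ 2 / k +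
      (Λ : ℝ) ^ 4 / (k * Real.sqrt k) * (3 / Real.sqrt Λ) := by
  have hkR : (1 : ℝ) ≤ k := by exact_mod_cast hk
  have hk0 : (0 : ℝ) < k := by linarith
  have hΛR : (1 : ℝ) ≤ Λ := by exact_mod_cast hΛ
  have habs : ∀ x ∈ S, |(x.a : ℝ)| = k := by
    intro x hx
    rw [← (hS x hx).2.2]
    rw [Nat.cast_natAbs, Int.cast_abs]
  have ha0 : ∀ x ∈ S, x.a ≠ 0 := by
    intro x hx h; have := (hS x hx).2.2; rw [h] at this; simp at this; omega
  have hAc : ∀ x ∈ S, ∀ y ∈ S, |(x.hA : ℝ) - y.hA| = k * |(x.c : ℝ) - y.c| := by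
    intro x hx y hy
    have e : x.hA - y.hA = - (x.a * (x.c - y.c)) := by
      simp only [Fm.hA, (hab x hx y hy).1, (hab x hx y hy).2]; ring
    have e' : (x.hA : ℝ) - y.hA = - (x.a * ((x.c : ℝ) - y.c)) := by exact_mod_cast e
    rw [e', abs_neg, abs_mul, habs x hx]
  have p1 : ((S.filter (fun x => |(x.hA : ℝ)| ≤ Λ * k)).card : ℝ) ≤
      (1 + 2 * Λ) * (1 + 3 / 2 * (Λ : ℝ) ^ 2 / k) := by
    refine (card_le_mul_fib _ ((S.filter (fun x => |(x.hA : ℝ)| ≤ Λ * k)).image (fun x => x.c))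
      (fun x => x.c) (1 + 3 / 2 * (Λ : ℝ) ^ 2 / k) (fun x hx => Finset.mem_image_of_mem _ hx) ?_).trans ?_
    · intro c _ F hF
      have hF' : ∀ x ∈ F, x ∈ S ∧ x.c = c := fun x hx => ⟨(Finset.mem_filter.1 (hF x hx).1).1, (hF x hx).2⟩
      apply card_spread_map _ (fun x => x.d) _ (by positivity)
      · intro x hx y hy hxy
        obtain ⟨hx, hxc⟩ := hF' x hx
        obtain ⟨hy, hyc⟩ := hF' y hy
        exact Fm.ext (hab x hx y hy).1 (hab x hx y hy).2 (hxc.trans hyc.symm) hxy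
      · intro x hx y hy
        obtain ⟨hx, hxc⟩ := hF' x hx
        obtain ⟨hy, hyc⟩ := hF' y hy
        have := (d_gap x y Λ (hS x hx).2.1 (hS y hy).2.1 (hab x hx y hy).1 (hab x hx y hy).2
          (hxc.trans hyc.symm) (ha0 x hx) (hs x hx y hy).1).1
        rw [← sq_abs, habs x hx] at this
        apply abs_le_of_sq_le_sq _ (by positivity)
        show ((x.d : ℝ) - y.d) ^ 2 ≤ _
        rw [div_pow, le_div_iff₀ (by positivity)]
        nlinarith [pow_nonneg (by linarith : (0 : ℝ) ≤ Λ) 4]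
    · gcongr
      apply card_spread _ _ (by positivity)
      intro c hc c' hc'
      obtain ⟨x, hx, rfl⟩ := Finset.mem_image.1 hc
      obtain ⟨y, hy, rfl⟩ := Finset.mem_image.1 hc'
      obtain ⟨hx, hx2⟩ := Finset.mem_filter.1 hx
      obtain ⟨hy, hy2⟩ := Finset.mem_filter.1 hy
      have h1 := hAc x hx y hy
      have h2 := abs_sub (x.hA : ℝ) y.hA
      have h3 : (k : ℝ) * |(x.c : ℝ) - y.c| ≤ k * (2 * Λ) := by linarith
      exact le_of_mul_le_mul_left h3 hk0
  have p2 : ((S.filter (fun x => ¬ |(x.hA : ℝ)| ≤ Λ * k)).card : ℝ) ≤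
      2 * (Λ : ℝ) ^ 2 / k + (Λ : ℝ) ^ 4 / (k * Real.sqrt k) * (3 / Real.sqrt Λ) := by
    have hcast : ∀ x : Fm, |(x.hA : ℝ)| = (x.hA.natAbs : ℕ) := by
      intro x; rw [Nat.cast_natAbs, Int.cast_abs]
    refine (card_le_sum_fib _ (Finset.Icc Λ (2 * Λ ^ 2 / k)) (fun x => x.hA.natAbs / k)
      (fun j => 1 + (Λ : ℝ) ^ 4 / (k * Real.sqrt k) * (1 / (j * Real.sqrt j))) ?_ ?_).trans ?_
    · intro x hx
      obtain ⟨hx, hx2⟩ := Finset.mem_filter.1 hx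
      push Not at hx2
      have h1 := (hS x hx).1
      rw [hcast] at hx2 h1
      have hx2' : Λ * k < x.hA.natAbs := by exact_mod_cast hx2
      have h1' : x.hA.natAbs ≤ 2 * Λ ^ 2 := by exact_mod_cast h1
      rw [Finset.mem_Icc]
      exact ⟨(Nat.le_div_iff_mul_le (by omega)).2 hx2'.le, Nat.div_le_div_right h1'⟩
    · intro j hj F hF
      have hj1 : 1 ≤ j := hΛ.trans (Finset.mem_Icc.1 hj).1
      have hjR : (1 : ℝ) ≤ j := by exact_mod_cast hj1
      have hF' : ∀ x ∈ F, x ∈ S ∧ (j : ℝ) * k ≤ |(x.hA : ℝ)| ∧ |(x.hA : ℝ)| < (j + 1) * k := by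
        intro x hx
        have h1 := (hF x hx).2
        refine ⟨(Finset.mem_filter.1 (hF x hx).1).1, ?_, ?_⟩
        · rw [hcast]
          have : j * k ≤ x.hA.natAbs := by rw [← h1]; exact Nat.div_mul_le_self _ _
          exact_mod_cast this
        · rw [hcast]
          have : x.hA.natAbs < (j + 1) * k := by
            rw [← h1]; exact (Nat.div_lt_iff_lt_mul (by omega)).1 (by omega)
          exact_mod_cast this
      have hcc : ∀ x ∈ F, ∀ y ∈ F, x.c = y.c := by
        intro x hx y hy
        obtain ⟨hx, hx1, hx2⟩ := hF' x hx
        obtain ⟨hy, hy1, hy2⟩ := hF' y hy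
        have h1 := hAc x hx y hy
        have h2 : |(x.hA : ℝ) - y.hA| < k := by
          have h3 : (0 : ℝ) ≤ x.hA * y.hA := by exact_mod_cast (hs x hx y hy).2
          have h4 : |(x.hA : ℝ) - y.hA| = |(|(x.hA : ℝ)| - |(y.hA : ℝ)|)| := by
            rcases le_total 0 (x.hA : ℝ) with h5 | h5 <;> rcases le_total 0 (y.hA : ℝ) with h6 | h6
            · rw [abs_of_nonneg h5, abs_of_nonneg h6]
            · have : (x.hA : ℝ) * y.hA = 0 := le_antisymm (mul_nonpos_of_nonneg_of_nonpos h5 h6) h3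
              have hjk : (0 : ℝ) < j * k := by positivity
              rcases mul_eq_zero.1 this with h7 | h7
              · rw [h7] at hx1; simp at hx1; linarith
              · rw [h7] at hy1; simp at hy1; linarith
            · have : (x.hA : ℝ) * y.hA = 0 := le_antisymm (mul_nonpos_of_nonpos_of_nonneg h5 h6) h3
              have hjk : (0 : ℝ) < j * k := by positivity
              rcases mul_eq_zero.1 this with h7 | h7
              · rw [h7] at hx1; simp at hx1; linarith
              · rw [h7] at hy1; simp at hy1; linarith
            · rw [abs_of_nonpos h5, abs_of_nonpos h6, ← abs_neg]; ring_nf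
          rw [h4, abs_lt]; constructor <;> linarith
        rw [h1] at h2
        have h3 : |(x.c : ℝ) - y.c| < 1 := by
          by_contra hn; push Not at hn; nlinarith
        have h4 : |x.c - y.c| < 1 := by exact_mod_cast h3
        have := Int.abs_lt_one_iff.1 h4
        omega
      apply card_spread_map _ (fun x => x.d) _ (by positivity)
      · intro x hx y hy hxy
        have hx' := (hF' x hx).1
        have hy' := (hF' y hy).1
        exact Fm.ext (hab x hx' y hy').1 (hab x hx' y hy').2 (hcc x hx y hy) hxy
      · intro x hx y hy
        have hx' := (hF' x hx).1
        have hy' := (hF' y hy).1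
        have h1 := (d_gap x y Λ (hS x hx').2.1 (hS y hy').2.1 (hab x hx' y hy').1 (hab x hx' y hy').2
          (hcc x hx y hy) (ha0 x hx') (hs x hx' y hy').1).2
        have h2 : ((j : ℝ) * k) ^ 3 ≤ |(x.hA : ℝ)| ^ 3 := by
          have := (hF' x hx).2.1
          gcongr
        apply abs_le_of_sq_le_sq _ (by positivity)
        show ((x.d : ℝ) - y.d) ^ 2 ≤ _
        have hsk : Real.sqrt k ^ 2 = (k : ℝ) := Real.sq_sqrt (by positivity)
        have hsj : Real.sqrt j ^ 2 = (j : ℝ) := Real.sq_sqrt (by positivity)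
        have e : ((Λ : ℝ) ^ 4 / (k * Real.sqrt k) * (1 / (j * Real.sqrt j))) ^ 2
            = (Λ : ℝ) ^ 8 / ((j : ℝ) * k) ^ 3 := by
          rw [mul_pow, div_pow, div_pow, mul_pow, mul_pow, hsk, hsj]
          field_simp
        rw [e, le_div_iff₀ (by positivity)]
        have : ((x.d : ℝ) - y.d) ^ 2 * ((j : ℝ) * k) ^ 3 ≤ ((x.d : ℝ) - y.d) ^ 2 * |(x.hA : ℝ)| ^ 3 := by
          gcongr
        linarith
    · rw [Finset.sum_add_distrib, Finset.sum_const, Nat.card_Icc, ← Finset.mul_sum]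
      apply add_le_add
      · simp only [nsmul_eq_mul, mul_one]
        have h1 : 2 * Λ ^ 2 / k + 1 - Λ ≤ 2 * Λ ^ 2 / k := by generalize 2 * Λ ^ 2 / k = z; omega
        calc ((2 * Λ ^ 2 / k + 1 - Λ : ℕ) : ℝ) ≤ ((2 * Λ ^ 2 / k : ℕ) : ℝ) := by exact_mod_cast h1
          _ ≤ ((2 * Λ ^ 2 : ℕ) : ℝ) / k := Nat.cast_div_le
          _ = 2 * (Λ : ℝ) ^ 2 / k := by push_cast; ring
      · gcongr
        exact sum_32 _ _ hΛ
  have h3 := Finset.card_filter_add_card_filter_not (s := S) (fun x => |(x.hA : ℝ)| ≤ Λ * k)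
  have h4 : (S.card : ℝ) = (S.filter (fun x => |(x.hA : ℝ)| ≤ Λ * k)).card
      + (S.filter (fun x => ¬ |(x.hA : ℝ)| ≤ Λ * k)).card := by
    exact_mod_cast h3.symm
  linarith
end DCB

end

section
namespace DCB
open Fm

theorem count_anz_aux (S : Finset Fm) (Λ : ℕ) (hΛ : 1 ≤ Λ)
    (hS : ∀ x ∈ S, x.a ≠ 0 ∧ x.a.natAbs ≤ 12 * Λ ∧ 0 ≤ x.b ∧ x.b < |x.a| ∧
      |(x.hA : ℝ)| ≤ 2 * (Λ : ℝ) ^ 2 ∧ |(x.D : ℝ)| ≤ (Λ : ℝ) ^ 4)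
    (hs : ∀ x ∈ S, ∀ y ∈ S, 0 < x.a * y.a ∧ 0 ≤ x.G * y.G ∧ 0 ≤ x.hA * y.hA) :
    (S.card : ℝ) ≤ 600 * (Λ : ℝ) ^ 4 := by
  have hΛR : (1 : ℝ) ≤ Λ := by exact_mod_cast hΛ
  have h1 := card_le_sum_fib S (Finset.Icc 1 (12 * Λ)) (fun x => x.a.natAbs)
    (fun k => 3 * Λ * (12 * Λ + 3 / 2 * (Λ : ℝ) ^ 2) + 2 * (Λ : ℝ) ^ 2 +
      3 * (Λ : ℝ) ^ 4 / Real.sqrt Λ * (1 / Real.sqrt k)) (by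
      intro x hx
      obtain ⟨h1, h2, _⟩ := hS x hx
      exact Finset.mem_Icc.2 ⟨Int.natAbs_pos.2 h1, h2⟩) (by
      intro k hk F hF
      obtain ⟨hk1, hk2⟩ := Finset.mem_Icc.1 hk
      have hkR : (1 : ℝ) ≤ k := by exact_mod_cast hk1
      have hkR2 : (k : ℝ) ≤ 12 * Λ := by exact_mod_cast hk2
      refine (card_le_mul_fib F (Finset.Ico (0 : ℤ) k) (fun x => x.b)
        ((1 + 2 * Λ) * (1 + 3 / 2 * (Λ : ℝ) ^ 2 / k) + 2 * (Λ : ℝ) ^ 2 / k +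
          (Λ : ℝ) ^ 4 / (k * Real.sqrt k) * (3 / Real.sqrt Λ)) ?_ ?_).trans ?_
      · intro x hx
        obtain ⟨hx, hxk⟩ := hF x hx
        obtain ⟨h1, h2, h3, h4, _⟩ := hS x hx
        refine Finset.mem_Ico.2 ⟨h3, ?_⟩
        rw [← hxk, Int.natCast_natAbs]; exact h4
      · intro b _ F' hF'
        apply count_ab F' Λ k hΛ hk1
        · intro x hx
          obtain ⟨hx, hxb⟩ := hF' x hx
          obtain ⟨hx, hxk⟩ := hF x hx
          exact ⟨(hS x hx).2.2.2.2.1, (hS x hx).2.2.2.2.2, hxk⟩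
        · intro x hx y hy
          obtain ⟨hx, hxb⟩ := hF' x hx
          obtain ⟨hx, hxk⟩ := hF x hx
          obtain ⟨hy, hyb⟩ := hF' y hy
          obtain ⟨hy, hyk⟩ := hF y hy
          refine ⟨?_, hxb.trans hyb.symm⟩
          rcases Int.natAbs_eq_natAbs_iff.1 (hxk.trans hyk.symm) with h | h
          · exact h
          · have := (hs x hx y hy).1
            rw [h] at this; nlinarith [sq_nonneg y.a]
        · intro x hx y hy
          exact (hs x (hF x (hF' x hx).1).1 y (hF y (hF' y hy).1).1).2
      · rw [Int.card_Ico]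
        have : ((((k : ℤ) - 0).toNat : ℕ) : ℝ) = k := by simp
        rw [this]
        have e : (k : ℝ) * ((1 + 2 * Λ) * (1 + 3 / 2 * (Λ : ℝ) ^ 2 / k) + 2 * (Λ : ℝ) ^ 2 / k +
          (Λ : ℝ) ^ 4 / (k * Real.sqrt k) * (3 / Real.sqrt Λ)) =
          (1 + 2 * Λ) * (k + 3 / 2 * (Λ : ℝ) ^ 2) + 2 * (Λ : ℝ) ^ 2 +
          3 * (Λ : ℝ) ^ 4 / Real.sqrt Λ * (1 / Real.sqrt k) := by
          field_simp
        rw [e]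
        gcongr
        linarith)
  refine h1.trans ?_
  rw [Finset.sum_add_distrib, Finset.sum_const, ← Finset.mul_sum, Nat.card_Icc]
  simp only [nsmul_eq_mul, add_tsub_cancel_right]
  have h2 := sum_12 (12 * Λ)
  have h3 : Real.sqrt ((12 * Λ : ℕ) : ℝ) ≤ 4 * Real.sqrt Λ := by
    rw [Real.sqrt_le_iff]
    refine ⟨by positivity, ?_⟩
    rw [mul_pow, Real.sq_sqrt (by positivity)]; push_cast; linarith
  have hsL : 0 < Real.sqrt (Λ : ℝ) := Real.sqrt_pos.2 (by linarith)
  have h4 : 3 * (Λ : ℝ) ^ 4 / Real.sqrt Λ * ∑ k ∈ Finset.Icc 1 (12 * Λ), 1 / Real.sqrt (k : ℝ)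
      ≤ 3 * (Λ : ℝ) ^ 4 / Real.sqrt Λ * (8 * Real.sqrt Λ) := by
    gcongr; linarith
  have h5 : 3 * (Λ : ℝ) ^ 4 / Real.sqrt Λ * (8 * Real.sqrt Λ) = 24 * (Λ : ℝ) ^ 4 := by
    field_simp; norm_num
  have h6 : (Λ : ℝ) ^ 3 ≤ (Λ : ℝ) ^ 4 := pow_le_pow_right₀ hΛR (by norm_num)
  push_cast
  nlinarith

theorem count_anz (S : Finset Fm) (Λ : ℕ) (hΛ : 1 ≤ Λ)
    (hS : ∀ x ∈ S, x.a ≠ 0 ∧ x.a.natAbs ≤ 12 * Λ ∧ 0 ≤ x.b ∧ x.b < |x.a| ∧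
      |(x.hA : ℝ)| ≤ 2 * (Λ : ℝ) ^ 2 ∧ |(x.D : ℝ)| ≤ (Λ : ℝ) ^ 4) :
    (S.card : ℝ) ≤ 4800 * (Λ : ℝ) ^ 4 := by
  have h := card_le_mul_fib S (Finset.univ : Finset (Bool × Bool × Bool))
    (fun x => (decide (0 < x.a), decide (0 ≤ x.G), decide (0 ≤ x.hA))) (600 * (Λ : ℝ) ^ 4)
    (by simp) (by
      intro b _ F hF
      apply count_anz_aux F Λ hΛ (fun x hx => hS x (hF x hx).1)
      intro x hx y hy
      obtain ⟨hx, hxb⟩ := hF x hx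
      obtain ⟨hy, hyb⟩ := hF y hy
      have hax := (hS x hx).1
      have hay := (hS y hy).1
      rw [← hyb] at hxb
      simp only [Prod.mk.injEq, decide_eq_decide] at hxb
      obtain ⟨e1, e2, e3⟩ := hxb
      refine ⟨?_, ?_, ?_⟩
      · by_cases h : 0 < x.a
        · exact mul_pos h (e1.1 h)
        · have := fun h' => h (e1.2 h')
          exact mul_pos_of_neg_of_neg (by omega) (by omega)
      · by_cases h : 0 ≤ x.G
        · exact mul_nonneg h (e2.1 h)
        · have := fun h' => h (e2.2 h')
          exact mul_nonneg_of_nonpos_of_nonpos (by omega) (by omega)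
      · by_cases h : 0 ≤ x.hA
        · exact mul_nonneg h (e3.1 h)
        · have := fun h' => h (e3.2 h')
          exact mul_nonneg_of_nonpos_of_nonpos (by omega) (by omega))
  have : (Finset.univ : Finset (Bool × Bool × Bool)).card = 8 := by decide
  rw [this] at h
  push_cast at h
  linarith

theorem exists_red2 (x : Fm) (Λ : ℕ) (h0 : x.D ≠ 0) (hD : |(x.D : ℝ)| ≤ (Λ : ℝ) ^ 4) :
    ∃ y, E x y ∧ ((y.a = 0 ∧ 0 ≤ y.c ∧ y.c < 2 * |y.b|) ∨
      (y.a ≠ 0 ∧ y.a.natAbs ≤ 12 * Λ ∧ 0 ≤ y.b ∧ y.b < |y.a| ∧ |(y.hA : ℝ)| ≤ 2 * (Λ : ℝ) ^ 2)) := by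
  obtain ⟨y, hE, hy⟩ := exists_red x Λ (by positivity) h0 hD
  by_cases ha : y.a = 0
  · have hb : y.b ≠ 0 := by
      intro hb
      apply h0; rw [← E_D hE]; simp [D, hA, hB, hC, ha, hb]
    refine ⟨_, E_trans hE (E_transl y (-(y.c / (2 * y.b)))), Or.inl ⟨by simp [T, ha], ?_, ?_⟩⟩
    · have e : (T 1 (-(y.c / (2 * y.b))) 0 1 y).c = y.c % (2 * y.b) := by
        simp only [T, ha]; rw [Int.emod_def]; ring
      rw [e]; exact Int.emod_nonneg _ (by omega)
    · have e : (T 1 (-(y.c / (2 * y.b))) 0 1 y).c = y.c % (2 * y.b) := by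
        simp only [T, ha]; rw [Int.emod_def]; ring
      have e2 : (T 1 (-(y.c / (2 * y.b))) 0 1 y).b = y.b := by
        simp only [T, ha]; ring
      rw [e, e2]
      have := Int.emod_lt_abs y.c (b := 2 * y.b) (by omega)
      rwa [abs_mul, abs_two] at this
  · rcases hy with hy | ⟨hy1, hy2⟩
    · exact absurd hy ha
    have e1 : (T 1 (-(y.b / y.a)) 0 1 y).a = y.a := by simp [T]
    have e2 : (T 1 (-(y.b / y.a)) 0 1 y).b = y.b % y.a := by
      simp only [T]; rw [Int.emod_def]; ring
    have e3 : (T 1 (-(y.b / y.a)) 0 1 y).hA = y.hA := by rw [hA_T]; ring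
    refine ⟨_, E_trans hE (E_transl y (-(y.b / y.a))), Or.inr ?_⟩
    rw [e1, e2, e3]
    refine ⟨ha, ?_, Int.emod_nonneg _ ha, Int.emod_lt_abs _ ha, hy2⟩
    have h3 : |(y.a : ℝ)| ≤ 12 * Λ := by
      apply abs_le_of_sq_le_sq _ (by positivity)
      nlinarith [sq_nonneg (Λ : ℝ)]
    have h4 : ((y.a.natAbs : ℕ) : ℝ) ≤ 12 * Λ := by rw [Nat.cast_natAbs, Int.cast_abs]; exact h3
    exact_mod_cast h4

/-- Davenport's bound -/
theorem dav : ∃ C : ℝ, 0 < C ∧ ∀ Z : ℝ, 0 ≤ Z → ∀ S : Finset Fm, Ineq S →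
    (∀ x ∈ S, x.D ≠ 0 ∧ |(x.D : ℝ)| ≤ Z) → (S.card : ℝ) ≤ C * Z := by
  refine ⟨80000, by norm_num, ?_⟩
  intro Z hZ0 S hI hS
  rcases S.eq_empty_or_nonempty with rfl | hne
  · simp; positivity
  have hZ1 : 1 ≤ Z := by
    obtain ⟨x, hx⟩ := hne
    have h1 := Int.one_le_abs (hS x hx).1
    have h2 : (1 : ℝ) ≤ |(x.D : ℝ)| := by exact_mod_cast h1
    linarith [(hS x hx).2]
  set z := Real.sqrt (Real.sqrt Z) with hz
  have hz4 : z ^ 4 = Z := by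
    rw [show z ^ 4 = (z ^ 2) ^ 2 by ring, hz, Real.sq_sqrt (Real.sqrt_nonneg _), Real.sq_sqrt hZ0]
  have hz1 : 1 ≤ z := by rw [hz, Real.one_le_sqrt, Real.one_le_sqrt]; exact hZ1
  set Λ := ⌈z⌉₊ with hΛ
  have hΛ1 : 1 ≤ Λ := Nat.one_le_ceil_iff.2 (by linarith)
  have hzΛ : z ≤ Λ := Nat.le_ceil z
  have hΛz : (Λ : ℝ) ≤ 2 * z := by
    have := Nat.ceil_lt_add_one (show 0 ≤ z by linarith)
    linarith
  have hZΛ : Z ≤ (Λ : ℝ) ^ 4 := by rw [← hz4]; gcongr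
  have hΛZ : (Λ : ℝ) ^ 4 ≤ 16 * Z := by
    calc (Λ : ℝ) ^ 4 ≤ (2 * z) ^ 4 := by gcongr
      _ = 16 * Z := by rw [mul_pow, hz4]; norm_num
  have hex : ∀ x : Fm, ∃ y, x ∈ S → (E x y ∧ ((y.a = 0 ∧ 0 ≤ y.c ∧ y.c < 2 * |y.b|) ∨
      (y.a ≠ 0 ∧ y.a.natAbs ≤ 12 * Λ ∧ 0 ≤ y.b ∧ y.b < |y.a| ∧ |(y.hA : ℝ)| ≤ 2 * (Λ : ℝ) ^ 2))) := by
    intro x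
    by_cases hx : x ∈ S
    · obtain ⟨y, hy⟩ := exists_red2 x Λ (hS x hx).1 ((hS x hx).2.trans hZΛ)
      exact ⟨y, fun _ => hy⟩
    · exact ⟨x, fun h => absurd h hx⟩
  choose f hf using hex
  obtain ⟨-, hcard⟩ := hI.image_E f (fun x hx => (hf x hx).1)
  rw [← hcard]
  set S' := S.image f with hS'
  have hprop : ∀ y ∈ S', y.D ≠ 0 ∧ |(y.D : ℝ)| ≤ (Λ : ℝ) ^ 4 ∧ ((y.a = 0 ∧ 0 ≤ y.c ∧ y.c < 2 * |y.b|) ∨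
      (y.a ≠ 0 ∧ y.a.natAbs ≤ 12 * Λ ∧ 0 ≤ y.b ∧ y.b < |y.a| ∧ |(y.hA : ℝ)| ≤ 2 * (Λ : ℝ) ^ 2)) := by
    intro y hy
    obtain ⟨x, hx, rfl⟩ := Finset.mem_image.1 hy
    obtain ⟨h1, h2⟩ := hf x hx
    rw [E_D h1]
    exact ⟨(hS x hx).1, (hS x hx).2.trans hZΛ, h2⟩
  have h1 := count_azero (S'.filter (fun y => y.a = 0)) Λ (by
    intro y hy
    obtain ⟨hy, hya⟩ := Finset.mem_filter.1 hy
    obtain ⟨h1, h2, h3⟩ := hprop y hy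
    rcases h3 with h3 | h3
    · exact ⟨h3.1, h3.2.1, h3.2.2, h1, by exact_mod_cast h2⟩
    · exact absurd hya h3.1)
  have h2 := count_anz (S'.filter (fun y => ¬ y.a = 0)) Λ hΛ1 (by
    intro y hy
    obtain ⟨hy, hya⟩ := Finset.mem_filter.1 hy
    obtain ⟨h1, h2, h3⟩ := hprop y hy
    rcases h3 with h3 | h3
    · exact absurd h3.1 hya
    · exact ⟨h3.1, h3.2.1, h3.2.2.1, h3.2.2.2.1, h3.2.2.2.2, h2⟩)
  have h3 := Finset.card_filter_add_card_filter_not (s := S') (fun y => y.a = 0)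
  have h4 : (S'.card : ℝ) = (S'.filter (fun y => y.a = 0)).card
      + (S'.filter (fun y => ¬ y.a = 0)).card := by
    exact_mod_cast h3.symm
  have h5 : (0 : ℝ) ≤ (Λ : ℝ) ^ 4 := by positivity
  linarith
end DCB

end

section
namespace DCB
open Fm

theorem isCoprime_of_primes {x y : ℤ} (_hy : y ≠ 0) (h : ∀ p : ℕ, p.Prime → (p : ℤ) ∣ y → ¬ (p : ℤ) ∣ x) :
    IsCoprime x y := by
  rw [Int.isCoprime_iff_gcd_eq_one]
  by_contra hn
  obtain ⟨p, hp, hpd⟩ := Nat.exists_prime_and_dvd hn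
  exact h p hp ((Int.natCast_dvd_natCast.2 hpd).trans (Int.gcd_dvd_right x y))
    ((Int.natCast_dvd_natCast.2 hpd).trans (Int.gcd_dvd_left x y))

theorem not_dvd_of_isCoprime {x y : ℤ} (h : IsCoprime x y) {p : ℕ} (hp : p.Prime)
    (h1 : (p : ℤ) ∣ x) (h2 : (p : ℤ) ∣ y) : False := by
  have := h.isUnit_of_dvd' h1 h2
  rw [Int.isUnit_iff_natAbs_eq] at this
  simp at this
  exact hp.one_lt.ne' this

/-- local point, `p ∣ n` -/
theorem local_pt (x : Fm) (n A B C : ℤ) (hn : n ≠ 0) (hA : x.hA = n * A) (hB : x.hB = n * B)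
    (hC : x.hC = n * C) (p : ℕ) (hp : p.Prime) (hx : ¬ Dv p x)
    (hh : ¬ ((p : ℤ) ∣ A ∧ (p : ℤ) ∣ B ∧ (p : ℤ) ∣ C)) :
    ∃ u v : ℕ, ¬ (p : ℤ) ∣ A * u ^ 2 + B * u * v + C * v ^ 2 ∧
      ((p : ℤ) ∣ n → ¬ (p : ℤ) ∣ x.ev u v) ∧ ¬ ((p : ℤ) ∣ u ∧ (p : ℤ) ∣ v) := by
  have hpp : Prime (p : ℤ) := Nat.prime_iff_prime_int.1 hp
  have hp1 : ¬ (p : ℤ) ∣ 1 := fun h => hpp.not_isUnit (isUnit_of_dvd_one h)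
  by_cases hpn : (p : ℤ) ∣ n
  · have r1 : x.a * C - x.b * B + x.c * A = 0 := by
      apply mul_left_cancel₀ hn
      have : n * (x.a * C - x.b * B + x.c * A) = x.a * x.hC - x.b * x.hB + x.c * x.hA := by
        rw [hA, hB, hC]; ring
      rw [this]; simp only [Fm.hA, Fm.hB, Fm.hC]; ring
    have r2 : x.b * C - x.c * B + x.d * A = 0 := by
      apply mul_left_cancel₀ hn
      have : n * (x.b * C - x.c * B + x.d * A) = x.b * x.hC - x.c * x.hB + x.d * x.hA := by
        rw [hA, hB, hC]; ring
      rw [this]; simp only [Fm.hA, Fm.hB, Fm.hC]; ring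
    have d1 : (p : ℤ) ∣ x.b ^ 2 - x.a * x.c := by
      have : x.b ^ 2 - x.a * x.c = n * A := hA
      rw [this]; exact hpn.mul_right _
    have d2 : (p : ℤ) ∣ x.b * x.c - x.a * x.d := by
      have : x.b * x.c - x.a * x.d = n * B := hB
      rw [this]; exact hpn.mul_right _
    have d3 : (p : ℤ) ∣ x.c ^ 2 - x.b * x.d := by
      have : x.c ^ 2 - x.b * x.d = n * C := hC
      rw [this]; exact hpn.mul_right _
    by_cases ha : (p : ℤ) ∣ x.a
    · have hb : (p : ℤ) ∣ x.b := by
        apply hpp.dvd_of_dvd_pow (n := 2)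
        have := dvd_add d1 (ha.mul_right x.c)
        simpa using this
      have hc : (p : ℤ) ∣ x.c := by
        apply hpp.dvd_of_dvd_pow (n := 2)
        have := dvd_add d3 (hb.mul_right x.d)
        simpa using this
      have hd : ¬ (p : ℤ) ∣ x.d := fun h => hx ⟨ha, hb, hc, h⟩
      have hA' : (p : ℤ) ∣ A := by
        have : (p : ℤ) ∣ x.d * A := by
          have e : x.d * A = x.c * B - x.b * C := by linarith
          rw [e]; exact dvd_sub (hc.mul_right _) (hb.mul_right _)
        exact (hpp.dvd_or_dvd this).resolve_left hd
      by_cases hC' : (p : ℤ) ∣ C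
      · have hB' : ¬ (p : ℤ) ∣ B := fun h => hh ⟨hA', h, hC'⟩
        refine ⟨1, 1, ?_, fun _ => ?_, by simpa using hp1⟩
        · intro h; apply hB'
          have e : B = (A * ((1 : ℕ) : ℤ) ^ 2 + B * ((1 : ℕ) : ℤ) * ((1 : ℕ) : ℤ) + C * ((1 : ℕ) : ℤ) ^ 2) - A - C := by
            push_cast; ring
          rw [e]; exact dvd_sub (dvd_sub h hA') hC'
        · intro h; apply hd
          have e : x.d = x.ev ((1 : ℕ) : ℤ) ((1 : ℕ) : ℤ) - x.a - x.b * 3 - x.c * 3 := by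
            simp only [ev]; push_cast; ring
          rw [e]
          exact dvd_sub (dvd_sub (dvd_sub h ha) (hb.mul_right _)) (hc.mul_right _)
      · refine ⟨0, 1, by simpa using hC', fun _ => by simpa [ev] using hd, by simpa using hp1⟩
    · by_cases hA' : (p : ℤ) ∣ A
      · have hB' : ¬ (p : ℤ) ∣ B := by
          intro hB'
          apply hh; refine ⟨hA', hB', ?_⟩
          have : (p : ℤ) ∣ x.a * C := by
            have e : x.a * C = x.b * B - x.c * A := by linarith
            rw [e]; exact dvd_sub (hB'.mul_left _) (hA'.mul_left _)
          exact (hpp.dvd_or_dvd this).resolve_left ha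
        -- a^2 h'(u,v) ≡ (a u + b v)(A(au - bv) + a B v);  a^2 ev ≡ (au+bv)^3
        have key : ∀ u : ℤ, ¬ (p : ℤ) ∣ x.a * u + x.b → ¬ (p : ℤ) ∣ A * u ^ 2 + B * u * 1 + C * 1 ^ 2 ∧
            ¬ (p : ℤ) ∣ x.ev u 1 := by
          intro u hu
          constructor
          · intro h
            have e : x.a * (A * u ^ 2 + B * u * 1 + C * 1 ^ 2) = A * (x.a * u ^ 2 - x.c) + B * (x.a * u + x.b) := by
              linear_combination r1
            have h2 := h.mul_left x.a
            rw [e] at h2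
            have h3 := (dvd_add_right (hA'.mul_right (x.a * u ^ 2 - x.c))).1 h2
            rcases hpp.dvd_or_dvd h3 with h4 | h4
            · exact hB' h4
            · exact hu h4
          · intro h
            apply hu
            apply hpp.dvd_of_dvd_pow (n := 3)
            have e : (x.a * u + x.b) ^ 3 = x.a ^ 2 * x.ev u 1 + (x.b ^ 2 - x.a * x.c) * (3 * x.a * u + x.b)
              + (x.b * x.c - x.a * x.d) * x.a := by
              simp only [ev]; ring
            rw [e]
            exact dvd_add (dvd_add (h.mul_left _) (d1.mul_right _)) (d2.mul_right _)
        by_cases hb : (p : ℤ) ∣ x.b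
        · obtain ⟨k1, k2⟩ := key 1 (by
            intro h; apply ha
            have := dvd_sub h hb
            simpa using this)
          exact ⟨1, 1, by simpa using k1, fun _ => by simpa using k2, by simpa using hp1⟩
        · obtain ⟨k1, k2⟩ := key 0 (by simpa using hb)
          exact ⟨0, 1, by simpa using k1, fun _ => by simpa using k2, by simpa using hp1⟩
      · exact ⟨1, 0, by simpa using hA', fun _ => by simpa [ev] using ha, by simpa using hp1⟩
  · by_cases hA' : (p : ℤ) ∣ A
    · by_cases hC' : (p : ℤ) ∣ C
      · have hB' : ¬ (p : ℤ) ∣ B := fun h => hh ⟨hA', h, hC'⟩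
        refine ⟨1, 1, ?_, fun h => absurd h hpn, by simpa using hp1⟩
        intro h; apply hB'
        have e : B = (A * ((1 : ℕ) : ℤ) ^ 2 + B * ((1 : ℕ) : ℤ) * ((1 : ℕ) : ℤ) + C * ((1 : ℕ) : ℤ) ^ 2) - A - C := by
          push_cast; ring
        rw [e]; exact dvd_sub (dvd_sub h hA') hC'
      · exact ⟨0, 1, by simpa using hC', fun h => absurd h hpn, by simpa using hp1⟩
    · exact ⟨1, 0, by simpa using hA', fun h => absurd h hpn, by simpa using hp1⟩

theorem exists_rep (x : Fm) (n A B C : ℤ) (hn : n ≠ 0) (hA : x.hA = n * A) (hB : x.hB = n * B)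
    (hC : x.hC = n * C) (hx : ∀ p : ℕ, p.Prime → ¬ Dv p x)
    (hh : ∀ p : ℕ, p.Prime → ¬ ((p : ℤ) ∣ A ∧ (p : ℤ) ∣ B ∧ (p : ℤ) ∣ C)) (N : ℤ) (hN : N ≠ 0) :
    ∃ y, E x y ∧ IsCoprime y.a n ∧ ∃ m, y.hA = n * m ∧ IsCoprime m N := by
  have hex : ∀ p : ℕ, ∃ u v : ℕ, p.Prime → (¬ (p : ℤ) ∣ A * u ^ 2 + B * u * v + C * v ^ 2 ∧
      ((p : ℤ) ∣ n → ¬ (p : ℤ) ∣ x.ev u v) ∧ ¬ ((p : ℤ) ∣ u ∧ (p : ℤ) ∣ v)) := by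
    intro p
    by_cases hp : p.Prime
    · obtain ⟨u, v, h⟩ := local_pt x n A B C hn hA hB hC p hp (hx p hp) (hh p hp)
      exact ⟨u, v, fun _ => h⟩
    · exact ⟨0, 0, fun h => absurd h hp⟩
  choose U V hUV using hex
  set M : ℕ := (2 * N * n).natAbs with hM
  have hM0 : M ≠ 0 := by simp [hM, hN, hn]
  have hpr : ∀ p ∈ M.primeFactors, p ≠ 0 := fun p hp => (Nat.prime_of_mem_primeFactors hp).ne_zero
  have hcop : Set.Pairwise (M.primeFactors : Set ℕ) (Function.onFun Nat.Coprime id) := by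
    intro p hp q hq hpq
    exact (Nat.coprime_primes (Nat.prime_of_mem_primeFactors hp) (Nat.prime_of_mem_primeFactors hq)).2 hpq
  obtain ⟨u, hu⟩ := Nat.chineseRemainderOfFinset U id M.primeFactors hpr hcop
  obtain ⟨v, hv⟩ := Nat.chineseRemainderOfFinset V id M.primeFactors hpr hcop
  have cong : ∀ p : ℕ, p.Prime → (p : ℤ) ∣ 2 * N * n →
      (¬ (p : ℤ) ∣ A * u ^ 2 + B * u * v + C * v ^ 2 ∧
      ((p : ℤ) ∣ n → ¬ (p : ℤ) ∣ x.ev u v) ∧ ¬ ((p : ℤ) ∣ u ∧ (p : ℤ) ∣ v)) := by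
    intro p hp hpd
    have hpm : p ∈ M.primeFactors := by
      rw [Nat.mem_primeFactors]; exact ⟨hp, Int.natCast_dvd.1 hpd, hM0⟩
    have hu' : (u : ℤ) ≡ U p [ZMOD p] := (Int.natCast_modEq_iff).2 (hu p hpm)
    have hv' : (v : ℤ) ≡ V p [ZMOD p] := (Int.natCast_modEq_iff).2 (hv p hpm)
    obtain ⟨h1, h2, h3⟩ := hUV p hp
    have tr : ∀ {s t : ℤ}, s ≡ t [ZMOD p] → ((p : ℤ) ∣ s → (p : ℤ) ∣ t) := by
      intro s t hst hs
      exact (Int.ModEq.dvd_iff hst).1 hs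
    refine ⟨fun h => h1 (tr ?_ h), fun hpn h => h2 hpn (tr ?_ h), fun h => h3 ⟨tr hu' h.1, tr hv' h.2⟩⟩
    · gcongr
    · simp only [ev]; gcongr
  have h0 : (u : ℤ) ≠ 0 ∨ (v : ℤ) ≠ 0 := by
    by_contra hcon
    push Not at hcon
    obtain ⟨h1, h2⟩ := hcon
    exact (cong 2 Nat.prime_two ⟨N * n, by push_cast; ring⟩).2.2 ⟨by rw [h1]; simp, by rw [h2]; simp⟩
  have hg : (Int.gcd u v) ≠ 0 := by
    rw [Ne, Int.gcd_eq_zero_iff]; tauto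
  obtain ⟨u', hu'⟩ := Int.gcd_dvd_left (u : ℤ) v
  obtain ⟨v', hv'⟩ := Int.gcd_dvd_right (u : ℤ) v
  set g : ℤ := (Int.gcd (u : ℤ) v : ℤ) with hgdef
  have hg' : g ≠ 0 := by rw [hgdef]; exact_mod_cast hg
  have hcop' : IsCoprime u' v' := by
    have h2 := Int.gcd_eq_gcd_ab (u : ℤ) v
    refine ⟨Int.gcdA u v, Int.gcdB u v, ?_⟩
    apply mul_left_cancel₀ hg'
    rw [← hgdef] at h2
    calc g * (Int.gcdA u v * u' + Int.gcdB u v * v')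
        = (g * u') * Int.gcdA u v + (g * v') * Int.gcdB u v := by ring
      _ = u * Int.gcdA u v + v * Int.gcdB u v := by rw [← hu', ← hv']
      _ = g * 1 := by rw [← h2]; ring
  obtain ⟨y, hE, hya, hyA⟩ := exists_T_of_coprime x hcop'
  refine ⟨y, hE, ?_, A * u' ^ 2 + B * u' * v' + C * v' ^ 2, by rw [hyA, hA, hB, hC]; ring, ?_⟩
  · apply isCoprime_of_primes hn
    intro p hp hpn hpy
    apply (cong p hp (hpn.mul_left _)).2.1 hpn
    have e : x.ev u v = g ^ 3 * y.a := by
      rw [hya, hu', hv']; simp only [ev]; ring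
    rw [e]; exact hpy.mul_left _
  · apply isCoprime_of_primes hN
    intro p hp hpn hpy
    apply (cong p hp ((hpn.mul_left 2).mul_right n)).1
    have e : A * (u : ℤ) ^ 2 + B * u * v + C * v ^ 2 = g ^ 2 * (A * u' ^ 2 + B * u' * v' + C * v' ^ 2) := by
      rw [hu', hv']; ring
    rw [e]; exact hpy.mul_left _
end DCB

end

section
namespace DCB
open Fm

/-- normalized representative data -/
structure NR (n Δ : ℤ) (x : Fm) (m B C g : ℤ) : Prop where
  eA : x.hA = n * m
  eB : x.hB = n * B
  eC : x.hC = n * C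
  eΔ : Δ = B ^ 2 - 4 * m * C
  eg : g = 2 * x.b * m - x.a * B
  can : IsCoprime x.a n
  cm : IsCoprime m (2 * n * Δ)

variable {n Δ : ℤ} {x : Fm} {m B C g : ℤ}

theorem NR.norm (h : NR n Δ x m B C g) (hn : n ≠ 0) : g ^ 2 - Δ * x.a ^ 2 = 4 * n * m ^ 3 := by
  have e := syzygy x
  have e1 : x.G = n * g := by
    rw [Fm.G, h.eA, h.eB, h.eg]; ring
  have e2 : x.D = n ^ 2 * Δ := by rw [D, h.eA, h.eB, h.eC, h.eΔ]; ring
  rw [e1, e2, h.eA] at e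
  apply mul_left_cancel₀ (pow_ne_zero 2 hn)
  linear_combination e

theorem NR.D_eq (h : NR n Δ x m B C g) : x.D = n ^ 2 * Δ := by
  rw [D, h.eA, h.eB, h.eC, h.eΔ]; ring

theorem NR.cm2 (h : NR n Δ x m B C g) : IsCoprime m 2 :=
  h.cm.of_isCoprime_of_dvd_right ⟨n * Δ, by ring⟩
theorem NR.cmn (h : NR n Δ x m B C g) : IsCoprime m n :=
  h.cm.of_isCoprime_of_dvd_right ⟨2 * Δ, by ring⟩
theorem NR.cmΔ (h : NR n Δ x m B C g) : IsCoprime m Δ :=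
  h.cm.of_isCoprime_of_dvd_right ⟨2 * n, by ring⟩

theorem NR.cmB (h : NR n Δ x m B C g) : IsCoprime m B := by
  have := h.cmΔ
  rw [h.eΔ] at this
  have h2 : IsCoprime m (B ^ 2) := by
    have h3 := this.add_mul_left_right (4 * C)
    rwa [show B ^ 2 - 4 * m * C + m * (4 * C) = B ^ 2 by ring] at h3
  exact (IsCoprime.pow_right_iff (by norm_num)).1 h2

theorem NR.m_ne (h : NR n Δ x m B C g) : m ≠ 0 := by
  intro h0
  have := h.cm2
  rw [h0, isCoprime_zero_left] at this
  exact absurd this (by decide)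

theorem NR.cam (h : NR n Δ x m B C g) : IsCoprime x.a m := by
  apply isCoprime_of_primes h.m_ne
  intro p hp hpm hpa
  have hpp : Prime (p : ℤ) := Nat.prime_iff_prime_int.1 hp
  have hb : (p : ℤ) ∣ x.b := by
    apply hpp.dvd_of_dvd_pow (n := 2)
    have e : x.b ^ 2 = n * m + x.a * x.c := by have := h.eA; simp only [hA] at this; linarith
    rw [e]; exact dvd_add (hpm.mul_left _) (hpa.mul_right _)
  have hB : (p : ℤ) ∣ n * B := by
    have e : n * B = x.b * x.c - x.a * x.d := by have := h.eB; simp only [Fm.hB] at this; linarith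
    rw [e]; exact dvd_sub (hb.mul_right _) (hpa.mul_right _)
  rcases hpp.dvd_or_dvd hB with h1 | h1
  · exact not_dvd_of_isCoprime h.cmn hp hpm h1
  · exact not_dvd_of_isCoprime h.cmB hp hpm h1

/-- existence of the type -/
theorem NR.exists_type (h : NR n Δ x m B C g) (hn : 0 < n) :
    ∃ s : ℤ, 0 ≤ s ∧ s < 2 * n ∧ (2 * n) ∣ g - x.a * s ∧ n ∣ s ^ 2 - Δ := by
  obtain ⟨α, β, hαβ⟩ := h.can
  have key : ∃ s : ℤ, (2 * n) ∣ g - x.a * s := by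
    rcases Int.even_or_odd x.a with ⟨a', ha'⟩ | hodd
    · have hn2 : IsCoprime 2 n := h.can.of_isCoprime_of_dvd_left ⟨a', by rw [ha']; ring⟩
      refine ⟨α * g, hn2.mul_dvd ?_ ?_⟩
      · rw [h.eg, ha']
        exact ⟨x.b * m - a' * B - a' * (α * (2 * x.b * m - (a' + a') * B)), by ring⟩
      · refine ⟨β * g, ?_⟩
        linear_combination (-g) * hαβ
    · have : IsCoprime x.a (2 * n) := by
        refine IsCoprime.mul_right ?_ h.can
        obtain ⟨k, hk⟩ := hodd
        exact ⟨1, -k, by rw [hk]; ring⟩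
      obtain ⟨α, β, hαβ⟩ := this
      exact ⟨α * g, β * g, by linear_combination (-g) * hαβ⟩
  obtain ⟨s, hs⟩ := key
  have hs' : (2 * n) ∣ g - x.a * (s % (2 * n)) := by
    rw [Int.emod_def]
    have e : g - x.a * (s - 2 * n * (s / (2 * n))) = (g - x.a * s) + 2 * n * (x.a * (s / (2 * n))) := by ring
    rw [e]; exact dvd_add hs (dvd_mul_right _ _)
  refine ⟨s % (2 * n), Int.emod_nonneg _ (by omega), Int.emod_lt_of_pos _ (by omega), hs', ?_⟩
  set t := s % (2 * n)
  have hno := h.norm hn.ne'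
  have h1 : n ∣ x.a ^ 2 * (t ^ 2 - Δ) := by
    obtain ⟨k, hk⟩ := hs'
    have e : g = x.a * t + 2 * n * k := by linarith
    refine ⟨4 * m ^ 3 - 4 * x.a * t * k - 4 * n * k ^ 2, ?_⟩
    rw [e] at hno
    linear_combination hno
  exact (h.can.symm.pow_right (n := 2)).dvd_of_dvd_mul_left h1

/-- the composition -/
theorem exists_comp {x0 x1 : Fm} {m0 B0 C0 g0 m1 B1 C1 g1 s : ℤ}
    (hn : 0 < n) (hΔ : Δ ≠ 0)
    (h0 : NR n Δ x0 m0 B0 C0 g0) (h1 : NR n Δ x1 m1 B1 C1 g1)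
    (hs0 : (2 * n) ∣ g0 - x0.a * s) (hs1 : (2 * n) ∣ g1 - x1.a * s) (hm : IsCoprime m1 m0) :
    ∃ (y : Fm) (F E B C : ℤ), 2 * n * F = x1.a * g0 - x0.a * g1 ∧
      2 * n * E = g1 * g0 - x1.a * x0.a * Δ ∧
      y.a = F ∧ y.hA = m1 * m0 ∧ y.hB = B ∧ y.hC = (m1 * m0) ^ 2 * C ∧ y.G = E ∧ y.D = Δ ∧
      (2 * m1) ∣ B - B1 ∧ m0 ∣ B + B0 := by
  have N0 := h0.norm hn.ne'
  have N1 := h1.norm hn.ne'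
  obtain ⟨k0, hk0⟩ := hs0
  obtain ⟨k1, hk1⟩ := hs1
  have eg0 : g0 = x0.a * s + 2 * n * k0 := by linarith
  have eg1 : g1 = x1.a * s + 2 * n * k1 := by linarith
  set F := x1.a * k0 - x0.a * k1 with hF
  have hF2 : 2 * n * F = x1.a * g0 - x0.a * g1 := by rw [eg0, eg1, hF]; ring
  have hn2 : (2 * n) ≠ 0 := by omega
  set M := m1 * m0 with hM
  have hEdvd : (2 * n) ∣ g1 * g0 - x1.a * x0.a * Δ := by
    rw [← Int.pow_dvd_pow_iff (n := 2) (by norm_num)]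
    refine ⟨Δ * F ^ 2 + 4 * M ^ 3, ?_⟩
    have : (g1 * g0 - x1.a * x0.a * Δ) ^ 2 = Δ * (x1.a * g0 - x0.a * g1) ^ 2
      + (g1 ^ 2 - Δ * x1.a ^ 2) * (g0 ^ 2 - Δ * x0.a ^ 2) := by ring
    rw [this, ← hF2, N0, N1, hM]; ring
  obtain ⟨E, hE⟩ := hEdvd
  have hEF : E ^ 2 - Δ * F ^ 2 = 4 * M ^ 3 := by
    apply mul_left_cancel₀ (pow_ne_zero 2 hn2)
    have e1 : (2 * n) ^ 2 * (E ^ 2 - Δ * F ^ 2) = (2 * n * E) ^ 2 - Δ * (2 * n * F) ^ 2 := by ring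
    rw [e1, ← hE, hF2]
    have : (g1 * g0 - x1.a * x0.a * Δ) ^ 2 - Δ * (x1.a * g0 - x0.a * g1) ^ 2 =
      (g1 ^ 2 - Δ * x1.a ^ 2) * (g0 ^ 2 - Δ * x0.a ^ 2) := by ring
    rw [this, N0, N1, hM]; ring
  have hr0 : E * x0.a + F * g0 = 2 * x1.a * m0 ^ 3 := by
    apply mul_left_cancel₀ hn2
    linear_combination (-x0.a) * hE + g0 * hF2 + x1.a * N0
  have hr1 : E * x1.a - F * g1 = 2 * x0.a * m1 ^ 3 := by
    apply mul_left_cancel₀ hn2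
    linear_combination (-x1.a) * hE - g1 * hF2 + x0.a * N1
  have hM0 : M ≠ 0 := mul_ne_zero h1.m_ne h0.m_ne
  have hFM : IsCoprime F M := by
    apply isCoprime_of_primes hM0
    intro p hp hpM hpF
    have hpp : Prime (p : ℤ) := Nat.prime_iff_prime_int.1 hp
    have hpE : (p : ℤ) ∣ E := by
      apply hpp.dvd_of_dvd_pow (n := 2)
      have e : E ^ 2 = F * (Δ * F) + M * (4 * M ^ 2) := by linear_combination hEF
      rw [e]; exact dvd_add (hpF.mul_right _) (hpM.mul_right _)
    rcases hpp.dvd_or_dvd hpM with hd | hd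
    · have h2 : (p : ℤ) ∣ 2 * x1.a * m0 ^ 3 := by
        rw [← hr0]; exact dvd_add (hpE.mul_right _) (hpF.mul_right _)
      rcases hpp.dvd_or_dvd h2 with h3 | h3
      · rcases hpp.dvd_or_dvd h3 with h4 | h4
        · exact not_dvd_of_isCoprime h1.cm2 hp hd h4
        · exact not_dvd_of_isCoprime h1.cam hp h4 hd
      · exact not_dvd_of_isCoprime hm hp hd (hpp.dvd_of_dvd_pow h3)
    · have h2 : (p : ℤ) ∣ 2 * x0.a * m1 ^ 3 := by
        rw [← hr1]; exact dvd_sub (hpE.mul_right _) (hpF.mul_right _)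
      rcases hpp.dvd_or_dvd h2 with h3 | h3
      · rcases hpp.dvd_or_dvd h3 with h4 | h4
        · exact not_dvd_of_isCoprime h0.cm2 hp hd h4
        · exact not_dvd_of_isCoprime h0.cam hp h4 hd
      · exact not_dvd_of_isCoprime hm hp (hpp.dvd_of_dvd_pow h3) hd
  have hM2 : IsCoprime M 2 := IsCoprime.mul_left h1.cm2 h0.cm2
  have hM32 : IsCoprime (M ^ 3) 2 := hM2.pow_left
  -- choose B
  have hB : ∃ B k : ℤ, E + F * B = 2 * M ^ 3 * k ∧ (2 : ℤ) ∣ B - Δ := by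
    obtain ⟨α, β, hαβ⟩ := hFM.pow_right (n := 3)
    have hM32c := hM32
    obtain ⟨γ, δ, hγδ⟩ := hM32c
    -- B = -αE + M^3 t, parity
    refine ⟨-α * E + M ^ 3 * (γ * (Δ + α * E)), ?_⟩
    have p2 : (2 : ℤ) ∣ (-α * E + M ^ 3 * (γ * (Δ + α * E))) - Δ := by
      refine ⟨- δ * (Δ + α * E), ?_⟩
      linear_combination (Δ + α * E) * hγδ
    have p1 : M ^ 3 ∣ E + F * (-α * E + M ^ 3 * (γ * (Δ + α * E))) := by
      refine ⟨β * E + F * (γ * (Δ + α * E)), ?_⟩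
      linear_combination (-E) * hαβ
    set B := -α * E + M ^ 3 * (γ * (Δ + α * E))
    have p3 : (2 : ℤ) ∣ E + F * B := by
      have q1 : (2 : ℤ) ∣ E - Δ * F := by
        have : (2 : ℤ) ∣ (E - Δ * F) - (E ^ 2 - Δ * F ^ 2) := by
          have q2 : Even (E * (E - 1)) := Int.even_mul_pred_self E
          have q3 : Even (F * (F - 1)) := Int.even_mul_pred_self F
          have e : (E - Δ * F) - (E ^ 2 - Δ * F ^ 2) = - (E * (E - 1)) + Δ * (F * (F - 1)) := by ring
          rw [e]; exact dvd_add ((dvd_neg).2 q2.two_dvd) (q3.two_dvd.mul_left _)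
        rw [hEF] at this
        have := dvd_add this (⟨2 * M ^ 3, by ring⟩ : (2 : ℤ) ∣ 4 * M ^ 3)
        simpa using this
      have e : E + F * B = (E - Δ * F) + 2 * (Δ * F) + (B - Δ) * F - 2 * 0 - 0 := by ring
      rw [e]
      have := dvd_add (dvd_add q1 (dvd_mul_right 2 (Δ * F))) (p2.mul_right F)
      simpa using this
    obtain ⟨k, hk⟩ := (hM32.symm).mul_dvd p3 p1
    exact ⟨k, hk, p2⟩
  obtain ⟨B, k, hBk, hBΔ⟩ := hB
  have hBB1 : (2 : ℤ) ∣ B - B1 := by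
    have e : B - B1 = (B - Δ) + (B1 * (B1 - 1) - 4 * m1 * C1) := by rw [h1.eΔ]; ring
    rw [e]
    exact dvd_add hBΔ (dvd_sub (Int.even_mul_pred_self B1).two_dvd ⟨2 * m1 * C1, by ring⟩)
  have hC : ∃ C : ℤ, B ^ 2 - Δ = 4 * M ^ 3 * C := by
    have q4 : (4 : ℤ) ∣ B ^ 2 - Δ := by
      obtain ⟨t, ht⟩ := hBB1
      refine ⟨t ^ 2 + t * B1 + m1 * C1, ?_⟩
      have : B = B1 + 2 * t := by linarith
      rw [this, h1.eΔ]; ring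
    have qM : M ^ 3 ∣ B ^ 2 - Δ := by
      have : M ^ 3 ∣ F ^ 2 * (B ^ 2 - Δ) := by
        refine ⟨4 * (M ^ 3 * k ^ 2 - k * E + 1), ?_⟩
        have e : F * B = 2 * M ^ 3 * k - E := by linarith
        have : F ^ 2 * (B ^ 2 - Δ) = (F * B) ^ 2 - Δ * F ^ 2 := by ring
        rw [this, e]
        linear_combination hEF
      exact (hFM.symm.pow (m := 3) (n := 2)).dvd_of_dvd_mul_left this
    have : IsCoprime (4 : ℤ) (M ^ 3) := by
      have := (hM32.symm).pow_left (m := 2)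
      norm_num at this
      exact_mod_cast this
    exact this.mul_dvd q4 qM
  obtain ⟨C, hC⟩ := hC
  have hFC : F ^ 2 * C = 1 - M ^ 3 * k ^ 2 + k * F * B := by
    have h4 : (4 * M ^ 3) ≠ 0 := mul_ne_zero (by norm_num) (pow_ne_zero 3 hM0)
    apply mul_left_cancel₀ h4
    have e : F * B = 2 * M ^ 3 * k - E := by linarith
    have e2 : 4 * M ^ 3 * (F ^ 2 * C) = (F * B) ^ 2 - Δ * F ^ 2 := by
      linear_combination (-F ^ 2) * hC
    have e3 : 4 * M ^ 3 * (1 - M ^ 3 * k ^ 2 + k * F * B) = 4 * M ^ 3 * (1 - M ^ 3 * k ^ 2 + k * (F * B)) := by ring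
    rw [e2, e3, e]
    linear_combination hEF
  set w := k * B - F * C with hw
  have hFw : F * w = M ^ 3 * k ^ 2 - 1 := by rw [hw]; linear_combination (-1) * hFC
  have yA : (⟨F, M ^ 2 * k, M * w, B * w - M ^ 3 * k * C⟩ : Fm).hA = M := by
    simp only [hA]; linear_combination (-M) * hFw
  have yB : (⟨F, M ^ 2 * k, M * w, B * w - M ^ 3 * k * C⟩ : Fm).hB = B := by
    simp only [Fm.hB]
    have : M ^ 3 * k * w + F * (M ^ 3 * k * C) = M ^ 3 * k * (k * B) := by rw [hw]; ring
    linear_combination this - B * hFw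
  have yC : (⟨F, M ^ 2 * k, M * w, B * w - M ^ 3 * k * C⟩ : Fm).hC = M ^ 2 * C := by
    simp only [Fm.hC]
    have : w * (k * B) = w * w + w * F * C := by rw [hw]; ring
    linear_combination (- M ^ 2) * this - M ^ 2 * C * hFw
  refine ⟨⟨F, M ^ 2 * k, M * w, B * w - M ^ 3 * k * C⟩, F, E, B, C, hF2, hE.symm, rfl, yA, yB, yC, ?_, ?_, ?_, ?_⟩
  · rw [Fm.G, yA, yB]; show 2 * (M ^ 2 * k) * M - F * B = E
    linear_combination (-1) * hBk
  · rw [D, yA, yB, yC]; linear_combination hC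
  · refine (h1.cm2.symm).mul_dvd hBB1 ?_
    have hd : m1 ∣ (F * x1.a) * (B - B1) := by
      refine ⟨2 * x1.a * m1 ^ 2 * m0 ^ 3 * k - 2 * x0.a * m1 ^ 2 - 2 * F * x1.b, ?_⟩
      have e := hBk
      rw [hM] at e
      linear_combination x1.a * e - hr1 - F * h1.eg
    have hco : IsCoprime m1 (F * x1.a) := by
      refine IsCoprime.mul_right ?_ h1.cam.symm
      exact hFM.symm.of_isCoprime_of_dvd_left ⟨m0, hM⟩
    exact hco.dvd_of_dvd_mul_left hd
  · have hd : m0 ∣ (F * x0.a) * (B + B0) := by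
      refine ⟨2 * x0.a * m0 ^ 2 * m1 ^ 3 * k - 2 * x1.a * m0 ^ 2 + 2 * F * x0.b, ?_⟩
      have e := hBk
      rw [hM] at e
      linear_combination x0.a * e - hr0 + F * h0.eg
    have hco : IsCoprime m0 (F * x0.a) := by
      refine IsCoprime.mul_right ?_ h0.cam.symm
      exact hFM.symm.of_isCoprime_of_dvd_left ⟨m1, by rw [hM]; ring⟩
    exact hco.dvd_of_dvd_mul_left hd
end DCB

end

section
namespace DCB
open Fm

theorem eq_of_cov {x y : Fm} (ha : x.a = y.a) (hb : x.b = y.b) (hhA : x.hA = y.hA)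
    (hhB : x.hB = y.hB) (hD : x.D = y.D) (h0 : x.hA ≠ 0) : x = y := by
  have hhC : x.hC = y.hC := by
    simp only [D, ← hhA, ← hhB] at hD
    have : 4 * x.hA * (x.hC - y.hC) = 0 := by linarith
    have := (mul_eq_zero.1 this).resolve_left (by simpa using h0)
    linarith
  by_cases haz : x.a = 0
  · have hbz : x.b ≠ 0 := by intro h; apply h0; simp [hA, haz, h]
    have hc : x.c = y.c := by
      simp only [hB, ← ha, ← hb, haz] at hhB
      apply mul_left_cancel₀ hbz; linarith
    have hd : x.d = y.d := by
      simp only [hC, ← hc, ← hb] at hhC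
      apply mul_left_cancel₀ hbz; linarith
    exact Fm.ext ha hb hc hd
  · have hc : x.c = y.c := by
      simp only [hA, ← ha, ← hb] at hhA
      apply mul_left_cancel₀ haz; linarith
    have hd : x.d = y.d := by
      simp only [hB, ← hc, ← hb, ← ha] at hhB
      apply mul_left_cancel₀ haz; linarith
    exact Fm.ext ha hb hc hd

/-- covariant value -/
def gv (x : Fm) (m B C u v : ℤ) : ℤ :=
  (x.b * u ^ 2 + 2 * x.c * u * v + x.d * v ^ 2) * (2 * m * u + B * v)
   - (x.a * u ^ 2 + 2 * x.b * u * v + x.c * v ^ 2) * (B * u + 2 * C * v)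

theorem G_T (u w v z : ℤ) (x : Fm) : (T u w v z x).G = (u * z - w * v) ^ 3 * gv x x.hA x.hB x.hC u v := by
  simp only [G, gv, hA_T, hB_T, hC_T]
  simp only [T, hA, hB, hC]; ring

theorem cov_ev (x : Fm) (u v : ℤ) : 8 * x.hA ^ 3 * x.ev u v =
   x.a * ((2 * x.hA * u + x.hB * v) ^ 3 + 3 * (2 * x.hA * u + x.hB * v) * v ^ 2 * x.D) +
   x.G * (3 * (2 * x.hA * u + x.hB * v) ^ 2 * v + x.D * v ^ 3) := by
  simp only [G, D, ev, hA, hB, hC]; ring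

theorem cov_gv (x : Fm) (u v : ℤ) : 8 * x.hA ^ 3 * gv x x.hA x.hB x.hC u v =
   x.G * ((2 * x.hA * u + x.hB * v) ^ 3 + 3 * (2 * x.hA * u + x.hB * v) * v ^ 2 * x.D) +
   x.a * x.D * (3 * (2 * x.hA * u + x.hB * v) ^ 2 * v + x.D * v ^ 3) := by
  simp only [gv, G, D, hA, hB, hC]; ring

theorem comp_inj {n Δ : ℤ} {x0 x1 x2 y1 y2 : Fm}
    {m0 B0 C0 g0 m1 B1 C1 g1 m2 B2 C2 g2 F1 E1 D1 K1 F2 E2 D2 K2 : ℤ} (hn : 0 < n)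
    (h0 : NR n Δ x0 m0 B0 C0 g0) (h1 : NR n Δ x1 m1 B1 C1 g1) (h2 : NR n Δ x2 m2 B2 C2 g2)
    (a1 : 2 * n * F1 = x1.a * g0 - x0.a * g1) (b1 : 2 * n * E1 = g1 * g0 - x1.a * x0.a * Δ)
    (c1 : y1.a = F1) (d1 : y1.hA = m1 * m0) (e1 : y1.hB = D1) (f1 : y1.hC = (m1 * m0) ^ 2 * K1)
    (g1' : y1.G = E1) (i1 : y1.D = Δ) (j1 : (2 * m1) ∣ D1 - B1) (k1 : m0 ∣ D1 + B0)
    (a2 : 2 * n * F2 = x2.a * g0 - x0.a * g2) (b2 : 2 * n * E2 = g2 * g0 - x2.a * x0.a * Δ)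
    (c2 : y2.a = F2) (d2 : y2.hA = m2 * m0) (e2 : y2.hB = D2)
    (g2' : y2.G = E2) (k2 : m0 ∣ D2 + B0)
    (hE : E y1 y2) : E x1 x2 := by
  obtain ⟨u, w, v, z, hdet, hT⟩ := hE
  have hm0 := h0.m_ne
  have hm1 := h1.m_ne
  have hm2 := h2.m_ne
  have q1 : m2 * m0 = m1 * m0 * u ^ 2 + D1 * u * v + (m1 * m0) ^ 2 * K1 * v ^ 2 := by
    rw [← d2, ← hT, hA_T, hdet, d1, e1, f1]; ring
  have q2 : D2 = 2 * (m1 * m0) * u * w + D1 * (u * z + w * v) + 2 * ((m1 * m0) ^ 2 * K1) * v * z := by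
    rw [← e2, ← hT, hB_T, hdet, d1, e1, f1]; ring
  obtain ⟨κ1, hκ1⟩ := k1
  obtain ⟨κ2, hκ2⟩ := k2
  have ruv : m0 ∣ u * v := by
    have : m0 ∣ B0 * (u * v) := ⟨m1 * u ^ 2 + κ1 * u * v + m1 ^ 2 * m0 * K1 * v ^ 2 - m2, by
      linear_combination (u * v) * hκ1 + q1⟩
    exact h0.cmB.dvd_of_dvd_mul_left this
  have rwv : m0 ∣ w * v := by
    have : m0 ∣ 2 * (B0 * (w * v)) :=
      ⟨2 * m1 * u * w + κ1 * (u * z + w * v) + 2 * m1 ^ 2 * m0 * K1 * v * z - κ2, by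
      linear_combination (u * z + w * v) * hκ1 + q2 - hκ2 - B0 * hdet⟩
    exact h0.cmB.dvd_of_dvd_mul_left (h0.cm2.dvd_of_dvd_mul_left this)
  have rv : m0 ∣ v := by
    have e : v = z * (u * v) - v * (w * v) := by linear_combination -v * hdet
    rw [e]; exact dvd_sub (ruv.mul_left _) (rwv.mul_left _)
  obtain ⟨v', rfl⟩ := rv
  obtain ⟨t, ht⟩ := j1
  obtain ⟨u', hu'⟩ : ∃ u', u' = u + v' * t := ⟨_, rfl⟩
  have eU : 2 * m1 * m0 * u + D1 * (m0 * v') = m0 * (2 * m1 * u' + B1 * v') := by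
    rw [hu']; linear_combination m0 * v' * ht
  set U := 2 * m1 * u' + B1 * v' with hU
  have n1 := h1.D_eq
  have hG1 : x1.G = n * g1 := by rw [Fm.G, h1.eA, h1.eB, h1.eg]; ring
  have hh : m1 * u' ^ 2 + B1 * u' * v' + C1 * v' ^ 2 = m2 := by
    have s1 : 4 * m1 * (m1 * u' ^ 2 + B1 * u' * v' + C1 * v' ^ 2) = U ^ 2 - Δ * v' ^ 2 := by
      rw [hU, h1.eΔ]; ring
    have s2 : 4 * (m1 * m0) * (m2 * m0) = (2 * m1 * m0 * u + D1 * (m0 * v')) ^ 2 - Δ * (m0 * v') ^ 2 := by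
      rw [q1, ← i1, D, e1, d1, f1]; ring
    rw [eU] at s2
    have : (4 * m1 * m0 ^ 2) ≠ 0 := by positivity
    apply mul_left_cancel₀ this
    linear_combination m0 ^ 2 * s1 - s2
  have V1 : 8 * m1 ^ 3 * x1.ev u' v' = x1.a * (U ^ 3 + 3 * U * v' ^ 2 * Δ)
      + g1 * (3 * U ^ 2 * v' + Δ * v' ^ 3) := by
    have s := cov_ev x1 u' v'
    rw [h1.eA, h1.eB, hG1, n1] at s
    apply mul_left_cancel₀ (pow_ne_zero 3 hn.ne')
    rw [hU]; linear_combination s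
  have W1 : 8 * m1 ^ 3 * gv x1 m1 B1 C1 u' v' = g1 * (U ^ 3 + 3 * U * v' ^ 2 * Δ)
      + x1.a * Δ * (3 * U ^ 2 * v' + Δ * v' ^ 3) := by
    have s := cov_gv x1 u' v'
    rw [h1.eA, h1.eB, h1.eC, hG1, n1] at s
    have s' : gv x1 (n * m1) (n * B1) (n * C1) u' v' = n * gv x1 m1 B1 C1 u' v' := by
      simp only [gv]; ring
    rw [s'] at s
    apply mul_left_cancel₀ (pow_ne_zero 4 hn.ne')
    rw [hU]; linear_combination s
  have V2 : 8 * m1 ^ 3 * F2 = F1 * (U ^ 3 + 3 * U * v' ^ 2 * Δ)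
      + E1 * (3 * U ^ 2 * v' + Δ * v' ^ 3) := by
    have s := cov_ev y1 u (m0 * v')
    rw [d1, e1, g1', i1, c1] at s
    have s' : y1.ev u (m0 * v') = F2 := by rw [← c2, ← hT]; simp [T, ev]
    rw [s', ← mul_assoc 2 m1 m0, eU] at s
    apply mul_left_cancel₀ (pow_ne_zero 3 hm0)
    linear_combination s
  have W2 : 8 * m1 ^ 3 * E2 = E1 * (U ^ 3 + 3 * U * v' ^ 2 * Δ)
      + F1 * Δ * (3 * U ^ 2 * v' + Δ * v' ^ 3) := by
    have s := cov_gv y1 u (m0 * v')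
    have s' : gv y1 y1.hA y1.hB y1.hC u (m0 * v') = E2 := by
      rw [← g2', ← hT, G_T, hdet]; ring
    rw [s', d1, e1, g1', i1, c1, ← mul_assoc 2 m1 m0, eU] at s
    apply mul_left_cancel₀ (pow_ne_zero 3 hm0)
    linear_combination s
  have hm13 : 8 * m1 ^ 3 ≠ 0 := by positivity
  have R1 : x2.a * g0 - x0.a * g2 = g0 * x1.ev u' v' - x0.a * gv x1 m1 B1 C1 u' v' := by
    apply mul_left_cancel₀ hm13
    linear_combination (-8 * m1 ^ 3) * a2 + 2 * n * V2 - g0 * V1 + x0.a * W1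
      + (U ^ 3 + 3 * U * v' ^ 2 * Δ) * a1 + (3 * U ^ 2 * v' + Δ * v' ^ 3) * b1
  have R2 : g2 * g0 - x2.a * x0.a * Δ = g0 * gv x1 m1 B1 C1 u' v' - x0.a * Δ * x1.ev u' v' := by
    apply mul_left_cancel₀ hm13
    linear_combination (-8 * m1 ^ 3) * b2 + 2 * n * W2 - g0 * W1 + x0.a * Δ * V1
      + (U ^ 3 + 3 * U * v' ^ 2 * Δ) * b1 + Δ * (3 * U ^ 2 * v' + Δ * v' ^ 3) * a1
  have N0 := h0.norm hn.ne'
  have N0' : g0 ^ 2 - Δ * x0.a ^ 2 ≠ 0 := by rw [N0]; positivity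
  have ha : x1.ev u' v' = x2.a := by
    apply mul_left_cancel₀ N0'; linear_combination -g0 * R1 - x0.a * R2
  have hg : gv x1 m1 B1 C1 u' v' = g2 := by
    apply mul_left_cancel₀ N0'; linear_combination -g0 * R2 - x0.a * Δ * R1
  have hcop : IsCoprime u' v' := by
    rw [Int.isCoprime_iff_gcd_eq_one]
    by_contra hne
    obtain ⟨p, hp, hpd⟩ := Nat.exists_prime_and_dvd hne
    have hpu : (p : ℤ) ∣ u' := (Int.natCast_dvd_natCast.2 hpd).trans (Int.gcd_dvd_left ..)
    have hpv : (p : ℤ) ∣ v' := (Int.natCast_dvd_natCast.2 hpd).trans (Int.gcd_dvd_right ..)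
    obtain ⟨u1, rfl⟩ := hpu
    obtain ⟨v1, rfl⟩ := hpv
    refine not_dvd_of_isCoprime h2.cam hp (?_) (?_)
    · rw [← ha, ev]
      exact ⟨p ^ 2 * (x1.a * u1 ^ 3 + 3 * x1.b * u1 ^ 2 * v1 + 3 * x1.c * u1 * v1 ^ 2 + x1.d * v1 ^ 3), by ring⟩
    · rw [← hh]; exact ⟨p * (m1 * u1 ^ 2 + B1 * u1 * v1 + C1 * v1 ^ 2), by ring⟩
  obtain ⟨z', w', hzw⟩ := hcop
  have hdet' : u' * z' - (-w') * v' = 1 := by linarith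
  obtain ⟨x', hx'⟩ : ∃ x', x' = T u' (-w') v' z' x1 := ⟨_, rfl⟩
  have hEx : E x1 x' := ⟨_, _, _, _, hdet', hx'.symm⟩
  have xa : x'.a = x2.a := by rw [← ha, hx']; simp [T, ev]
  have xA : x'.hA = n * m2 := by rw [hx', hA_T, hdet', h1.eA, h1.eB, h1.eC, ← hh]; ring
  have xG : x'.G = n * g2 := by
    rw [hx', G_T, hdet', h1.eA, h1.eB, h1.eC, ← hg]; simp only [gv]; ring
  have xD : x'.D = n ^ 2 * Δ := by rw [E_D hEx, n1]
  obtain ⟨B', hB'⟩ : ∃ B', x'.hB = n * B' := by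
    rw [hx', hB_T, hdet', h1.eA, h1.eB, h1.eC]
    exact ⟨2 * m1 * u' * (-w') + B1 * (u' * z' + (-w') * v') + 2 * C1 * v' * z', by ring⟩
  obtain ⟨C', hC'⟩ : ∃ C', x'.hC = n * C' := by
    rw [hx', hC_T, hdet', h1.eA, h1.eB, h1.eC]
    exact ⟨m1 * (-w') ^ 2 + B1 * (-w') * z' + C1 * z' ^ 2, by ring⟩
  have eg' : 2 * x'.b * m2 - x2.a * B' = g2 := by
    apply mul_left_cancel₀ hn.ne'
    rw [← xG, G, xA, hB', xa]; ring
  have eD' : B' ^ 2 - 4 * m2 * C' = Δ := by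
    apply mul_left_cancel₀ (pow_ne_zero 2 hn.ne')
    rw [← xD, D, xA, hB', hC']; ring
  have eab : x2.a * (B' - B2) = 2 * m2 * (x'.b - x2.b) := by
    linear_combination -h2.eg - eg'
  have dm : m2 ∣ B' - B2 := by
    apply h2.cam.symm.dvd_of_dvd_mul_left
    rw [eab]; exact ⟨2 * (x'.b - x2.b), by ring⟩
  have d2' : (2 : ℤ) ∣ B' - B2 := by
    have : (2 : ℤ) ∣ (B' - B2) * (B' + B2) := ⟨2 * m2 * (C' - C2), by
      linear_combination eD' + h2.eΔ⟩
    rcases Int.prime_two.dvd_or_dvd this with h | h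
    · exact h
    · omega
  obtain ⟨k, hk⟩ := h2.cm2.mul_dvd dm d2'
  have hbk : x'.b = x2.b + x2.a * k := by
    have : (2 * m2) ≠ 0 := by positivity
    apply mul_left_cancel₀ this
    rw [hk] at eab; linear_combination -eab
  have hfin : x' = T 1 k 0 1 x2 := by
    apply eq_of_cov
    · rw [xa]; simp [T]
    · rw [hbk]; simp [T]; ring
    · rw [xA, hA_T, h2.eA]; ring
    · rw [hB', hB_T, h2.eA, h2.eB]; linear_combination n * hk
    · rw [xD, D_T, h2.D_eq]; ring
    · rw [xA]; positivity
  rw [hfin] at hEx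
  exact E_trans hEx (E_symm (E_transl _ _))

end DCB

end

section
namespace DCB
open Fm

/-- square roots of Δ mod n, in `[0,2n)` -/
def rts (n Δ : ℤ) : Finset ℤ := (Finset.Ico 0 (2 * n)).filter (fun s => n ∣ s ^ 2 - Δ)

/-- normalized -/
def NR' (n Δ : ℤ) (x : Fm) : Prop :=
  NR n Δ x (x.hA / n) (x.hB / n) (x.hC / n) (2 * x.b * (x.hA / n) - x.a * (x.hB / n))

/-- primitive with Hessian content `n` -/
def Good (n : ℤ) (x : Fm) : Prop :=
  (∀ p : ℕ, p.Prime → ¬ Dv p x) ∧ ∃ A B C : ℤ, x.hA = n * A ∧ x.hB = n * B ∧ x.hC = n * C ∧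
    ∀ p : ℕ, p.Prime → ¬ ((p : ℤ) ∣ A ∧ (p : ℤ) ∣ B ∧ (p : ℤ) ∣ C)

theorem Good.rep {n Δ : ℤ} {x : Fm} (h : Good n x) (hn : 0 < n) (hΔ : Δ ≠ 0) (hD : x.D = n ^ 2 * Δ)
    (N : ℤ) (hN : N ≠ 0) : ∃ y, E x y ∧ NR' n Δ y ∧ IsCoprime (y.hA / n) N := by
  obtain ⟨hp, A, B, C, hA', hB', hC', hh⟩ := h
  obtain ⟨y, hE, hya, m, hm, hmN⟩ := exists_rep x n A B C hn.ne' hA' hB' hC' hp hh (2 * n * Δ * N)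
    (by have := hn.ne'; positivity)
  obtain ⟨⟨A1, hA1⟩, ⟨B1, hB1⟩, ⟨C1, hC1⟩⟩ := (HDv_E hE).1 (⟨⟨A, hA'⟩, ⟨B, hB'⟩, ⟨C, hC'⟩⟩ : HDv n x)
  have e1 : y.hA / n = A1 := by rw [hA1]; exact Int.mul_ediv_cancel_left _ hn.ne'
  have e2 : y.hB / n = B1 := by rw [hB1]; exact Int.mul_ediv_cancel_left _ hn.ne'
  have e3 : y.hC / n = C1 := by rw [hC1]; exact Int.mul_ediv_cancel_left _ hn.ne'
  have e4 : m = A1 := by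
    apply mul_left_cancel₀ hn.ne'; rw [← hm, hA1]
  have hyD : y.D = n ^ 2 * Δ := by rw [E_D hE, hD]
  refine ⟨y, hE, ?_, ?_⟩
  · unfold NR'
    rw [e1, e2, e3]
    refine ⟨hA1, hB1, hC1, ?_, rfl, hya, ?_⟩
    · apply mul_left_cancel₀ (pow_ne_zero 2 hn.ne')
      rw [← hyD, D, hA1, hB1, hC1]; ring
    · rw [← e4]; exact hmN.of_isCoprime_of_dvd_right ⟨N, by ring⟩
  · rw [e1, ← e4]; exact hmN.of_isCoprime_of_dvd_right ⟨2 * n * Δ, by ring⟩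

theorem choose_reps {n Δ : ℤ} (hn : 0 < n) (hΔ : Δ ≠ 0) (S : Finset Fm)
    (hS : ∀ x ∈ S, Good n x ∧ x.D = n ^ 2 * Δ) :
    ∃ f : Fm → Fm, ∀ x ∈ S, E x (f x) ∧ NR' n Δ (f x) ∧
      ∀ y ∈ S, y ≠ x → IsCoprime ((f y).hA / n) ((f x).hA / n) := by
  induction S using Finset.induction_on with
  | empty => exact ⟨id, by simp⟩
  | insert z S hz ih =>
    obtain ⟨f, hf⟩ := ih (fun x hx => hS x (Finset.mem_insert_of_mem hx))
    obtain ⟨hg, hD⟩ := hS z (Finset.mem_insert_self _ _)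
    obtain ⟨y, hy1, hy2, hy3⟩ := hg.rep hn hΔ hD (∏ x ∈ S, (f x).hA / n) (by
      rw [Finset.prod_ne_zero_iff]
      intro x hx
      exact (hf x hx).2.1.m_ne)
    have hcop : ∀ x ∈ S, IsCoprime (y.hA / n) ((f x).hA / n) := fun x hx =>
      hy3.of_isCoprime_of_dvd_right (Finset.dvd_prod_of_mem _ hx)
    have hne : ∀ x ∈ S, x ≠ z := fun x hx h => hz (h ▸ hx)
    refine ⟨Function.update f z y, ?_⟩
    intro x hx
    rcases Finset.mem_insert.1 hx with rfl | hxS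
    · rw [Function.update_self]
      refine ⟨hy1, hy2, ?_⟩
      intro w hw hwx
      rcases Finset.mem_insert.1 hw with rfl | hw
      · exact absurd rfl hwx
      · rw [Function.update_of_ne hwx]; exact (hcop w hw).symm
    · rw [Function.update_of_ne (hne x hxS)]
      refine ⟨(hf x hxS).1, (hf x hxS).2.1, ?_⟩
      intro w hw hwx
      rcases Finset.mem_insert.1 hw with rfl | hw
      · rw [Function.update_self]; exact hcop x hxS
      · rw [Function.update_of_ne (hne w hw)]; exact (hf x hxS).2.2 w hw hwx

theorem count_type {n Δ s : ℤ} (hn : 0 < n) (hΔ : Δ ≠ 0) (R : Finset Fm) (f : Fm → Fm) (hR : Ineq R)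
    (h : ∀ x ∈ R, E x (f x) ∧ NR' n Δ (f x) ∧
      (∀ y ∈ R, y ≠ x → IsCoprime ((f y).hA / n) ((f x).hA / n)) ∧
      (2 * n) ∣ (2 * (f x).b * ((f x).hA / n) - (f x).a * ((f x).hB / n)) - (f x).a * s) :
    ∃ Y : Finset Fm, Ineq Y ∧ (∀ y ∈ Y, y.D = Δ) ∧ R.card ≤ 1 + Y.card := by
  rcases R.eq_empty_or_nonempty with rfl | ⟨x0, hx0⟩
  · exact ⟨∅, by intro x hx; simp at hx, by simp, by simp⟩
  obtain ⟨_, h0, hc0, hs0⟩ := h x0 hx0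
  have key : ∀ x : Fm, ∃ y : Fm, x ∈ R.erase x0 → ∃ (F E B C : ℤ),
      2 * n * F = (f x).a * (2 * (f x0).b * ((f x0).hA / n) - (f x0).a * ((f x0).hB / n))
        - (f x0).a * (2 * (f x).b * ((f x).hA / n) - (f x).a * ((f x).hB / n)) ∧
      2 * n * E = (2 * (f x).b * ((f x).hA / n) - (f x).a * ((f x).hB / n)) *
        (2 * (f x0).b * ((f x0).hA / n) - (f x0).a * ((f x0).hB / n)) - (f x).a * (f x0).a * Δ ∧
      y.a = F ∧ y.hA = ((f x).hA / n) * ((f x0).hA / n) ∧ y.hB = B ∧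
      y.hC = (((f x).hA / n) * ((f x0).hA / n)) ^ 2 * C ∧ y.G = E ∧ y.D = Δ ∧
      (2 * ((f x).hA / n)) ∣ B - (f x).hB / n ∧ ((f x0).hA / n) ∣ B + (f x0).hB / n := by
    intro x
    by_cases hx : x ∈ R.erase x0
    · obtain ⟨hne, hx⟩ := Finset.mem_erase.1 hx
      obtain ⟨_, h1, hc1, hs1⟩ := h x hx
      obtain ⟨y, hy⟩ := exists_comp hn hΔ h0 h1 hs0 hs1 (hc0 x hx hne)
      exact ⟨y, fun _ => hy⟩
    · exact ⟨x, fun h => absurd h hx⟩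
  choose c hc using key
  have hinj : ∀ x ∈ R.erase x0, ∀ x' ∈ R.erase x0, E (c x) (c x') → x = x' := by
    intro x hx x' hx' hE
    obtain ⟨F1, E1, B1, C1, a1, b1, c1, d1, e1, f1, g1, i1, j1, k1⟩ := hc x hx
    obtain ⟨F2, E2, B2, C2, a2, b2, c2, d2, e2, f2, g2, i2, j2, k2⟩ := hc x' hx'
    have hxR := (Finset.mem_erase.1 hx).2
    have hxR' := (Finset.mem_erase.1 hx').2
    have := comp_inj (K2 := 0) hn h0 (h x hxR).2.1 (h x' hxR').2.1 a1 b1 c1 d1 e1 f1 g1 i1 j1 k1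
      a2 b2 c2 d2 e2 g2 k2 hE
    exact hR x hxR x' hxR' (E_trans (h x hxR).1 (E_trans this (E_symm (h x' hxR').1)))
  obtain ⟨hI, hcard⟩ := Ineq.image c hinj
  refine ⟨_, hI, ?_, ?_⟩
  · intro y hy
    obtain ⟨x, hx, rfl⟩ := Finset.mem_image.1 hy
    obtain ⟨F1, E1, B1, C1, a1, b1, c1, d1, e1, f1, g1, i1, j1, k1⟩ := hc x hx
    exact i1
  · rw [hcard, Finset.card_erase_of_mem hx0]; omega

theorem count_disc {n Δ : ℤ} (hn : 0 < n) (hΔ : Δ ≠ 0) (S : Finset Fm) (hI : Ineq S)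
    (hS : ∀ x ∈ S, Good n x ∧ x.D = n ^ 2 * Δ) :
    ∃ Y : Finset Fm, Ineq Y ∧ (∀ y ∈ Y, y.D = Δ) ∧
      (S.card : ℝ) ≤ (rts n Δ).card * (1 + Y.card : ℝ) := by
  obtain ⟨f, hf⟩ := choose_reps hn hΔ S hS
  have key : ∀ x : Fm, ∃ s : ℤ, x ∈ S → s ∈ rts n Δ ∧
      (2 * n) ∣ (2 * (f x).b * ((f x).hA / n) - (f x).a * ((f x).hB / n)) - (f x).a * s := by
    intro x
    by_cases hx : x ∈ S
    · obtain ⟨s, h1, h2, h3, h4⟩ := (hf x hx).2.1.exists_type hn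
      exact ⟨s, fun _ => ⟨Finset.mem_filter.2 ⟨Finset.mem_Ico.2 ⟨h1, h2⟩, h4⟩, h3⟩⟩
    · exact ⟨0, fun h => absurd h hx⟩
  choose t ht using key
  rcases S.eq_empty_or_nonempty with rfl | ⟨x0, hx0⟩
  · exact ⟨∅, by intro x hx; simp at hx, by simp, by simp⟩
  obtain ⟨s, hs, hmax⟩ := Finset.exists_max_image (rts n Δ) (fun s => (S.filter (fun x => t x = s)).card)
    ⟨_, (ht x0 hx0).1⟩
  obtain ⟨Y, hY1, hY2, hY3⟩ := count_type (s := s) hn hΔ (S.filter (fun x => t x = s)) f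
    (hI.subset (Finset.filter_subset _ _)) (by
      intro x hx
      obtain ⟨hx, hxs⟩ := Finset.mem_filter.1 hx
      refine ⟨(hf x hx).1, (hf x hx).2.1, ?_, hxs ▸ (ht x hx).2⟩
      intro y hy hne
      exact (hf x hx).2.2 y (Finset.mem_filter.1 hy).1 hne)
  refine ⟨Y, hY1, hY2, ?_⟩
  apply card_le_mul_fib S (rts n Δ) t _ (fun x hx => (ht x hx).1)
  intro b hb F hF
  have h1 : F.card ≤ (S.filter (fun x => t x = b)).card :=
    Finset.card_le_card (fun x hx => Finset.mem_filter.2 (hF x hx))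
  have h2 := hmax b hb
  have : F.card ≤ 1 + Y.card := by omega
  exact_mod_cast this

theorem comp_count : ∃ C : ℝ, 0 < C ∧ ∀ (n : ℤ), 0 < n → ∀ (T Z : ℝ), 0 ≤ T → 0 ≤ Z →
    ∀ S : Finset Fm, Ineq S →
    (∀ x ∈ S, Good n x ∧ x.D ≠ 0 ∧ |(x.D : ℝ)| ≤ Z ∧ ∀ Δ, x.D = n ^ 2 * Δ → ((rts n Δ).card : ℝ) ≤ T) →
    (S.card : ℝ) ≤ C * T * (Z / (n : ℝ) ^ 2) := by
  obtain ⟨C0, hC0, hdav⟩ := dav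
  refine ⟨2 + C0, by positivity, ?_⟩
  intro n hn T Z hT hZ S hI hS
  have hn' : (0 : ℝ) < n := by exact_mod_cast hn
  set W := Z / (n : ℝ) ^ 2 with hW
  have hW0 : 0 ≤ W := by positivity
  have hdef : ∀ x ∈ S, x.D = n ^ 2 * (x.D / n ^ 2) := by
    intro x hx
    obtain ⟨-, A, B, C, h1, h2, h3, -⟩ := (hS x hx).1
    rw [mul_comm, Int.ediv_mul_cancel]
    exact ⟨B ^ 2 - 4 * A * C, by rw [D, h1, h2, h3]; ring⟩
  set t := S.image (fun x => x.D / n ^ 2) with ht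
  have htp : ∀ Δ ∈ t, Δ ≠ 0 ∧ |(Δ : ℝ)| ≤ W ∧ ((rts n Δ).card : ℝ) ≤ T := by
    intro Δ hΔ
    obtain ⟨x, hx, rfl⟩ := Finset.mem_image.1 hΔ
    have h1 := hdef x hx
    obtain ⟨h2, h3, h4, h5⟩ := hS x hx
    refine ⟨?_, ?_, h5 _ h1⟩
    · intro h0; rw [h0] at h1; simp at h1; exact h3 h1
    · rw [hW, le_div_iff₀ (by positivity)]
      rw [h1] at h4
      push_cast at h4
      rw [abs_mul, abs_of_pos (by positivity : (0 : ℝ) < (n : ℝ) ^ 2)] at h4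
      linarith
  have key : ∀ Δ : ℤ, ∃ Y : Finset Fm, Δ ∈ t → Ineq Y ∧ (∀ y ∈ Y, y.D = Δ) ∧
      ∀ F : Finset Fm, (∀ x ∈ F, x ∈ S ∧ x.D / n ^ 2 = Δ) → (F.card : ℝ) ≤ T * (1 + Y.card) := by
    intro Δ
    by_cases hΔ : Δ ∈ t
    · obtain ⟨p1, p2, p3⟩ := htp Δ hΔ
      obtain ⟨Y, hY1, hY2, hY3⟩ := count_disc (n := n) hn p1 (S.filter (fun x => x.D / n ^ 2 = Δ))
        (hI.subset (Finset.filter_subset _ _)) (by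
          intro x hx
          obtain ⟨hx, h⟩ := Finset.mem_filter.1 hx
          exact ⟨(hS x hx).1, by rw [← h]; exact hdef x hx⟩)
      refine ⟨Y, fun _ => ⟨hY1, hY2, ?_⟩⟩
      intro F hF
      have h1 : F.card ≤ (S.filter (fun x => x.D / n ^ 2 = Δ)).card :=
        Finset.card_le_card (fun x hx => Finset.mem_filter.2 (hF x hx))
      calc (F.card : ℝ) ≤ _ := by exact_mod_cast h1
        _ ≤ _ := hY3
        _ ≤ _ := by gcongr
    · exact ⟨∅, fun h => absurd h hΔ⟩
  choose Y hY using key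
  have h1 := card_le_sum_fib S t (fun x => x.D / n ^ 2) (fun Δ => T * (1 + (Y Δ).card))
    (fun x hx => Finset.mem_image_of_mem _ hx) (fun Δ hΔ => (hY Δ hΔ).2.2)
  have hdisj : ((t.biUnion Y).card : ℝ) = ∑ Δ ∈ t, ((Y Δ).card : ℝ) := by
    rw [Finset.card_biUnion]
    · push_cast; rfl
    · intro a ha b hb hab
      change Disjoint (Y a) (Y b)
      rw [Finset.disjoint_left]
      intro y hy hy'
      exact hab (((hY a ha).2.1 y hy).symm.trans ((hY b hb).2.1 y hy'))
  have h2 : ((t.biUnion Y).card : ℝ) ≤ C0 * W := by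
    apply hdav W hW0
    · intro x hx y hy hxy
      obtain ⟨a, ha, hx⟩ := Finset.mem_biUnion.1 hx
      obtain ⟨b, hb, hy⟩ := Finset.mem_biUnion.1 hy
      have e := E_D hxy
      rw [(hY a ha).2.1 x hx, (hY b hb).2.1 y hy] at e
      subst e
      exact (hY b ha).1 x hx y hy hxy
    · intro x hx
      obtain ⟨a, ha, hx⟩ := Finset.mem_biUnion.1 hx
      rw [(hY a ha).2.1 x hx]
      exact ⟨(htp a ha).1, (htp a ha).2.1⟩
  have h3 : (t.card : ℝ) ≤ 2 * W := by
    have hs : t ⊆ (Finset.Icc (-(⌊W⌋)) ⌊W⌋).erase 0 := by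
      intro Δ hΔ
      obtain ⟨p1, p2, -⟩ := htp Δ hΔ
      rw [Finset.mem_erase, Finset.mem_Icc]
      obtain ⟨q1, q2⟩ := abs_le.1 p2
      refine ⟨p1, ?_, Int.le_floor.2 q2⟩
      have : -Δ ≤ ⌊W⌋ := Int.le_floor.2 (by push_cast; linarith)
      linarith
    have h0 : 0 ≤ ⌊W⌋ := Int.floor_nonneg.2 hW0
    have hc := Finset.card_le_card hs
    rw [Finset.card_erase_of_mem (by rw [Finset.mem_Icc]; omega), Int.card_Icc] at hc
    have : (t.card : ℤ) ≤ 2 * ⌊W⌋ := by omega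
    have : (t.card : ℝ) ≤ 2 * (⌊W⌋ : ℝ) := by exact_mod_cast this
    linarith [Int.floor_le W]
  calc (S.card : ℝ) ≤ _ := h1
    _ = T * (t.card + (t.biUnion Y).card) := by
      rw [← Finset.mul_sum, Finset.sum_add_distrib, hdisj]; simp
    _ ≤ T * (2 * W + C0 * W) := by gcongr
    _ = _ := by ring

end DCB

end

section
namespace DCB
open Fm

theorem tau_bound (ε : ℝ) (hε : 0 < ε) : ∃ C : ℝ, 1 ≤ C ∧ ∀ n : ℕ, n ≠ 0 →
    (n.divisors.card : ℝ) ≤ C * (n : ℝ) ^ ε := by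
  set K : ℝ := 1 + 1 / (ε * Real.log 2) with hK
  have hl2 : 0 < Real.log 2 := Real.log_pos (by norm_num)
  have hK1 : 1 ≤ K := by rw [hK]; have : 0 < 1 / (ε * Real.log 2) := by positivity
                         linarith
  obtain ⟨P, hP⟩ := exists_nat_ge ((2 : ℝ) ^ (1 / ε))
  refine ⟨K ^ P, one_le_pow₀ hK1, ?_⟩
  intro n hn
  have key : ∀ p ∈ n.primeFactors, ((n.factorization p + 1 : ℕ) : ℝ) ≤
      (if p < P then K else 1) * ((p : ℝ) ^ ε) ^ (n.factorization p) := by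
    intro p hp
    have hpp := Nat.prime_of_mem_primeFactors hp
    set e := n.factorization p
    have hp2 : (2 : ℝ) ≤ p := by exact_mod_cast hpp.two_le
    split_ifs with h
    · have h1 : (2 : ℝ) ^ ε ≤ (p : ℝ) ^ ε := Real.rpow_le_rpow (by norm_num) hp2 hε.le
      have h2 : ((2 : ℝ) ^ ε) ^ e ≤ ((p : ℝ) ^ ε) ^ e := by gcongr
      have h3 : 1 + e * (ε * Real.log 2) ≤ ((2 : ℝ) ^ ε) ^ e := by
        rw [← Real.rpow_natCast, ← Real.rpow_mul (by norm_num), Real.rpow_def_of_pos (by norm_num)]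
        have := Real.add_one_le_exp (Real.log 2 * (ε * e))
        linarith
      have h4 : ((e + 1 : ℕ) : ℝ) ≤ K * (1 + e * (ε * Real.log 2)) := by
        rw [hK]; push_cast
        have : (1 + 1 / (ε * Real.log 2)) * (1 + e * (ε * Real.log 2)) =
          1 + e + (e * (ε * Real.log 2) + 1 / (ε * Real.log 2)) := by field_simp; ring
        rw [this]
        have : 0 ≤ e * (ε * Real.log 2) + 1 / (ε * Real.log 2) := by positivity
        linarith
      calc _ ≤ _ := h4
        _ ≤ _ := by
          have := h3.trans h2
          gcongr
    · have h0 : (2 : ℝ) ^ (1 / ε) ≤ p := hP.trans (by exact_mod_cast not_lt.1 h)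
      have h1 : (2 : ℝ) ≤ (p : ℝ) ^ ε := by
        have := Real.rpow_le_rpow (by positivity) h0 hε.le
        rwa [← Real.rpow_mul (by norm_num), one_div_mul_cancel hε.ne', Real.rpow_one] at this
      have h2 : (2 : ℝ) ^ e ≤ ((p : ℝ) ^ ε) ^ e := by gcongr
      have h3 : ((e + 1 : ℕ) : ℝ) ≤ 2 ^ e := by exact_mod_cast Nat.lt_two_pow_self
      rw [one_mul]; exact h3.trans h2
  rw [Nat.card_divisors hn]
  push_cast at key ⊢
  refine (Finset.prod_le_prod (fun p _ => by positivity) key).trans ?_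
  rw [Finset.prod_mul_distrib]
  have e1 : ∏ p ∈ n.primeFactors, ((p : ℝ) ^ ε) ^ (n.factorization p) = (n : ℝ) ^ ε := by
    have h := Nat.prod_factorization_pow_eq_self hn
    rw [Finsupp.prod, Nat.support_factorization] at h
    conv_rhs => rw [← h]
    push_cast
    rw [← Real.finsetProd_rpow _ _ (fun i _ => by positivity)]
    refine Finset.prod_congr rfl fun p hp => ?_
    rw [← Real.rpow_natCast, ← Real.rpow_natCast, ← Real.rpow_mul (by positivity),
      ← Real.rpow_mul (by positivity), mul_comm]
  rw [e1]
  gcongr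
  rw [Finset.prod_ite, Finset.prod_const, Finset.prod_const, one_pow, mul_one]
  apply pow_le_pow_right₀ hK1
  calc _ ≤ (Finset.range P).card := Finset.card_le_card (fun p hp => by
            simp only [Finset.mem_filter] at hp; exact Finset.mem_range.2 hp.2)
    _ = P := Finset.card_range P

theorem card_ap (F : Finset ℤ) (L j : ℤ) (hL : 0 < L) (hj : 0 ≤ j)
    (h : ∀ s ∈ F, 0 ≤ s ∧ s < L * j) (hc : ∀ s ∈ F, ∀ s' ∈ F, L ∣ s - s') : (F.card : ℤ) ≤ j := by
  have h1 : F.card ≤ (Finset.Ico 0 j).card := by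
    apply Finset.card_le_card_of_injOn (fun s => s / L)
    · intro s hs
      obtain ⟨h1, h2⟩ := h s hs
      simp only [Finset.coe_Ico, Set.mem_Ico]
      exact ⟨Int.ediv_nonneg h1 hL.le, Int.ediv_lt_of_lt_mul hL (by linarith)⟩
    · intro s hs s' hs' he
      simp only at he
      have : s % L = s' % L := Int.emod_eq_emod_iff_emod_sub_eq_zero.2
        (Int.emod_eq_zero_of_dvd (hc s hs s' hs'))
      rw [← Int.mul_ediv_add_emod s L, ← Int.mul_ediv_add_emod s' L, he, this]
  rw [Int.card_Ico] at h1
  omega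

theorem sq_dvd_lem1 {e Q1 R : ℕ} (hQ : Q1 ≠ 0) (h : e ^ 2 ∣ Q1 ^ 2 * R) : (e / e.gcd Q1) ^ 2 ∣ R := by
  have hg : 0 < e.gcd Q1 := Nat.gcd_pos_of_pos_right _ (Nat.pos_of_ne_zero hQ)
  have hc := Nat.coprime_div_gcd_div_gcd hg
  set g := e.gcd Q1 with hgd
  obtain ⟨e', he⟩ : g ∣ e := Nat.gcd_dvd_left _ _
  obtain ⟨q, hq⟩ : g ∣ Q1 := Nat.gcd_dvd_right _ _
  have e1 : e / g = e' := by rw [he]; exact Nat.mul_div_cancel_left _ hg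
  have e2 : Q1 / g = q := by rw [hq]; exact Nat.mul_div_cancel_left _ hg
  rw [e1, e2] at hc
  rw [e1]
  have h2 : g ^ 2 * e' ^ 2 ∣ g ^ 2 * (q ^ 2 * R) := by
    rw [← mul_pow, ← he, ← mul_assoc, ← mul_pow, ← hq]; exact h
  have h3 := Nat.dvd_of_mul_dvd_mul_left (by positivity) h2
  exact (Nat.Coprime.pow 2 2 hc).dvd_of_dvd_mul_left h3

theorem sq_dvd_lem2 {e Q k : ℕ} (hQ : Squarefree Q) (h : e ^ 2 ∣ Q * k) : e ∣ k := by
  have hQ0 : Q ≠ 0 := hQ.ne_zero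
  have hg : 0 < e.gcd Q := Nat.gcd_pos_of_pos_right _ (Nat.pos_of_ne_zero hQ0)
  have hc := Nat.coprime_div_gcd_div_gcd hg
  set g := e.gcd Q with hgd
  obtain ⟨e', he⟩ : g ∣ e := Nat.gcd_dvd_left _ _
  obtain ⟨q, hq⟩ : g ∣ Q := Nat.gcd_dvd_right _ _
  have e1 : e / g = e' := by rw [he]; exact Nat.mul_div_cancel_left _ hg
  have e2 : Q / g = q := by rw [hq]; exact Nat.mul_div_cancel_left _ hg
  rw [e1, e2] at hc
  have hgq : Nat.Coprime g q := by
    rw [hq] at hQ; exact Nat.coprime_of_squarefree_mul hQ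
  have h2 : g * (g * e' ^ 2) ∣ g * (q * k) := by
    rw [← mul_assoc g q, ← hq]; refine dvd_trans ?_ h; rw [he]; exact ⟨1, by ring⟩
  have h3 := Nat.dvd_of_mul_dvd_mul_left hg h2
  have hec : Nat.Coprime e q := by rw [he]; exact Nat.Coprime.mul_left hgq hc
  have h4 : e ∣ q * k := dvd_trans ⟨e', by rw [he]; ring⟩ h3
  exact hec.dvd_of_dvd_mul_left h4
end DCB

end

section
namespace DCB
open Fm

theorem rts_card {Q1 Q k : ℕ} (hQ1 : Squarefree Q1) (hQ : Squarefree Q) (hk : k ≠ 0) (Δ : ℤ)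
    (hΔ : ∀ p : ℕ, p.Prime → p ∣ Q1 → ¬ (p : ℤ) ∣ Δ) (M : ℕ)
    (hM : ∀ e : ℕ, e ∣ k → e ^ 2 ∣ Q * k → e ≤ M) :
    ((rts ((Q1 ^ 2 * Q * k : ℕ) : ℤ) Δ).card : ℝ) ≤ ((Q1 ^ 2 * Q * k).divisors.card : ℝ) * (4 * M) := by
  have hQ10 : Q1 ≠ 0 := hQ1.ne_zero
  have hQ0 : Q ≠ 0 := hQ.ne_zero
  have hn0 : Q1 ^ 2 * Q * k ≠ 0 := by positivity
  obtain ⟨n, hn⟩ : ∃ n, n = Q1 ^ 2 * Q * k := ⟨_, rfl⟩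
  rw [← hn] at hn0 ⊢
  rcases (rts (n : ℤ) Δ).eq_empty_or_nonempty with he | ⟨s1, hs1⟩
  · rw [he]; simp; positivity
  have hmem : ∀ s ∈ rts (n : ℤ) Δ, 0 ≤ s ∧ s < 2 * n ∧ (n : ℤ) ∣ s ^ 2 - Δ := by
    intro s hs
    obtain ⟨h1, h2⟩ := Finset.mem_filter.1 hs
    exact ⟨(Finset.mem_Ico.1 h1).1, (Finset.mem_Ico.1 h1).2, h2⟩
  apply card_le_mul_fib (rts (n : ℤ) Δ) n.divisors (fun s => Int.gcd (s - s1) n)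
  · intro s hs
    rw [Nat.mem_divisors]
    exact ⟨Int.natCast_dvd_natCast.1 (Int.gcd_dvd_right ..), hn0⟩
  intro d hd F hF
  rcases F.eq_empty_or_nonempty with rfl | ⟨s2, hs2⟩
  · simp
  obtain ⟨⟨n', hn'⟩, -⟩ := Nat.mem_divisors.1 hd
  have hd0 : 0 < d := Nat.pos_of_ne_zero (by rintro rfl; simp at hn'; exact hn0 hn')
  have hn'0 : 0 < n' := Nat.pos_of_ne_zero (by rintro rfl; simp at hn'; exact hn0 hn')
  have hFs : ∀ s ∈ F, (d : ℤ) ∣ s - s1 ∧ (n' : ℤ) ∣ s + s1 := by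
    intro s hs
    obtain ⟨hs', hg⟩ := hF s hs
    have h1 : (d : ℤ) ∣ s - s1 := by rw [← hg]; exact Int.gcd_dvd_left ..
    refine ⟨h1, ?_⟩
    obtain ⟨t, ht⟩ := h1
    have hco : Int.gcd t n' = 1 := by
      rw [ht, hn'] at hg
      push_cast at hg
      rw [Int.gcd_mul_left] at hg
      simp only [Int.natAbs_natCast] at hg
      exact Nat.eq_of_mul_eq_mul_left hd0 (by rw [hg, mul_one])
    have h2 : (n : ℤ) ∣ (s - s1) * (s + s1) := by
      have := dvd_sub (hmem s hs').2.2 (hmem s1 hs1).2.2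
      rwa [show s ^ 2 - Δ - (s1 ^ 2 - Δ) = (s - s1) * (s + s1) by ring] at this
    rw [ht, hn'] at h2
    push_cast at h2
    rw [mul_assoc] at h2
    have h3 := Int.dvd_of_mul_dvd_mul_left (by positivity : (d : ℤ) ≠ 0) h2
    exact (Int.isCoprime_iff_gcd_eq_one.2 hco).symm.dvd_of_dvd_mul_left h3
  set e := Nat.gcd d n' with he
  have he0 : 0 < e := Nat.gcd_pos_of_pos_left _ hd0
  have hen : e ^ 2 ∣ n := by
    rw [hn', pow_two]; exact Nat.mul_dvd_mul (Nat.gcd_dvd_left _ _) (Nat.gcd_dvd_right _ _)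
  have hed : (e : ℤ) ∣ d := Int.natCast_dvd_natCast.2 (Nat.gcd_dvd_left _ _)
  have hen' : (e : ℤ) ∣ n' := Int.natCast_dvd_natCast.2 (Nat.gcd_dvd_right _ _)
  have he2s : (e : ℤ) ∣ 2 * s1 := by
    have := dvd_sub (hen'.trans (hFs s2 hs2).2) (hed.trans (hFs s2 hs2).1)
    rwa [show s2 + s1 - (s2 - s1) = 2 * s1 by ring] at this
  -- gcd(e, Q1) divides 2
  have hg2 : e.gcd Q1 ≤ 2 := by
    have hcop : IsCoprime ((e.gcd Q1 : ℕ) : ℤ) s1 := by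
      apply IsCoprime.symm
      apply isCoprime_of_primes
      · have := Nat.gcd_pos_of_pos_left Q1 he0; omega
      intro p hp hpg hps
      have hpQ : p ∣ Q1 := (Int.natCast_dvd_natCast.1 hpg).trans (Nat.gcd_dvd_right _ _)
      apply hΔ p hp hpQ
      have h1 : (p : ℤ) ∣ n := Int.natCast_dvd_natCast.2 (by
        rw [hn]; exact hpQ.trans ⟨Q1 * (Q * k), by ring⟩)
      have h2 := h1.trans (hmem s1 hs1).2.2
      have h3 := dvd_sub (hps.trans (dvd_pow_self s1 two_ne_zero)) h2
      rwa [sub_sub_cancel] at h3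
    have h1 : ((e.gcd Q1 : ℕ) : ℤ) ∣ 2 * s1 :=
      (Int.natCast_dvd_natCast.2 (Nat.gcd_dvd_left _ _)).trans he2s
    have h2 := hcop.dvd_of_dvd_mul_right h1
    exact Nat.le_of_dvd (by norm_num) (by exact_mod_cast h2)
  have heM : e ≤ 2 * M := by
    have h1 : (e / e.gcd Q1) ^ 2 ∣ Q * k := sq_dvd_lem1 hQ10 (by rw [← mul_assoc, ← hn]; exact hen)
    have h2 := hM _ (sq_dvd_lem2 hQ h1) h1
    calc e = e.gcd Q1 * (e / e.gcd Q1) := (Nat.mul_div_cancel' (Nat.gcd_dvd_left _ _)).symm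
      _ ≤ 2 * M := Nat.mul_le_mul hg2 h2
  have hlcm : Nat.lcm d n' * e = n := by rw [mul_comm, he, Nat.gcd_mul_lcm, hn']
  have hL := card_ap F (Nat.lcm d n') (2 * e) (by exact_mod_cast Nat.lcm_pos hd0 hn'0) (by positivity)
    (by
      intro s hs
      obtain ⟨h1, h2, -⟩ := hmem s (hF s hs).1
      refine ⟨h1, h2.trans_eq ?_⟩
      rw [← hlcm]; push_cast; ring)
    (by
      intro s hs s' hs'
      obtain ⟨a1, b1⟩ := hFs s hs
      obtain ⟨a2, b2⟩ := hFs s' hs'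
      have h1 := dvd_sub a1 a2
      have h2 := dvd_sub b1 b2
      rw [show s - s1 - (s' - s1) = s - s' by ring] at h1
      rw [show s + s1 - (s' + s1) = s - s' by ring] at h2
      rw [Int.natCast_dvd] at h1 h2 ⊢
      exact Nat.lcm_dvd h1 h2)
  have : F.card ≤ 4 * M := by
    have : (F.card : ℤ) ≤ 4 * M := by linarith [(by exact_mod_cast heM : (e : ℤ) ≤ 2 * M)]
    exact_mod_cast this
  exact_mod_cast this

theorem rts_bound (ε : ℝ) (hε : 0 < ε) (hε4 : ε ≤ 1 / 4) : ∃ C : ℝ, 0 < C ∧ ∀ Q1 Q k : ℕ, Squarefree Q1 →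
    Squarefree Q → k ≠ 0 → ∀ Δ : ℤ, (∀ p : ℕ, p.Prime → p ∣ Q1 → ¬ (p : ℤ) ∣ Δ) →
    ((rts ((Q1 ^ 2 * Q * k : ℕ) : ℤ) Δ).card : ℝ) ≤
      C * ((Q1 : ℝ) ^ (2 * ε) * (Q : ℝ) ^ (3 * ε) * (k : ℝ) ^ (1 - ε)) := by
  obtain ⟨C, hC1, hC⟩ := tau_bound ε hε
  refine ⟨C * 4, by positivity, ?_⟩
  intro Q1 Q k hQ1 hQ hk Δ hΔ
  have hQ10 : Q1 ≠ 0 := hQ1.ne_zero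
  have hQ0 : Q ≠ 0 := hQ.ne_zero
  have hkp : (0 : ℝ) < k := by exact_mod_cast Nat.pos_of_ne_zero hk
  have hQp : (0 : ℝ) < Q := by exact_mod_cast Nat.pos_of_ne_zero hQ0
  have hQ1p : (0 : ℝ) < Q1 := by exact_mod_cast Nat.pos_of_ne_zero hQ10
  set B : ℝ := (k : ℝ) ^ (1 - 4 * ε) * (Q * k : ℝ) ^ (2 * ε) with hB
  have h := rts_card hQ1 hQ hk Δ hΔ ⌊B⌋₊ (by
    intro e h1 h2
    apply Nat.le_floor
    have hkk : e ≤ k := Nat.le_of_dvd (Nat.pos_of_ne_zero hk) h1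
    have hqk : e ^ 2 ≤ Q * k := Nat.le_of_dvd (by positivity) h2
    rcases Nat.eq_zero_or_pos e with rfl | hep
    · simp; positivity
    have hep' : (0 : ℝ) < e := by exact_mod_cast hep
    have e1 : (e : ℝ) = (e : ℝ) ^ (1 - 4 * ε) * ((e : ℝ) ^ 2) ^ (2 * ε) := by
      rw [← Real.rpow_natCast, ← Real.rpow_mul hep'.le, ← Real.rpow_add hep']
      have : 1 - 4 * ε + (2 : ℕ) * (2 * ε) = 1 := by push_cast; ring
      rw [this, Real.rpow_one]
    rw [e1, hB]
    have q1 : (e : ℝ) ≤ k := by exact_mod_cast hkk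
    have q2 : (e : ℝ) ^ 2 ≤ Q * k := by exact_mod_cast hqk
    have : 0 ≤ 1 - 4 * ε := by linarith
    gcongr)
  have h1 := hC (Q1 ^ 2 * Q * k) (by positivity)
  have h2 : ((⌊B⌋₊ : ℕ) : ℝ) ≤ B := Nat.floor_le (by positivity)
  calc _ ≤ _ := h
    _ ≤ (C * ((Q1 ^ 2 * Q * k : ℕ) : ℝ) ^ ε) * (4 * B) := by gcongr
    _ = _ := by
      push_cast
      rw [hB, Real.mul_rpow (by positivity) (by positivity), Real.mul_rpow (by positivity) (by positivity),
        Real.mul_rpow (by positivity) (by positivity), ← Real.rpow_natCast, ← Real.rpow_mul hQ1p.le]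
      have e1 : (Q : ℝ) ^ (3 * ε) = (Q : ℝ) ^ ε * (Q : ℝ) ^ (2 * ε) := by
        rw [← Real.rpow_add hQp]; congr 1; ring
      have e2 : (k : ℝ) ^ (1 - ε) = (k : ℝ) ^ ε * (k : ℝ) ^ (1 - 4 * ε) * (k : ℝ) ^ (2 * ε) := by
        rw [← Real.rpow_add hkp, ← Real.rpow_add hkp]; congr 1; ring
      rw [e1, e2]; push_cast; ring
end DCB

end

section
namespace DCB
open Fm

/-- content -/
def cont (x : Fm) : ℕ := Nat.gcd (Nat.gcd x.a.natAbs x.b.natAbs) (Nat.gcd x.c.natAbs x.d.natAbs)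
/-- Hessian content -/
def hcont (x : Fm) : ℕ := Nat.gcd (Nat.gcd x.hA.natAbs x.hB.natAbs) x.hC.natAbs

theorem dvd_cont (k : ℕ) (x : Fm) : k ∣ cont x ↔ Dv k x := by
  simp only [cont, Dv, Nat.dvd_gcd_iff, Int.natCast_dvd]; tauto
theorem dvd_hcont (k : ℕ) (x : Fm) : k ∣ hcont x ↔ HDv k x := by
  simp only [hcont, HDv, Nat.dvd_gcd_iff, Int.natCast_dvd]; tauto

theorem cont_ne {x : Fm} (h : x.D ≠ 0) : cont x ≠ 0 := by
  intro h0
  obtain ⟨h1, h2, h3, h4⟩ := (dvd_cont 0 x).1 (by rw [h0])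
  simp at h1 h2 h3 h4
  exact h (by simp [D, hA, hB, hC, h1, h2, h3, h4])
theorem hcont_ne {x : Fm} (h : x.D ≠ 0) : hcont x ≠ 0 := by
  intro h0
  obtain ⟨h1, h2, h3⟩ := (dvd_hcont 0 x).1 (by rw [h0])
  simp at h1 h2 h3
  exact h (by simp [D, h1, h2, h3])

theorem exists_prim {x : Fm} (h : x.D ≠ 0) : ∃ z, x = smul (cont x) z ∧ ∀ p : ℕ, p.Prime → ¬ Dv p z := by
  obtain ⟨z, hz⟩ := Dv_iff.1 ((dvd_cont (cont x) x).1 dvd_rfl)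
  refine ⟨z, hz, ?_⟩
  intro p hp hpz
  obtain ⟨w, rfl⟩ := Dv_iff.1 hpz
  have : cont x * p ∣ cont x := by
    rw [dvd_cont, Dv_iff]
    refine ⟨w, hz.trans ?_⟩
    ext <;> simp [smul] <;> ring
  have := Nat.le_of_dvd (Nat.pos_of_ne_zero (cont_ne h)) this
  have := hp.two_le
  have := Nat.pos_of_ne_zero (cont_ne h)
  nlinarith

theorem good_hcont {z : Fm} (h : z.D ≠ 0) (hp : ∀ p : ℕ, p.Prime → ¬ Dv p z) : Good (hcont z) z := by
  refine ⟨hp, ?_⟩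
  obtain ⟨⟨A, hA'⟩, ⟨B, hB'⟩, ⟨C, hC'⟩⟩ := (dvd_hcont (hcont z) z).1 dvd_rfl
  refine ⟨A, B, C, hA', hB', hC', ?_⟩
  rintro p hp ⟨⟨a, rfl⟩, ⟨b, rfl⟩, ⟨c, rfl⟩⟩
  have : hcont z * p ∣ hcont z := by
    rw [dvd_hcont]
    exact ⟨⟨a, by rw [hA']; push_cast; ring⟩, ⟨b, by rw [hB']; push_cast; ring⟩,
      ⟨c, by rw [hC']; push_cast; ring⟩⟩
  have := Nat.le_of_dvd (Nat.pos_of_ne_zero (hcont_ne h)) this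
  have := hp.two_le
  have := Nat.pos_of_ne_zero (hcont_ne h)
  nlinarith

theorem smul_inj {k : ℤ} (hk : k ≠ 0) {x y : Fm} (h : smul k x = smul k y) : x = y := by
  have h1 := congrArg Fm.a h
  have h2 := congrArg Fm.b h
  have h3 := congrArg Fm.c h
  have h4 := congrArg Fm.d h
  simp only [smul] at h1 h2 h3 h4
  exact Fm.ext (mul_left_cancel₀ hk h1) (mul_left_cancel₀ hk h2) (mul_left_cancel₀ hk h3)
    (mul_left_cancel₀ hk h4)

theorem E_smul {k : ℤ} {x y : Fm} (h : E x y) : E (smul k x) (smul k y) := by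
  obtain ⟨α, β, g, δ, h1, rfl⟩ := h
  exact ⟨α, β, g, δ, h1, smul_T _ _ _ _ _ _⟩

theorem squarefree_dvd_of_primes {Q m : ℕ} (hQ : Squarefree Q) (h : ∀ p : ℕ, p.Prime → p ∣ Q → p ∣ m) : Q ∣ m := by
  rcases Nat.eq_zero_or_pos m with rfl | hm
  · simp
  rw [← Nat.prod_primeFactors_of_squarefree hQ]
  refine Finset.prod_dvd_of_isRelPrime ?_ ?_
  · intro p hp p' hp' hne
    exact Nat.coprime_iff_isRelPrime.1 ((Nat.coprime_primes (Nat.prime_of_mem_primeFactors hp)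
      (Nat.prime_of_mem_primeFactors hp')).2 hne)
  · intro p hp
    exact h p (Nat.prime_of_mem_primeFactors hp) (Nat.dvd_of_mem_primeFactors hp)

theorem squarefree_sq_dvd_of_primes {Q m : ℕ} (hQ : Squarefree Q)
    (h : ∀ p : ℕ, p.Prime → p ∣ Q → p ^ 2 ∣ m) : Q ^ 2 ∣ m := by
  rcases Nat.eq_zero_or_pos m with rfl | hm
  · simp
  rw [← Nat.prod_primeFactors_of_squarefree hQ, ← Finset.prod_pow]
  refine Finset.prod_dvd_of_isRelPrime ?_ ?_
  · intro p hp p' hp' hne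
    exact Nat.coprime_iff_isRelPrime.1 (Nat.Coprime.pow _ _ ((Nat.coprime_primes (Nat.prime_of_mem_primeFactors hp)
      (Nat.prime_of_mem_primeFactors hp')).2 hne))
  · intro p hp
    exact h p (Nat.prime_of_mem_primeFactors hp) (Nat.dvd_of_mem_primeFactors hp)

/-- the condition at the primes dividing `Q1` and `Q` -/
def Cnd (Q1 Q : ℕ) (x : Fm) : Prop :=
  (∀ p : ℕ, p.Prime → p ∣ Q1 → ¬ Dv p x ∧ HDv ((p : ℤ) ^ 2) x ∧ ¬ (p : ℤ) ^ 5 ∣ x.D) ∧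
  (∀ p : ℕ, p.Prime → p ∣ Q → ¬ Dv p x ∧ HDv p x)

theorem cop_cont {e p : ℕ} (hp : p.Prime) {z : Fm} (h : ¬ Dv p (smul e z)) : IsCoprime (p : ℤ) e := by
  rw [Nat.isCoprime_iff_coprime, Nat.Prime.coprime_iff_not_dvd hp]
  intro hpe
  exact h (Dv_iff.2 (by
    obtain ⟨f, rfl⟩ := hpe
    exact ⟨smul f z, by ext <;> simp [smul] <;> ring⟩))

theorem HDv_of_smul {e k : ℤ} {z : Fm} (hc : IsCoprime k e) (h : HDv k (smul e z)) : HDv k z := by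
  obtain ⟨h1, h2, h3⟩ := h
  rw [hA_smul] at h1; rw [hB_smul] at h2; rw [hC_smul] at h3
  have := hc.pow_right (n := 2)
  exact ⟨this.dvd_of_dvd_mul_left h1, this.dvd_of_dvd_mul_left h2, this.dvd_of_dvd_mul_left h3⟩

theorem Cnd.of_smul {Q1 Q e : ℕ} {z : Fm} (h : Cnd Q1 Q (smul e z)) : Cnd Q1 Q z := by
  constructor
  · intro p hp hpQ
    obtain ⟨h1, h2, h3⟩ := h.1 p hp hpQ
    have hc := cop_cont hp h1
    refine ⟨fun h => h1 ?_, HDv_of_smul hc.pow_left h2, fun h => h3 ?_⟩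
    · obtain ⟨w, rfl⟩ := Dv_iff.1 h
      exact Dv_iff.2 ⟨smul e w, by ext <;> simp [smul] <;> ring⟩
    · rw [D_smul]; exact h.mul_left _
  · intro p hp hpQ
    obtain ⟨h1, h2⟩ := h.2 p hp hpQ
    have hc := cop_cont hp h1
    refine ⟨fun h => h1 ?_, HDv_of_smul hc h2⟩
    obtain ⟨w, rfl⟩ := Dv_iff.1 h
    exact Dv_iff.2 ⟨smul e w, by ext <;> simp [smul] <;> ring⟩

theorem Cnd.hc {Q1 Q : ℕ} {z : Fm} (h : Cnd Q1 Q z) (h1 : Squarefree Q1) (h2 : Squarefree Q)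
    (hc : Nat.Coprime Q1 Q) : Q1 ^ 2 * Q ∣ hcont z := by
  apply Nat.Coprime.mul_dvd_of_dvd_of_dvd (hc.pow_left 2)
  · apply squarefree_sq_dvd_of_primes h1
    intro p hp hpQ
    rw [dvd_hcont]; push_cast; exact (h.1 p hp hpQ).2.1
  · apply squarefree_dvd_of_primes h2
    intro p hp hpQ
    rw [dvd_hcont]; exact (h.2 p hp hpQ).2

theorem cnt1 (ε : ℝ) (hε : 0 < ε) (hε4 : ε ≤ 1 / 4) : ∃ C : ℝ, 0 < C ∧ ∀ Q1 Q : ℕ, Squarefree Q1 →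
    Squarefree Q → Nat.Coprime Q1 Q → ∀ Z : ℝ, 0 ≤ Z → ∀ S : Finset Fm, Ineq S →
    (∀ x ∈ S, Cnd Q1 Q x ∧ x.D ≠ 0 ∧ |(x.D : ℝ)| ≤ Z) →
    (S.card : ℝ) ≤ C * ((Q1 : ℝ) ^ (2 * ε) * (Q : ℝ) ^ (3 * ε)) * (Z / ((Q1 : ℝ) ^ 4 * (Q : ℝ) ^ 2)) := by
  obtain ⟨C1, hC1, hcc⟩ := comp_count
  obtain ⟨C2, hC2, hrt⟩ := rts_bound ε hε hε4
  have hsum : Summable (fun k : ℕ => (k : ℝ) ^ (-(1 + ε))) := Real.summable_nat_rpow.2 (by linarith)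
  set Sg := ∑' k : ℕ, (k : ℝ) ^ (-(1 + ε)) with hSg
  have hSg0 : 0 ≤ Sg := tsum_nonneg (fun k => by positivity)
  refine ⟨C1 * C2 * 2 * (Sg + 1), by positivity, ?_⟩
  intro Q1 Q hQ1 hQ hcop Z hZ S hI hS
  have hQ1p : (0 : ℝ) < Q1 := by exact_mod_cast Nat.pos_of_ne_zero hQ1.ne_zero
  have hQp : (0 : ℝ) < Q := by exact_mod_cast Nat.pos_of_ne_zero hQ.ne_zero
  have key : ∀ x : Fm, ∃ (z : Fm) (k : ℕ), x ∈ S → x = smul (cont x) z ∧ hcont z = Q1 ^ 2 * Q * k ∧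
      k ≠ 0 ∧ Good (hcont z) z ∧ Cnd Q1 Q z ∧ z.D ≠ 0 := by
    intro x
    by_cases hx : x ∈ S
    · obtain ⟨h1, h2, h3⟩ := hS x hx
      obtain ⟨z, hz, hp⟩ := exists_prim h2
      have hzD : z.D ≠ 0 := by
        intro h0; apply h2; rw [hz, D_smul, h0, mul_zero]
      have hzC : Cnd Q1 Q z := by rw [hz] at h1; exact h1.of_smul
      obtain ⟨k, hk⟩ := hzC.hc hQ1 hQ hcop
      refine ⟨z, k, fun _ => ⟨hz, hk, ?_, good_hcont hzD hp, hzC, hzD⟩⟩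
      rintro rfl
      exact hcont_ne hzD (by rw [hk, mul_zero])
    · exact ⟨x, 0, fun h => absurd h hx⟩
  choose f kf hf using key
  set K := S.image kf with hK
  set Es := S.image cont with hEs
  have hE1 : ∑ e ∈ Es, (1 : ℝ) / (e : ℝ) ^ 4 ≤ 2 := by
    obtain ⟨N, hN⟩ := Es.exists_nat_subset_range
    have hsub : Es ⊆ Finset.Icc 1 N := by
      intro e he
      have h1 := Finset.mem_range.1 (hN he)
      obtain ⟨x, hx, rfl⟩ := Finset.mem_image.1 he
      have := cont_ne (hS x hx).2.1
      exact Finset.mem_Icc.2 ⟨by omega, by omega⟩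
    calc _ ≤ ∑ e ∈ Finset.Icc 1 N, (1 : ℝ) / (e : ℝ) ^ 4 :=
          Finset.sum_le_sum_of_subset_of_nonneg hsub (fun _ _ _ => by positivity)
      _ ≤ ∑ e ∈ Finset.Icc 1 N, (1 : ℝ) / (e : ℝ) ^ 2 := by
          refine Finset.sum_le_sum fun e he => ?_
          have : (1 : ℝ) ≤ e := by exact_mod_cast (Finset.mem_Icc.1 he).1
          apply one_div_le_one_div_of_le (by positivity)
          exact pow_le_pow_right₀ this (by norm_num)
      _ ≤ 2 := sum_inv_sq_le N
  have hK1 : ∑ k ∈ K, (k : ℝ) ^ (-(1 + ε)) ≤ Sg := hsum.sum_le_tsum _ (fun k _ => by positivity)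
  set W : ℝ := C1 * C2 * ((Q1 : ℝ) ^ (2 * ε) * (Q : ℝ) ^ (3 * ε)) * (Z / ((Q1 : ℝ) ^ 4 * (Q : ℝ) ^ 2)) with hW
  have hW0 : 0 ≤ W := by positivity
  have main := card_le_sum_fib S (Es ×ˢ K) (fun x => (cont x, kf x))
    (fun b => W * ((1 : ℝ) / (b.1 : ℝ) ^ 4 * (b.2 : ℝ) ^ (-(1 + ε))))
    (fun x hx => Finset.mem_product.2 ⟨Finset.mem_image_of_mem _ hx, Finset.mem_image_of_mem _ hx⟩) (by
      rintro ⟨e, k⟩ hb F hF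
      obtain ⟨he, hk⟩ := Finset.mem_product.1 hb
      have he0 : e ≠ 0 := by
        obtain ⟨x, hx, rfl⟩ := Finset.mem_image.1 he
        exact cont_ne (hS x hx).2.1
      have hk0 : k ≠ 0 := by
        obtain ⟨x, hx, rfl⟩ := Finset.mem_image.1 hk
        exact (hf x hx).2.2.1
      have hep : (0 : ℝ) < e := by exact_mod_cast Nat.pos_of_ne_zero he0
      have hkp : (0 : ℝ) < k := by exact_mod_cast Nat.pos_of_ne_zero hk0
      have hF' : ∀ x ∈ F, x ∈ S ∧ cont x = e ∧ kf x = k := by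
        intro x hx
        have := hF x hx
        simp only [Prod.mk.injEq] at this
        exact this
      obtain ⟨hI', hcard⟩ := Ineq.image (S := F) f (by
        intro x hx y hy hxy
        obtain ⟨a1, a2, a3⟩ := hF' x hx
        obtain ⟨b1, b2, b3⟩ := hF' y hy
        apply hI x a1 y b1
        rw [(hf x a1).1, (hf y b1).1, a2, b2]
        exact E_smul hxy)
      set n : ℕ := Q1 ^ 2 * Q * k with hn
      have hn0 : n ≠ 0 := by
        have := hQ1.ne_zero
        have := hQ.ne_zero
        positivity
      have h := hcc (n : ℤ) (by exact_mod_cast Nat.pos_of_ne_zero hn0)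
        (C2 * ((Q1 : ℝ) ^ (2 * ε) * (Q : ℝ) ^ (3 * ε) * (k : ℝ) ^ (1 - ε)))
        (Z / (e : ℝ) ^ 4) (by positivity) (by positivity) _ hI' (by
          intro z hz
          obtain ⟨x, hx, rfl⟩ := Finset.mem_image.1 hz
          obtain ⟨a1, a2, a3⟩ := hF' x hx
          obtain ⟨b1, b2, b3, b4, b5, b6⟩ := hf x a1
          rw [a3] at b2
          rw [b2] at b4
          refine ⟨b4, b6, ?_, ?_⟩
          · have h3 := (hS x a1).2.2
            rw [b1, D_smul, a2] at h3
            push_cast at h3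
            rw [abs_mul, abs_of_pos (by positivity : (0 : ℝ) < (e : ℝ) ^ 4)] at h3
            rw [le_div_iff₀ (by positivity)]; linarith
          · intro Δ hΔ
            apply hrt Q1 Q k hQ1 hQ hk0
            intro p hp hpQ hpΔ
            apply (b5.1 p hp hpQ).2.2
            rw [hΔ]
            obtain ⟨q, hq⟩ := hpQ
            obtain ⟨r, hr⟩ := hpΔ
            exact ⟨(q ^ 2 * Q * k) ^ 2 * r, by rw [hn, hr, hq]; push_cast; ring⟩)
      rw [hcard] at h
      refine h.trans (le_of_eq ?_)
      have ek : (k : ℝ) ^ (-(1 + ε)) = (k : ℝ) ^ (1 - ε) / (k : ℝ) ^ 2 := by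
        rw [← Real.rpow_natCast, ← Real.rpow_sub hkp]; congr 1; push_cast; ring
      rw [ek, hW, hn]
      push_cast
      field_simp)
  rw [← Finset.mul_sum, Finset.sum_product] at main
  simp only [← Finset.mul_sum] at main
  rw [← Finset.sum_mul] at main
  calc (S.card : ℝ) ≤ _ := main
    _ ≤ W * (2 * (Sg + 1)) := by
      have : 0 ≤ ∑ k ∈ K, (k : ℝ) ^ (-(1 + ε)) := Finset.sum_nonneg (fun _ _ => by positivity)
      have h' : ∑ k ∈ K, (k : ℝ) ^ (-(1 + ε)) ≤ Sg + 1 := by linarith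
      gcongr
    _ = _ := by rw [hW]; ring
end DCB

end

section
namespace DCB
open Fm

theorem T_adj {α β g δ : ℤ} (z : Fm) : T δ (-β) (-g) α (T α β g δ z) = smul ((α * δ - β * g) ^ 3) z := by
  rw [T_T, ← T_scalar]
  congr 1 <;> ring

theorem HDv_of_T {k α β g δ : ℤ} {z : Fm} (hc : IsCoprime k (α * δ - β * g))
    (h : HDv k (T α β g δ z)) : HDv k z := by
  have := HDv_T h δ (-β) (-g) α
  rw [T_adj] at this
  exact HDv_of_smul hc.pow_right this

/-- a form with a triple root mod `p` -/
theorem triple {p : ℕ} (hp : p.Prime) {x : Fm} (h1 : ¬ Dv p x) (h2 : HDv p x) :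
    ∃ y, E x y ∧ (p : ℤ) ∣ y.a ∧ (p : ℤ) ∣ y.b ∧ (p : ℤ) ∣ y.c ∧ ¬ (p : ℤ) ∣ y.d := by
  have hpp : Prime (p : ℤ) := Nat.prime_iff_prime_int.1 hp
  have step : ∀ y : Fm, ¬ Dv p y → HDv p y → (p : ℤ) ∣ y.a →
      (p : ℤ) ∣ y.a ∧ (p : ℤ) ∣ y.b ∧ (p : ℤ) ∣ y.c ∧ ¬ (p : ℤ) ∣ y.d := by
    rintro y h1 ⟨hA', hB', hC'⟩ ha
    have hb : (p : ℤ) ∣ y.b := by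
      apply hpp.dvd_of_dvd_pow (n := 2)
      have := dvd_add hA' (ha.mul_right y.c)
      rwa [hA, sub_add_cancel] at this
    have hc : (p : ℤ) ∣ y.c := by
      apply hpp.dvd_of_dvd_pow (n := 2)
      have := dvd_add hC' (hb.mul_right y.d)
      rwa [hC, sub_add_cancel] at this
    exact ⟨ha, hb, hc, fun hd => h1 ⟨ha, hb, hc, hd⟩⟩
  by_cases ha : (p : ℤ) ∣ x.a
  · exact ⟨x, E_refl x, step x h1 h2 ha⟩
  · obtain ⟨s, t, hst⟩ : IsCoprime (p : ℤ) x.a := (Prime.coprime_iff_not_dvd hpp).2 ha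
    -- root at (-b t, 1)
    have hE : E x (T (-(x.b * t)) (-1) 1 0 x) := ⟨_, _, _, _, by ring, rfl⟩
    refine ⟨_, hE, step _ (fun h => h1 ((Dv_E hE).2 h)) ((HDv_E hE).1 h2) ?_⟩
    obtain ⟨⟨A, hA'⟩, ⟨B, hB'⟩, ⟨C, hC'⟩⟩ := h2
    simp only [hA, hB, hC] at hA' hB' hC'
    have e : x.a ^ 2 * (T (-(x.b * t)) (-1) 1 0 x).a = p * (
        - x.b * s * (x.b * x.b * s * s * p ^ 2 * 1) * 0 + 0) + x.a ^ 2 * (T (-(x.b * t)) (-1) 1 0 x).a := by ring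
    have hk : ∃ k, x.a * (-(x.b * t)) + x.b = p * k := ⟨x.b * s, by linear_combination -x.b * hst⟩
    obtain ⟨k, hk⟩ := hk
    obtain ⟨w, hw⟩ : ∃ w, w = -(x.b * t) := ⟨_, rfl⟩
    rw [← hw] at hk ⊢
    have h3 : (p : ℤ) ∣ x.a ^ 2 * (T w (-1) 1 0 x).a := by
      simp only [T]
      refine ⟨(p * k) ^ 2 * k - 3 * A * (p * k) + 2 * x.b * A - x.a * B , ?_⟩
      linear_combination ((x.a * w + x.b) ^ 2 + (x.a * w + x.b) * (p * k) + (p * k) ^ 2 - 3 * (x.b ^ 2 - x.a * x.c)) * hk - 3 * (p * k) * hA' + 2 * x.b * hA' - x.a * hB'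
    rcases hpp.dvd_or_dvd h3 with h | h
    · exact absurd (hpp.dvd_of_dvd_pow h) ha
    · exact h

theorem c2_step {p : ℕ} (hp : p.Prime) {x : Fm} (h1 : ¬ Dv p x) (h2 : HDv ((p : ℤ) ^ 2) x)
    (h3 : (p : ℤ) ^ 5 ∣ x.D) : ∃ (z : Fm) (α β g δ : ℤ), α * δ - β * g = p ∧ x = T α β g δ z := by
  have hpp : Prime (p : ℤ) := Nat.prime_iff_prime_int.1 hp
  have hp0 : (p : ℤ) ≠ 0 := hpp.ne_zero
  have h2' : HDv p x := ⟨(dvd_pow_self _ two_ne_zero).trans h2.1, (dvd_pow_self _ two_ne_zero).trans h2.2.1,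
    (dvd_pow_self _ two_ne_zero).trans h2.2.2⟩
  obtain ⟨y, hE, ⟨a, ha⟩, ⟨b, hb⟩, ⟨c, hc⟩, hd⟩ := triple hp h1 h2'
  have hyH := (HDv_E hE).1 h2
  rw [← E_D hE] at h3
  have hcop : IsCoprime (p : ℤ) y.d := (Prime.coprime_iff_not_dvd hpp).2 hd
  obtain ⟨hA1, hB1, hC1⟩ := hyH
  have ha2 : (p : ℤ) ∣ a := by
    obtain ⟨k, hk⟩ := hB1
    simp only [hB, ha, hb, hc] at hk
    apply hcop.dvd_of_dvd_mul_right
    exact ⟨b * c - k, by apply mul_left_cancel₀ hp0; linear_combination -hk⟩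
  have hb2 : (p : ℤ) ∣ b := by
    obtain ⟨k, hk⟩ := hC1
    simp only [hC, ha, hb, hc] at hk
    apply hcop.dvd_of_dvd_mul_right
    exact ⟨c ^ 2 - k, by apply mul_left_cancel₀ hp0; linear_combination -hk⟩
  obtain ⟨a, rfl⟩ := ha2
  obtain ⟨b, rfl⟩ := hb2
  have ha3 : (p : ℤ) ∣ a := by
    obtain ⟨k, hk⟩ := h3
    simp only [D, hA, hB, hC, ha, hb, hc] at hk
    have : (p : ℤ) ∣ (a * y.d) ^ 2 := ⟨k - (p * b ^ 2 * c ^ 2 - 2 * b * c * a * y.d)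
      + 4 * (p * b ^ 2 - a * c) * (c ^ 2 - b * y.d), by
        apply mul_left_cancel₀ (pow_ne_zero 4 hp0); linear_combination hk⟩
    exact hcop.dvd_of_dvd_mul_right (hpp.dvd_of_dvd_pow this)
  obtain ⟨a, rfl⟩ := ha3
  have hy : y = T p 0 0 1 ⟨a, b, c, y.d⟩ := by
    ext
    · simp [T, ha]; ring
    · simp [T, hb]; ring
    · simp [T, hc]; ring
    · simp [T]
  obtain ⟨α, β, g, δ, hdet, hx⟩ := E_symm hE
  rw [hy, T_T] at hx
  refine ⟨_, _, _, _, _, ?_, hx.symm⟩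
  linear_combination (p : ℤ) * hdet

/-- condition at primes dividing `R` -/
def CndR (R : ℕ) (x : Fm) : Prop :=
  ∀ p : ℕ, p.Prime → p ∣ R → ¬ Dv p x ∧ HDv ((p : ℤ) ^ 2) x ∧ (p : ℤ) ^ 5 ∣ x.D

theorem cop_of_prime {p R : ℕ} (hp : p.Prime) (h : ¬ p ∣ R) : IsCoprime (p : ℤ) R := by
  rw [Nat.isCoprime_iff_coprime, Nat.Prime.coprime_iff_not_dvd hp]; exact h

theorem c2_all : ∀ R : ℕ, Squarefree R → ∀ x : Fm, CndR R x →
    ∃ (z : Fm) (α β g δ : ℤ), α * δ - β * g = R ∧ x = T α β g δ z := by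
  intro R
  induction R using Nat.strong_induction_on with
  | _ R ih =>
  intro hR x hx
  by_cases hR1 : R = 1
  · exact ⟨x, 1, 0, 0, 1, by rw [hR1]; norm_num, (T_id x).symm⟩
  obtain ⟨p, hp, R', rfl⟩ := Nat.exists_prime_and_dvd hR1
  have hR0 : 0 < R' := Nat.pos_of_ne_zero (by rintro rfl; exact hR.ne_zero (by simp))
  obtain ⟨h1, h2, h3⟩ := hx p hp (dvd_mul_right _ _)
  obtain ⟨z1, α, β, g, δ, hdet, rfl⟩ := c2_step hp h1 h2 h3
  have hcop : Nat.Coprime p R' := Nat.coprime_of_squarefree_mul hR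
  obtain ⟨z, α', β', g', δ', hdet', rfl⟩ := ih R' (by have := hp.two_le; nlinarith)
    (hR.of_mul_right) z1 (by
      intro p' hp' hpR
      obtain ⟨k1, k2, k3⟩ := hx p' hp' (hpR.mul_left _)
      have hne : ¬ p' ∣ p := by
        intro h
        have : p' = p := (Nat.prime_dvd_prime_iff_eq hp' hp).1 h
        subst this
        exact (Nat.Prime.coprime_iff_not_dvd hp').1 hcop hpR
      have hc := cop_of_prime hp' hne
      refine ⟨fun h => k1 (Dv_T h _ _ _ _), HDv_of_T (by rw [hdet]; exact hc.pow_left) k2, ?_⟩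
      rw [D_T, hdet] at k3
      exact (hc.pow (m := 5) (n := 6)).dvd_of_dvd_mul_left k3)
  refine ⟨z, _, _, _, _, ?_, T_T _ _ _ _ _ _ _ _ _⟩
  push_cast
  linear_combination (α * δ - β * g) * hdet' + R' * hdet

theorem hnf {R : ℕ} (hR : R ≠ 0) {α β g δ : ℤ} (hdet : α * δ - β * g = R) (z : Fm) :
    ∃ h ∈ R.divisors, ∃ b ∈ Finset.range R, E (T α β g δ z) (T h 0 b (R / h : ℕ) z) := by
  have hne : Int.gcd α β ≠ 0 := by
    rw [Ne, Int.gcd_eq_zero_iff]; rintro ⟨rfl, rfl⟩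
    simp at hdet; exact hR (by exact_mod_cast hdet.symm)
  obtain ⟨h, hh⟩ : ∃ h, h = Int.gcd α β := ⟨_, rfl⟩
  have hbez := Int.gcd_eq_gcd_ab α β
  obtain ⟨α', hα⟩ : (h : ℤ) ∣ α := by rw [hh]; exact Int.gcd_dvd_left ..
  obtain ⟨β', hβ⟩ : (h : ℤ) ∣ β := by rw [hh]; exact Int.gcd_dvd_right ..
  rw [← hh] at hbez hne
  have hh0 : (h : ℤ) ≠ 0 := by exact_mod_cast hne
  generalize Int.gcdA α β = u at hbez
  generalize Int.gcdB α β = v at hbez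
  have hb1 : α' * u + β' * v = 1 := by
    apply mul_left_cancel₀ hh0; rw [hα, hβ] at hbez; linear_combination -hbez
  have hR' : (R : ℤ) = h * (α' * δ - β' * g) := by rw [← hdet, hα, hβ]; ring
  have hhR : h ∣ R := Int.natCast_dvd_natCast.1 ⟨_, hR'⟩
  obtain ⟨d, hd⟩ := hhR
  have hd0 : 0 < d := Nat.pos_of_ne_zero (by rintro rfl; exact hR (by simpa using hd))
  have hdd : R / h = d := by rw [hd]; exact Nat.mul_div_cancel_left _ (Nat.pos_of_ne_zero hne)
  have hd2 : (d : ℤ) = α' * δ - β' * g := by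
    apply mul_left_cancel₀ hh0; rw [← hR', hd]; push_cast; ring
  obtain ⟨b0, hb0⟩ : ∃ b0, b0 = g * u + δ * v := ⟨_, rfl⟩
  obtain ⟨t, ht⟩ : ∃ t, t = -(b0 / d) := ⟨_, rfl⟩
  have hdz : (0 : ℤ) < d := by exact_mod_cast hd0
  have hb : b0 + t * d = b0 % d := by
    rw [ht]; have := Int.mul_ediv_add_emod b0 d; linarith
  have hbnn : 0 ≤ b0 % d := Int.emod_nonneg _ hdz.ne'
  have hblt : b0 % d < d := Int.emod_lt_of_pos _ hdz
  refine ⟨h, Nat.mem_divisors.2 ⟨⟨d, hd⟩, hR⟩, (b0 % d).toNat, ?_, ?_⟩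
  · rw [Finset.mem_range]
    have : d ≤ R := Nat.le_of_dvd (Nat.pos_of_ne_zero hR) ⟨h, by rw [hd]; ring⟩
    omega
  · have e2 : (((b0 % d).toNat : ℕ) : ℤ) = b0 % d := Int.toNat_of_nonneg hbnn
    refine ⟨u - β' * t, -β', v + α' * t, α', ?_, ?_⟩
    · linear_combination hb1
    · rw [T_T, e2, hdd, ← hb]
      congr 1
      · rw [hα, hβ]; linear_combination h * hb1
      · rw [hα, hβ]; ring
      · rw [hb0, hd2]; ring
      · rw [hd2]; ring

theorem Cnd.of_T {Q1 Q R : ℕ} {α β g δ : ℤ} {z : Fm} (hdet : α * δ - β * g = R)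
    (h : Cnd Q1 Q (T α β g δ z)) (hc : Nat.Coprime (Q1 * Q) R) : Cnd Q1 Q z := by
  constructor
  · intro p hp hpQ
    obtain ⟨h1, h2, h3⟩ := h.1 p hp hpQ
    have hcp : IsCoprime (p : ℤ) R := Nat.isCoprime_iff_coprime.2 (hc.coprime_dvd_left (hpQ.mul_right _))
    refine ⟨fun h => h1 (Dv_T h _ _ _ _), HDv_of_T (by rw [hdet]; exact hcp.pow_left) h2, fun h => h3 ?_⟩
    rw [D_T]; exact h.mul_left _
  · intro p hp hpQ
    obtain ⟨h1, h2⟩ := h.2 p hp hpQ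
    have hcp : IsCoprime (p : ℤ) R := Nat.isCoprime_iff_coprime.2 (hc.coprime_dvd_left (hpQ.mul_left _))
    exact ⟨fun h => h1 (Dv_T h _ _ _ _), HDv_of_T (by rw [hdet]; exact hcp) h2⟩

theorem cnt2 (ε : ℝ) (hε : 0 < ε) (hε4 : ε ≤ 1 / 4) : ∃ C : ℝ, 0 < C ∧ ∀ R Q1 Q : ℕ, Squarefree R →
    Squarefree Q1 → Squarefree Q → Nat.Coprime Q1 Q → Nat.Coprime (Q1 * Q) R →
    ∀ Z : ℝ, 0 ≤ Z → ∀ S : Finset Fm, Ineq S →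
    (∀ x ∈ S, CndR R x ∧ Cnd Q1 Q x ∧ x.D ≠ 0 ∧ |(x.D : ℝ)| ≤ Z) →
    (S.card : ℝ) ≤ (R.divisors.card * R) *
      (C * ((Q1 : ℝ) ^ (2 * ε) * (Q : ℝ) ^ (3 * ε)) * ((Z / (R : ℝ) ^ 6) / ((Q1 : ℝ) ^ 4 * (Q : ℝ) ^ 2))) := by
  obtain ⟨C, hC, h1⟩ := cnt1 ε hε hε4
  refine ⟨C, hC, ?_⟩
  intro R Q1 Q hR hQ1 hQ hc hcR Z hZ S hI hS
  have hR0 := hR.ne_zero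
  have hRp : (0 : ℝ) < R := by exact_mod_cast Nat.pos_of_ne_zero hR0
  have key : ∀ x : Fm, ∃ z : Fm, x ∈ S → ∃ α β g δ : ℤ, α * δ - β * g = R ∧ x = T α β g δ z := by
    intro x
    by_cases hx : x ∈ S
    · obtain ⟨z, h⟩ := c2_all R hR x (hS x hx).1
      exact ⟨z, fun _ => h⟩
    · exact ⟨x, fun h => absurd h hx⟩
  choose f hf using key
  obtain ⟨Rp, hRp1, hRp2, hRp3⟩ := exists_reps (S.image f)
  have hcardR := h1 Q1 Q hQ1 hQ hc (Z / (R : ℝ) ^ 6) (by positivity) Rp hRp2 (by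
    intro z hz
    obtain ⟨x, hx, rfl⟩ := Finset.mem_image.1 (hRp1 hz)
    obtain ⟨α, β, g, δ, hdet, hxe⟩ := hf x hx
    obtain ⟨k1, k2, k3, k4⟩ := hS x hx
    have hD : x.D = (R : ℤ) ^ 6 * (f x).D := by
      conv_lhs => rw [hxe]
      rw [D_T, hdet]
    refine ⟨Cnd.of_T hdet (hxe ▸ k2) hcR, ?_, ?_⟩
    · intro h; rw [h, mul_zero] at hD; exact k3 hD
    · rw [hD] at k4
      push_cast at k4
      rw [abs_mul, abs_of_pos (by positivity : (0 : ℝ) < (R : ℝ) ^ 6)] at k4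
      rw [le_div_iff₀ (by positivity)]; linarith)
  have key2 : ∀ x : Fm, ∃ t : Fm × ℕ × ℕ, x ∈ S → t ∈ Rp ×ˢ (R.divisors ×ˢ Finset.range R) ∧
      E x (T t.2.1 0 t.2.2 (R / t.2.1 : ℕ) t.1) := by
    intro x
    by_cases hx : x ∈ S
    · obtain ⟨r, hr, α', β', g', δ', hdet', hrz⟩ := hRp3 (f x) (Finset.mem_image_of_mem _ hx)
      obtain ⟨α, β, g, δ, hdet, hxe⟩ := hf x hx
      rw [← hrz, T_T] at hxe
      obtain ⟨h, hh, b, hb, hE⟩ := hnf hR0 (α := α' * α + β' * g) (β := α' * β + β' * δ)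
        (g := g' * α + δ' * g) (δ := g' * β + δ' * δ)
        (by linear_combination (α * δ - β * g) * hdet' + hdet) r
      refine ⟨(r, h, b), fun _ => ⟨?_, ?_⟩⟩
      · exact Finset.mem_product.2 ⟨hr, Finset.mem_product.2 ⟨hh, hb⟩⟩
      · rw [← hxe] at hE; exact hE
    · exact ⟨(x, 0, 0), fun h => absurd h hx⟩
  choose t ht using key2
  have hcard : S.card ≤ (Rp ×ˢ (R.divisors ×ˢ Finset.range R)).card := by
    apply Finset.card_le_card_of_injOn t (fun x hx => (ht x hx).1)
    intro x hx y hy hxy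
    have e1 := (ht x hx).2
    have e2 := (ht y hy).2
    rw [← hxy] at e2
    exact hI x hx y hy (E_trans e1 (E_symm e2))
  rw [Finset.card_product, Finset.card_product, Finset.card_range] at hcard
  calc (S.card : ℝ) ≤ (Rp.card : ℝ) * (R.divisors.card * R) := by exact_mod_cast hcard
    _ = (R.divisors.card * R) * (Rp.card : ℝ) := by ring
    _ ≤ _ := by gcongr

theorem cnt3 (ε : ℝ) (hε : 0 < ε) (hε4 : ε ≤ 1 / 4) : ∃ C : ℝ, 0 < C ∧ ∀ A B R Q1 Q : ℕ,
    Squarefree (A * B * R * Q1 * Q) →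
    ∀ Z : ℝ, 0 ≤ Z → ∀ S : Finset Fm, Ineq S →
    (∀ x ∈ S, (∀ p : ℕ, p.Prime → p ∣ A → Dv ((p : ℤ) ^ 2) x) ∧ (∀ p : ℕ, p.Prime → p ∣ B → Dv p x) ∧
      CndR R x ∧ Cnd Q1 Q x ∧ x.D ≠ 0 ∧ |(x.D : ℝ)| ≤ Z) →
    (S.card : ℝ) ≤ (R.divisors.card * R) *
      (C * ((Q1 : ℝ) ^ (2 * ε) * (Q : ℝ) ^ (3 * ε)) *
        ((Z / ((A : ℝ) ^ 8 * (B : ℝ) ^ 4) / (R : ℝ) ^ 6) / ((Q1 : ℝ) ^ 4 * (Q : ℝ) ^ 2))) := by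
  obtain ⟨C, hC, h2⟩ := cnt2 ε hε hε4
  refine ⟨C, hC, ?_⟩
  intro A B R Q1 Q hsq Z hZ S hI hS
  have hQ : Squarefree Q := hsq.of_mul_right
  have hQ1 : Squarefree Q1 := hsq.of_mul_left.of_mul_right
  have hR : Squarefree R := hsq.of_mul_left.of_mul_left.of_mul_right
  have hB : Squarefree B := hsq.of_mul_left.of_mul_left.of_mul_left.of_mul_right
  have hA' : Squarefree A := hsq.of_mul_left.of_mul_left.of_mul_left.of_mul_left
  have c1 : Nat.Coprime Q1 Q := by
    have : Squarefree (Q1 * Q) := hsq.squarefree_of_dvd ⟨A * B * R, by ring⟩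
    exact Nat.coprime_of_squarefree_mul this
  have c2 : Nat.Coprime (Q1 * Q) R := by
    have : Squarefree (Q1 * Q * R) := hsq.squarefree_of_dvd ⟨A * B, by ring⟩
    exact Nat.coprime_of_squarefree_mul this
  have c3 : Nat.Coprime A B := by
    have : Squarefree (A * B) := hsq.squarefree_of_dvd ⟨R * Q1 * Q, by ring⟩
    exact Nat.coprime_of_squarefree_mul this
  obtain ⟨e, he⟩ : ∃ e, e = A ^ 2 * B := ⟨_, rfl⟩
  have hA0 := hA'.ne_zero
  have hB0 := hB.ne_zero
  have he0 : e ≠ 0 := by rw [he]; positivity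
  have hep : (0 : ℝ) < e := by exact_mod_cast Nat.pos_of_ne_zero he0
  have key : ∀ x : Fm, ∃ z : Fm, x ∈ S → x = smul e z := by
    intro x
    by_cases hx : x ∈ S
    · obtain ⟨k1, k2, -⟩ := hS x hx
      have : e ∣ cont x := by
        rw [he]
        apply Nat.Coprime.mul_dvd_of_dvd_of_dvd (c3.pow_left 2)
        · apply squarefree_sq_dvd_of_primes hA'
          intro p hp hpA; rw [dvd_cont]; push_cast; exact k1 p hp hpA
        · apply squarefree_dvd_of_primes hB
          intro p hp hpA; rw [dvd_cont]; exact k2 p hp hpA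
      obtain ⟨z, hz⟩ := Dv_iff.1 ((dvd_cont _ _).1 this)
      exact ⟨z, fun _ => hz⟩
    · exact ⟨x, fun h => absurd h hx⟩
  choose f hf using key
  obtain ⟨hI', hcard⟩ := Ineq.image (S := S) f (by
    intro x hx y hy hxy
    apply hI x hx y hy
    rw [hf x hx, hf y hy]
    exact E_smul hxy)
  have h := h2 R Q1 Q hR hQ1 hQ c1 c2 (Z / ((A : ℝ) ^ 8 * (B : ℝ) ^ 4)) (by positivity) _ hI' (by
    intro z hz
    obtain ⟨x, hx, rfl⟩ := Finset.mem_image.1 hz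
    obtain ⟨k1, k2, k3, k4, k5, k6⟩ := hS x hx
    have hxe := hf x hx
    rw [hxe] at k3 k4 k5 k6
    refine ⟨?_, k4.of_smul, ?_, ?_⟩
    · intro p hp hpR
      obtain ⟨m1, m2, m3⟩ := k3 p hp hpR
      have hc := cop_cont hp m1
      refine ⟨fun h => m1 ?_, HDv_of_smul hc.pow_left m2, ?_⟩
      · obtain ⟨w, hw⟩ := Dv_iff.1 h
        rw [hw]
        exact Dv_iff.2 ⟨smul e w, by ext <;> simp [smul] <;> ring⟩
      · rw [D_smul] at m3
        exact (hc.pow (m := 5) (n := 4)).dvd_of_dvd_mul_left m3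
    · intro h; rw [D_smul, h, mul_zero] at k5; exact k5 rfl
    · rw [D_smul] at k6
      push_cast at k6
      rw [abs_mul, abs_of_pos (by positivity : (0 : ℝ) < (e : ℝ) ^ 4)] at k6
      have e1 : (A : ℝ) ^ 8 * (B : ℝ) ^ 4 = (e : ℝ) ^ 4 := by rw [he]; push_cast; ring
      rw [e1, le_div_iff₀ (by positivity)]; linarith)
  rw [hcard] at h
  exact h
end DCB

end

section
namespace DCB
open Fm

/-- additive character -/
def ec (N : ℕ) (t : ℤ) : ℂ := Complex.exp (2 * Real.pi * Complex.I * (t : ℂ) / (N : ℂ))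

theorem ec_add (N : ℕ) (s t : ℤ) : ec N (s + t) = ec N s * ec N t := by
  simp only [ec]; rw [← Complex.exp_add]; congr 1; push_cast; ring

theorem ec_zero (N : ℕ) : ec N 0 = 1 := by simp [ec]

theorem ec_mul {M N : ℕ} (hN : N ≠ 0) (t : ℤ) : ec (M * N) (N * t) = ec M t := by
  simp only [ec]; congr 1
  have : (N : ℂ) ≠ 0 := by exact_mod_cast hN
  push_cast
  rcases eq_or_ne (M : ℂ) 0 with h | h
  · simp [h]
  · field_simp

theorem ec_self {N : ℕ} (hN : N ≠ 0) (t : ℤ) : ec N (N * t) = 1 := by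
  have : (N : ℂ) ≠ 0 := by exact_mod_cast hN
  simp only [ec]
  rw [Complex.exp_eq_one_iff]
  refine ⟨t, ?_⟩
  push_cast; field_simp

theorem ec_eq_one {N : ℕ} (hN : N ≠ 0) {t : ℤ} (h : ec N t = 1) : (N : ℤ) ∣ t := by
  have hN' : (N : ℂ) ≠ 0 := by exact_mod_cast hN
  simp only [ec] at h
  rw [Complex.exp_eq_one_iff] at h
  obtain ⟨n, hn⟩ := h
  refine ⟨n, ?_⟩
  have hpi : (2 * Real.pi * Complex.I : ℂ) ≠ 0 := Complex.two_pi_I_ne_zero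
  have h2 : (t : ℂ) = N * n := by
    apply mul_left_cancel₀ hpi
    field_simp at hn
    linear_combination (2 * Real.pi * Complex.I : ℂ) * hn
  exact_mod_cast h2

/-- full sum -/
theorem sum_ec {N : ℕ} (hN : N ≠ 0) (t : ℤ) :
    ∑ k ∈ Finset.range N, ec N (t * k) = if (N : ℤ) ∣ t then (N : ℂ) else 0 := by
  split_ifs with h
  · obtain ⟨s, rfl⟩ := h
    rw [Finset.sum_congr rfl (fun k _ => by rw [mul_assoc, ec_self hN])]
    simp
  · have hne : ec N t ≠ 1 := fun h' => h (ec_eq_one hN h')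
    have hp : ∀ k : ℕ, ec N (t * k) = ec N t ^ k := by
      intro k
      induction k with
      | zero => simp [ec_zero]
      | succ k ih => rw [pow_succ, ← ih, ← ec_add]; congr 1; push_cast; ring
    rw [Finset.sum_congr rfl (fun k _ => hp k), geom_sum_eq hne, ← hp, mul_comm t, ec_self hN]
    simp

def I (N : ℕ) : Finset ℤ := (Finset.range N).image (fun k : ℕ => (k : ℤ))

theorem mem_I {N : ℕ} {k : ℤ} : k ∈ I N ↔ 0 ≤ k ∧ k < N := by
  simp only [I, Finset.mem_image, Finset.mem_range]
  constructor
  · rintro ⟨a, h, rfl⟩; omega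
  · rintro ⟨h, h'⟩; exact ⟨k.toNat, by omega, by omega⟩

theorem sum_I (N : ℕ) (f : ℤ → ℂ) : ∑ k ∈ I N, f k = ∑ k ∈ Finset.range N, f k := by
  rw [I, Finset.sum_image]
  intro a _ b _ h; simpa using h

theorem card_I (N : ℕ) : (I N).card = N := by
  rw [I, Finset.card_image_of_injective _ Nat.cast_injective, Finset.card_range]

theorem sI_full {N : ℕ} (hN : N ≠ 0) (t : ℤ) :
    ∑ k ∈ I N, ec N (t * k) = if (N : ℤ) ∣ t then (N : ℂ) else 0 := by
  rw [sum_I, sum_ec hN]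

/-- sum over multiples of `p` -/
theorem sI_p {p : ℕ} (hp : p ≠ 0) (t : ℤ) :
    ∑ k ∈ I (p ^ 2), (if (p : ℤ) ∣ k then ec (p ^ 2) (t * k) else 0)
      = if (p : ℤ) ∣ t then (p : ℂ) else 0 := by
  rw [← sI_full hp t, ← Finset.sum_filter]
  symm
  have hpz : (0 : ℤ) < p := by exact_mod_cast Nat.pos_of_ne_zero hp
  apply Finset.sum_nbij (fun k : ℤ => (p : ℤ) * k)
  · intro k hk
    rw [mem_I] at hk
    rw [Finset.mem_filter, mem_I]
    refine ⟨⟨by nlinarith, ?_⟩, dvd_mul_right _ _⟩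
    push_cast; nlinarith
  · intro a _ b _ h
    exact mul_left_cancel₀ hpz.ne' h
  · intro k hk
    rw [Finset.mem_coe, Finset.mem_filter, mem_I] at hk
    obtain ⟨⟨h1, h2⟩, ⟨m, rfl⟩⟩ := hk
    refine ⟨m, ?_, rfl⟩
    rw [Finset.mem_coe, mem_I]
    push_cast at h2
    constructor
    · by_contra h; push Not at h; nlinarith
    · by_contra h; push Not at h; nlinarith
  · intro k _
    rw [sq, show t * ((p : ℤ) * k) = p * (t * k) by ring, ec_mul hp]

theorem sI_pp {p : ℕ} (hp : p ≠ 0) (t : ℤ) :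
    ∑ k ∈ I (p ^ 2), (if (p : ℤ) ^ 2 ∣ k then ec (p ^ 2) (t * k) else 0) = 1 := by
  rw [Finset.sum_eq_single 0]
  · simp [ec_zero]
  · intro k hk hk0
    rw [mem_I] at hk
    rw [if_neg]
    intro h
    push_cast at hk
    have := Int.le_of_dvd (by omega) h
    omega
  · intro h
    exact absurd (mem_I.2 ⟨le_rfl, by push_cast; positivity⟩) h

def Bx (N : ℕ) : Finset BCF := I N ×ˢ I N ×ˢ I N ×ˢ I N

theorem card_Bx (N : ℕ) : (Bx N).card = N ^ 4 := by
  simp only [Bx, Finset.card_product, card_I]; ring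

def red (N : ℕ) (y : BCF) : BCF := (y.1 % N, y.2.1 % N, y.2.2.1 % N, y.2.2.2 % N)

theorem red_mem {N : ℕ} (hN : N ≠ 0) (y : BCF) : red N y ∈ Bx N := by
  have hN' : (N : ℤ) ≠ 0 := by exact_mod_cast hN
  have hN'' : (0 : ℤ) < N := by exact_mod_cast Nat.pos_of_ne_zero hN
  simp only [Bx, Finset.mem_product, mem_I, red]
  exact ⟨⟨Int.emod_nonneg _ hN', Int.emod_lt_of_pos _ hN''⟩, ⟨Int.emod_nonneg _ hN', Int.emod_lt_of_pos _ hN''⟩,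
    ⟨Int.emod_nonneg _ hN', Int.emod_lt_of_pos _ hN''⟩, ⟨Int.emod_nonneg _ hN', Int.emod_lt_of_pos _ hN''⟩⟩

theorem red_of_mem {N : ℕ} {y : BCF} (hy : y ∈ Bx N) : red N y = y := by
  simp only [Bx, Finset.mem_product, mem_I] at hy
  obtain ⟨⟨h1, h1'⟩, ⟨h2, h2'⟩, ⟨h3, h3'⟩, ⟨h4, h4'⟩⟩ := hy
  ext
  · exact Int.emod_eq_of_lt h1 h1'
  · exact Int.emod_eq_of_lt h2 h2'
  · exact Int.emod_eq_of_lt h3 h3'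
  · exact Int.emod_eq_of_lt h4 h4'

/-- `y + N w` -/
def addN (N : ℤ) (y w : BCF) : BCF :=
  (y.1 + N * w.1, y.2.1 + N * w.2.1, y.2.2.1 + N * w.2.2.1, y.2.2.2 + N * w.2.2.2)

theorem red_addN (N : ℕ) (y w : BCF) : red N (addN N y w) = red N y := by
  simp [red, addN]

theorem red_eq (N : ℕ) (y : BCF) : ∃ w, red N y = addN N y w := by
  refine ⟨(-(y.1 / N), -(y.2.1 / N), -(y.2.2.1 / N), -(y.2.2.2 / N)), ?_⟩
  ext <;> simp only [red, addN] <;> rw [Int.emod_def] <;> ring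

def Per (N : ℕ) (F : BCF → ℂ) : Prop := ∀ y w, F (addN N y w) = F y

theorem Per.red {N : ℕ} {F : BCF → ℂ} (h : Per N F) (y : BCF) : F (red N y) = F y := by
  obtain ⟨w, hw⟩ := red_eq N y
  rw [hw, h]

/-- pairing -/
def pr (x : Fm) (y : BCF) : ℤ := x.d * y.1 - x.c * y.2.1 + x.b * y.2.2.1 - x.a * y.2.2.2

def tob (x : Fm) : BCF := (x.a, 3 * x.b, 3 * x.c, x.d)

theorem pairQ_tob (x : Fm) (y : BCF) : BCF.pairQ (tob x) y = (pr x y : ℤ) := by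
  simp only [BCF.pairQ, tob, pr]; push_cast; ring

theorem PhiHat_eq (q : ℕ) (x : Fm) : BCF.PhiHat q (tob x) = ((q : ℂ) ^ 8)⁻¹ *
    ∑ y ∈ Bx (q ^ 2), (if BCF.nonmaxAll q y then 1 else 0) * ec (q ^ 2) (pr x y) := by
  rw [BCF.PhiHat, Bx, Finset.sum_product]
  congr 1
  rw [sum_I]
  refine Finset.sum_congr rfl fun y1 _ => ?_
  rw [Finset.sum_product, sum_I]
  refine Finset.sum_congr rfl fun y2 _ => ?_
  rw [Finset.sum_product, sum_I]
  refine Finset.sum_congr rfl fun y3 _ => ?_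
  rw [sum_I]
  refine Finset.sum_congr rfl fun y4 _ => ?_
  rw [pairQ_tob, ec]
  push_cast
  rfl

/-- unimodular substitution without twisting -/
def TB (α β g δ : ℤ) (y : BCF) : BCF :=
  (y.1 * α ^ 3 + y.2.1 * α ^ 2 * g + y.2.2.1 * α * g ^ 2 + y.2.2.2 * g ^ 3,
   3 * y.1 * α ^ 2 * β + y.2.1 * (α ^ 2 * δ + 2 * α * β * g)
      + y.2.2.1 * (2 * α * g * δ + β * g ^ 2) + 3 * y.2.2.2 * g ^ 2 * δ,
   3 * y.1 * α * β ^ 2 + y.2.1 * (2 * α * β * δ + β ^ 2 * g)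
      + y.2.2.1 * (α * δ ^ 2 + 2 * β * g * δ) + 3 * y.2.2.2 * g * δ ^ 2,
   y.1 * β ^ 3 + y.2.1 * β ^ 2 * δ + y.2.2.1 * β * δ ^ 2 + y.2.2.2 * δ ^ 3)

theorem TB_addN (α β g δ N : ℤ) (y w : BCF) :
    TB α β g δ (addN N y w) = addN N (TB α β g δ y) (TB α β g δ w) := by
  ext <;> simp only [TB, addN] <;> ring

theorem TB_adj (α β g δ : ℤ) (h : α * δ - β * g = 1) (y : BCF) : TB δ (-β) (-g) α (TB α β g δ y) = y := by
  have h3 : (α * δ - β * g) ^ 3 = 1 := by rw [h]; norm_num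
  ext
  · simp only [TB]; linear_combination y.1 * h3
  · simp only [TB]; linear_combination y.2.1 * h3
  · simp only [TB]; linear_combination y.2.2.1 * h3
  · simp only [TB]; linear_combination y.2.2.2 * h3

theorem pr_T (α β g δ : ℤ) (h : α * δ - β * g = 1) (x : Fm) (y : BCF) :
    pr (T α β g δ x) (TB α β g δ y) = pr x y := by
  have h3 : (α * δ - β * g) ^ 3 = 1 := by rw [h]; norm_num
  simp only [pr, T, TB]
  linear_combination (x.d * y.1 - x.c * y.2.1 + x.b * y.2.2.1 - x.a * y.2.2.2) * h3

theorem sum_TB {N : ℕ} (hN : N ≠ 0) {F : BCF → ℂ} (hF : Per N F) {α β g δ : ℤ} (h : α * δ - β * g = 1) :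
    ∑ y ∈ Bx N, F (TB α β g δ y) = ∑ y ∈ Bx N, F y := by
  have key : ∀ (a b c d : ℤ) (y : BCF), red N (TB a b c d (red N y)) = red N (TB a b c d y) := by
    intro a b c d y
    obtain ⟨w, hw⟩ := red_eq N y
    rw [hw, TB_addN, red_addN]
  refine Finset.sum_nbij' (fun y => red N (TB α β g δ y)) (fun y => red N (TB δ (-β) (-g) α y)) ?_ ?_ ?_ ?_ ?_
  · intro y _; exact red_mem hN _
  · intro y _; exact red_mem hN _
  · intro y hy
    rw [key, TB_adj _ _ _ _ h, red_of_mem hy]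
  · intro y hy
    have := TB_adj δ (-β) (-g) α (by linear_combination h) y
    rw [neg_neg, neg_neg] at this
    rw [key, this, red_of_mem hy]
  · intro y _
    rw [hF.red]

end DCB

end

section
namespace DCB
open Fm

def LL (p : ℕ) (y : BCF) : Prop := (p : ℤ) ^ 2 ∣ y.1 ∧ (p : ℤ) ∣ y.2.1
def PD (p : ℕ) (y : BCF) : Prop := (p : ℤ) ∣ y.1 ∧ (p : ℤ) ∣ y.2.1 ∧ (p : ℤ) ∣ y.2.2.1 ∧ (p : ℤ) ∣ y.2.2.2
def smB (k : ℤ) (y : BCF) : BCF := (k * y.1, k * y.2.1, k * y.2.2.1, k * y.2.2.2)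

theorem TB_smB (α β g δ k : ℤ) (y : BCF) : TB α β g δ (smB k y) = smB k (TB α β g δ y) := by
  ext <;> simp only [TB, smB] <;> ring

theorem act_eq (γ : Matrix (Fin 2) (Fin 2) ℤ) (y : BCF) :
    BCF.act γ y = smB γ.det (TB (γ 0 0) (γ 1 0) (γ 0 1) (γ 1 1) y) := by
  ext <;> simp only [TB, smB, BCF.act]

theorem LL_smB {p : ℕ} {k : ℤ} (hk : IsCoprime (p : ℤ) k) {y : BCF} : LL p (smB k y) ↔ LL p y := by
  simp only [LL, smB]
  constructor
  · rintro ⟨h1, h2⟩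
    exact ⟨hk.pow_left.dvd_of_dvd_mul_left h1, hk.dvd_of_dvd_mul_left h2⟩
  · rintro ⟨h1, h2⟩
    exact ⟨h1.mul_left _, h2.mul_left _⟩

theorem PD_smB {p : ℕ} {k : ℤ} (hk : IsCoprime (p : ℤ) k) {y : BCF} : PD p (smB k y) ↔ PD p y := by
  simp only [PD, smB]
  constructor
  · rintro ⟨h1, h2, h3, h4⟩
    exact ⟨hk.dvd_of_dvd_mul_left h1, hk.dvd_of_dvd_mul_left h2, hk.dvd_of_dvd_mul_left h3, hk.dvd_of_dvd_mul_left h4⟩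
  · rintro ⟨h1, h2, h3, h4⟩
    exact ⟨h1.mul_left _, h2.mul_left _, h3.mul_left _, h4.mul_left _⟩

theorem LL_addN {p : ℕ} {N : ℤ} (hN : (p : ℤ) ^ 2 ∣ N) {y w : BCF} : LL p (addN N y w) ↔ LL p y := by
  have h1 : (p : ℤ) ∣ N := (dvd_pow_self _ two_ne_zero).trans hN
  simp only [LL, addN]
  rw [dvd_add_left (hN.mul_right _), dvd_add_left (h1.mul_right _)]

theorem PD_addN {p : ℕ} {N : ℤ} (hN : (p : ℤ) ^ 2 ∣ N) {y w : BCF} : PD p (addN N y w) ↔ PD p y := by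
  have h1 : (p : ℤ) ∣ N := (dvd_pow_self _ two_ne_zero).trans hN
  simp only [PD, addN]
  rw [dvd_add_left (h1.mul_right _), dvd_add_left (h1.mul_right _), dvd_add_left (h1.mul_right _),
    dvd_add_left (h1.mul_right _)]

theorem not_inUp {p : ℕ} {y : BCF} : ¬ BCF.inUp p y ↔ PD p y ∨
    ∃ α β g δ : ℤ, (α * δ - β * g = 1 ∨ α * δ - β * g = -1) ∧ LL p (TB α β g δ y) := by
  have hl : ∀ (k : ℤ), (k = 1 ∨ k = -1) → ∀ z, LL p (smB k z) ↔ LL p z := by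
    intro k hk z
    apply LL_smB
    rcases hk with rfl | rfl
    · exact isCoprime_one_right
    · exact ⟨0, -1, by norm_num⟩
  unfold BCF.inUp
  rw [not_and_or, not_not]
  apply or_congr Iff.rfl
  push Not
  constructor
  · rintro ⟨γ, hγ, h⟩
    rw [act_eq] at h
    refine ⟨γ 0 0, γ 1 0, γ 0 1, γ 1 1, ?_, (hl _ hγ _).1 h⟩
    rw [Matrix.det_fin_two] at hγ
    convert hγ using 2 <;> ring
  · rintro ⟨α, β, g, δ, h1, h2⟩
    have hd : (!![α, g; β, δ] : Matrix (Fin 2) (Fin 2) ℤ).det = α * δ - β * g := by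
      rw [Matrix.det_fin_two_of]; ring
    refine ⟨!![α, g; β, δ], by rw [hd]; exact h1, ?_⟩
    rw [act_eq]
    apply (hl _ (by rw [hd]; exact h1) _).2
    simpa using h2

theorem inUp_addN {p : ℕ} {N : ℤ} (hN : (p : ℤ) ^ 2 ∣ N) {y w : BCF} :
    ¬ BCF.inUp p (addN N y w) ↔ ¬ BCF.inUp p y := by
  simp only [not_inUp, TB_addN, LL_addN hN, PD_addN hN]

theorem inUp_smB {p : ℕ} {k : ℤ} (hk : IsCoprime (p : ℤ) k) {y : BCF} :
    ¬ BCF.inUp p (smB k y) ↔ ¬ BCF.inUp p y := by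
  simp only [not_inUp, TB_smB, LL_smB hk, PD_smB hk]

theorem nm_addN {q : ℕ} {N : ℤ} (hN : (q : ℤ) ^ 2 ∣ N) {y w : BCF} :
    BCF.nonmaxAll q (addN N y w) ↔ BCF.nonmaxAll q y := by
  unfold BCF.nonmaxAll
  refine forall_congr' fun p => forall_congr' fun _ => forall_congr' fun hpq => ?_
  apply inUp_addN
  exact (pow_dvd_pow_of_dvd (Int.natCast_dvd_natCast.2 hpq) 2).trans hN

theorem nm_smB {q : ℕ} {k : ℤ} (hk : IsCoprime (q : ℤ) k) {y : BCF} :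
    BCF.nonmaxAll q (smB k y) ↔ BCF.nonmaxAll q y := by
  unfold BCF.nonmaxAll
  refine forall_congr' fun p => forall_congr' fun _ => forall_congr' fun hpq => ?_
  apply inUp_smB
  exact hk.of_isCoprime_of_dvd_left (Int.natCast_dvd_natCast.2 hpq)

theorem crt1 {M N : ℕ} (h : IsCoprime (M : ℤ) N) {i i' j j' : ℤ} (hi : i ∈ I M) (hi' : i' ∈ I M)
    (e : (N * i + M * j) % ((M * N : ℕ) : ℤ) = (N * i' + M * j') % ((M * N : ℕ) : ℤ)) : i = i' := by
  rw [mem_I] at hi hi'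
  have h1 := Int.ModEq.dvd (show Int.ModEq ((M * N : ℕ) : ℤ) _ _ from e)
  have h2 : (M : ℤ) ∣ N * (i' - i) := by
    have h3 : (M : ℤ) ∣ N * i' + M * j' - (N * i + M * j) := (by push_cast; exact dvd_mul_right _ _ : (M : ℤ) ∣ ((M * N : ℕ) : ℤ)).trans h1
    have h4 : (N : ℤ) * (i' - i) = N * i' + M * j' - (N * i + M * j) - M * (j' - j) := by ring
    rw [h4]; exact dvd_sub h3 (dvd_mul_right _ _)
  have h5 := h.dvd_of_dvd_mul_left h2
  have h6 := Int.eq_zero_of_abs_lt_dvd h5 (by rw [abs_lt]; omega)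
  omega

def cb (M N : ℕ) (y w : BCF) : BCF := addN M (smB N y) w

theorem sum_crt {M N : ℕ} (hM : M ≠ 0) (hN : N ≠ 0) (h : IsCoprime (M : ℤ) N) {F : BCF → ℂ}
    (hF : Per (M * N) F) :
    ∑ y ∈ Bx (M * N), F y = ∑ y ∈ Bx M, ∑ w ∈ Bx N, F (cb M N y w) := by
  rw [← Finset.sum_product']
  symm
  have hinj : Set.InjOn (fun z : BCF × BCF => red (M * N) (cb M N z.1 z.2)) (Bx M ×ˢ Bx N : Finset _) := by
    rintro ⟨⟨a, b, c, d⟩, ⟨e, f, g, k⟩⟩ hz ⟨⟨a', b', c', d'⟩, ⟨e', f', g', k'⟩⟩ hz' he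
    simp only [Finset.coe_product, Set.mem_prod, Finset.mem_coe, Bx] at hz hz'
    simp only [red, cb, addN, smB, Prod.mk.injEq] at he
    obtain ⟨⟨h1, h2, h3, h4⟩, ⟨h5, h6, h7, h8⟩⟩ := hz
    obtain ⟨⟨k1, k2, k3, k4⟩, ⟨k5, k6, k7, k8⟩⟩ := hz'
    obtain ⟨e1, e2, e3, e4⟩ := he
    have sw : ∀ {i i' j j' : ℤ}, (N * i + M * j) % ((M * N : ℕ) : ℤ) = (N * i' + M * j') % ((M * N : ℕ) : ℤ) →
        (M * j + N * i) % ((N * M : ℕ) : ℤ) = (M * j' + N * i') % ((N * M : ℕ) : ℤ) := by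
      intro i i' j j' he
      rw [Nat.mul_comm N M, add_comm, he, add_comm]
    simp only [Prod.mk.injEq]
    exact ⟨⟨crt1 h h1 k1 e1, crt1 h h2 k2 e2, crt1 h h3 k3 e3, crt1 h h4 k4 e4⟩,
      crt1 h.symm h5 k5 (sw e1), crt1 h.symm h6 k6 (sw e2), crt1 h.symm h7 k7 (sw e3), crt1 h.symm h8 k8 (sw e4)⟩
  have hmaps : ∀ z ∈ Bx M ×ˢ Bx N, red (M * N) (cb M N z.1 z.2) ∈ Bx (M * N) :=
    fun z _ => red_mem (Nat.mul_ne_zero hM hN) _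
  refine Finset.sum_nbij (fun z : BCF × BCF => red (M * N) (cb M N z.1 z.2)) hmaps hinj ?_ ?_
  · apply Finset.surjOn_of_injOn_of_card_le _ hmaps hinj
    rw [Finset.card_product, card_Bx, card_Bx, card_Bx, mul_pow]
  · intro z _
    rw [hF.red]

theorem pr_addN (x : Fm) (N : ℤ) (y w : BCF) : pr x (addN N y w) = pr x y + N * pr x w := by
  simp only [pr, addN]; ring
theorem pr_smB (x : Fm) (N : ℤ) (y : BCF) : pr x (smB N y) = N * pr x y := by
  simp only [pr, smB]; ring

theorem Per_ec {N : ℕ} (hN : N ≠ 0) (x : Fm) : Per N (fun y => ec N (pr x y)) := by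
  intro y w
  simp only [pr_addN, ec_add, ec_self hN, mul_one]

theorem PhiHat_mul {m n : ℕ} (hm : m ≠ 0) (hn : n ≠ 0) (h : Nat.Coprime m n) (x : Fm) :
    BCF.PhiHat (m * n) (tob x) = BCF.PhiHat m (tob x) * BCF.PhiHat n (tob x) := by
  have hM : m ^ 2 ≠ 0 := pow_ne_zero _ hm
  have hN : n ^ 2 ≠ 0 := pow_ne_zero _ hn
  have hc : IsCoprime (m : ℤ) (n : ℤ) := Nat.isCoprime_iff_coprime.2 h
  rw [PhiHat_eq, PhiHat_eq, PhiHat_eq, mul_pow m n 2, sum_crt hM hN]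
  · have key : ∀ y w, (if BCF.nonmaxAll (m * n) (cb (m ^ 2) (n ^ 2) y w) then (1 : ℂ) else 0) *
        ec (m ^ 2 * n ^ 2) (pr x (cb (m ^ 2) (n ^ 2) y w)) =
        ((if BCF.nonmaxAll m y then 1 else 0) * ec (m ^ 2) (pr x y)) *
        ((if BCF.nonmaxAll n w then 1 else 0) * ec (n ^ 2) (pr x w)) := by
      intro y w
      have h1 : BCF.nonmaxAll m (cb (m ^ 2) (n ^ 2) y w) ↔ BCF.nonmaxAll m y := by
        rw [cb, nm_addN (by push_cast; exact dvd_rfl), nm_smB (by push_cast; exact hc.pow_right)]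
      have h2 : BCF.nonmaxAll n (cb (m ^ 2) (n ^ 2) y w) ↔ BCF.nonmaxAll n w := by
        have : cb (m ^ 2) (n ^ 2) y w = addN ((n ^ 2 : ℕ) : ℤ) (smB ((m ^ 2 : ℕ) : ℤ) w) y := by
          ext <;> simp only [cb, addN, smB] <;> ring
        rw [this, nm_addN (by push_cast; exact dvd_rfl), nm_smB (by push_cast; exact hc.symm.pow_right)]
      have h3 : BCF.nonmaxAll (m * n) (cb (m ^ 2) (n ^ 2) y w) ↔ BCF.nonmaxAll m y ∧ BCF.nonmaxAll n w := by
        rw [← h1, ← h2]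
        unfold BCF.nonmaxAll
        constructor
        · intro h
          exact ⟨fun p hp hd => h p hp (hd.mul_right _), fun p hp hd => h p hp (hd.mul_left _)⟩
        · rintro ⟨h, h'⟩ p hp hd
          rcases (Nat.Prime.dvd_mul hp).1 hd with hd | hd
          · exact h p hp hd
          · exact h' p hp hd
      have h4 : ec (m ^ 2 * n ^ 2) (pr x (cb (m ^ 2) (n ^ 2) y w)) = ec (m ^ 2) (pr x y) * ec (n ^ 2) (pr x w) := by
        rw [cb, pr_addN, pr_smB, ec_add, ec_mul hN, mul_comm (m ^ 2), ec_mul hM]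
      rw [h4]
      by_cases k1 : BCF.nonmaxAll m y <;> by_cases k2 : BCF.nonmaxAll n w <;> simp [h3, k1, k2]
    simp only [key]
    rw [← Finset.sum_mul_sum]
    push_cast
    rw [mul_pow, mul_inv]
    ring
  · push_cast; exact hc.pow
  · intro y w
    have e1 := Per_ec (Nat.mul_ne_zero hM hN) x y w
    have e2 : BCF.nonmaxAll (m * n) (addN ((m ^ 2 * n ^ 2 : ℕ) : ℤ) y w) ↔ BCF.nonmaxAll (m * n) y := by
      apply nm_addN
      push_cast; rw [mul_pow]
    simp only at e1 ⊢
    rw [e1]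
    simp only [e2]

end DCB

end

section
namespace DCB
open Fm

def ra (p r : ℕ) : ℤ := if r = p then 1 else r
def rb (p r : ℕ) : ℤ := if r = p then 0 else -1
def rg (p r : ℕ) : ℤ := if r = p then 0 else 1
def rd (p r : ℕ) : ℤ := if r = p then 1 else 0

theorem r_det (p r : ℕ) : ra p r * rd p r - rb p r * rg p r = 1 := by
  simp only [ra, rb, rg, rd]; split_ifs <;> norm_num

theorem r_cross {p r s : ℕ} (hp : p.Prime) (hr : r ∈ Finset.range (p + 1)) (hs : s ∈ Finset.range (p + 1)) (h : r ≠ s) :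
    ¬ (p : ℤ) ∣ rg p s * ra p r - ra p s * rg p r := by
  rw [Finset.mem_range] at hr hs
  have hp1 : ¬ (p : ℤ) ∣ 1 := by
    intro h; have := Int.le_of_dvd one_pos h; have := hp.two_le; omega
  simp only [ra, rg]
  split_ifs with h1 h2 h2
  · omega
  · simpa using hp1
  · simpa using hp1
  · intro h3
    have h6 := Int.eq_zero_of_abs_lt_dvd h3 (by rw [abs_lt]; omega)
    omega

theorem r_cover {p : ℕ} (hp : p.Prime) (α g : ℤ) :
    ∃ r ∈ Finset.range (p + 1), (p : ℤ) ∣ α * rg p r - g * ra p r := by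
  by_cases hg : (p : ℤ) ∣ g
  · exact ⟨p, by simp, by simpa [ra, rg] using hg⟩
  · have hc : IsCoprime (p : ℤ) g := (Prime.coprime_iff_not_dvd (Nat.prime_iff_prime_int.1 hp)).2 hg
    obtain ⟨u, v, huv⟩ := hc
    have hp0 : (0 : ℤ) < p := by exact_mod_cast hp.pos
    have h1 := Int.emod_nonneg (α * v) hp0.ne'
    have h2 := Int.emod_lt_of_pos (α * v) hp0
    obtain ⟨k, hk⟩ := Int.eq_ofNat_of_zero_le h1
    refine ⟨k, by rw [Finset.mem_range]; omega, ?_⟩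
    have hkp : k ≠ p := by omega
    simp only [ra, rg, if_neg hkp]
    have h3 := Int.mul_ediv_add_emod (α * v) p
    rw [hk] at h3
    refine ⟨α * u + g * (α * v / p), ?_⟩
    linear_combination (-α) * huv - g * h3

theorem TB_TB (α β g δ α' β' g' δ' : ℤ) (y : BCF) : TB α' β' g' δ' (TB α β g δ y) =
    TB (α' * α + g' * β) (β' * α + δ' * β) (α' * g + g' * δ) (β' * g + δ' * δ) y := by
  ext <;> simp only [TB] <;> ring

theorem LL_stab {p : ℕ} {y : BCF} (h : LL p y) {α β g δ : ℤ} (hg : (p : ℤ) ∣ g) : LL p (TB α β g δ y) := by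
  obtain ⟨⟨a, ha⟩, ⟨b, hb⟩⟩ := h
  obtain ⟨g', rfl⟩ := hg
  simp only [LL, TB]
  rw [ha, hb]
  constructor
  · exact ⟨a * α ^ 3 + b * α ^ 2 * g' + y.2.2.1 * α * g' ^ 2 + y.2.2.2 * p * g' ^ 3, by ring⟩
  · exact ⟨3 * p * a * α ^ 2 * β + b * (α ^ 2 * δ + 2 * α * β * (p * g'))
      + y.2.2.1 * (2 * α * g' * δ + β * p * g' ^ 2) + 3 * y.2.2.2 * p * g' ^ 2 * δ, by ring⟩

theorem LL_uniq {p : ℕ} (hp : p.Prime) {y : BCF} (h : LL p y) {α β g δ : ℤ} (hd : α * δ - β * g = 1)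
    (hg : ¬ (p : ℤ) ∣ g) (h' : LL p (TB α β g δ y)) : PD p y := by
  have hP := Nat.prime_iff_prime_int.1 hp
  obtain ⟨h1, h2⟩ := h'
  simp only [TB] at h1 h2
  have ha : (p : ℤ) ∣ y.1 := (dvd_pow_self _ two_ne_zero).trans h.1
  have hb : (p : ℤ) ∣ y.2.1 := h.2
  have h1' := (dvd_pow_self (p : ℤ) two_ne_zero).trans h1
  have e1 : (p : ℤ) ∣ g ^ 2 * (y.2.2.1 * α + y.2.2.2 * g) := by
    have : g ^ 2 * (y.2.2.1 * α + y.2.2.2 * g) = (y.1 * α ^ 3 + y.2.1 * α ^ 2 * g + y.2.2.1 * α * g ^ 2 + y.2.2.2 * g ^ 3)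
      - y.1 * α ^ 3 - y.2.1 * (α ^ 2 * g) := by ring
    rw [this]
    exact dvd_sub (dvd_sub h1' (ha.mul_right _)) (hb.mul_right _)
  have e1' := (hP.dvd_or_dvd e1).resolve_left (fun h => hg (hP.dvd_of_dvd_pow h))
  have e2 : (p : ℤ) ∣ g * y.2.2.1 := by
    have : g * y.2.2.1 = -(3 * y.1 * α ^ 2 * β + y.2.1 * (α ^ 2 * δ + 2 * α * β * g)
      + y.2.2.1 * (2 * α * g * δ + β * g ^ 2) + 3 * y.2.2.2 * g ^ 2 * δ) + y.1 * (3 * α ^ 2 * β)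
      + y.2.1 * (α ^ 2 * δ + 2 * α * β * g) + (y.2.2.1 * α + y.2.2.2 * g) * (3 * g * δ) := by
      linear_combination (-g * y.2.2.1) * hd
    rw [this]
    exact dvd_add (dvd_add (dvd_add (dvd_neg.2 h2) (ha.mul_right _)) (hb.mul_right _)) (e1'.mul_right _)
  have hc := (hP.dvd_or_dvd e2).resolve_left hg
  have hdd := (hP.dvd_or_dvd ((dvd_add_right (hc.mul_right α)).1 e1')).resolve_right hg
  exact ⟨ha, hb, hc, hdd⟩

def LP (p : ℕ) (y : BCF) : Prop := LL p y ∧ PD p y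
def TBr (p r : ℕ) (y : BCF) : BCF := TB (ra p r) (rb p r) (rg p r) (rd p r) y
def Tr (p r : ℕ) (x : Fm) : Fm := T (ra p r) (rb p r) (rg p r) (rd p r) x

theorem PD_TB {p : ℕ} {y : BCF} (h : PD p y) (α β g δ : ℤ) : PD p (TB α β g δ y) := by
  obtain ⟨⟨a, ha⟩, ⟨b, hb⟩, ⟨c, hc⟩, ⟨d, hd⟩⟩ := h
  have : y = smB p (a, b, c, d) := by ext <;> simp only [smB] <;> assumption
  rw [this, TB_smB]
  exact ⟨dvd_mul_right _ _, dvd_mul_right _ _, dvd_mul_right _ _, dvd_mul_right _ _⟩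

theorem PD_TBr {p r : ℕ} {y : BCF} : PD p (TBr p r y) ↔ PD p y := by
  constructor
  · intro h
    rw [← TB_adj _ _ _ _ (r_det p r) y]
    exact PD_TB h _ _ _ _
  · intro h; exact PD_TB h _ _ _ _

theorem LL_exists {p : ℕ} (hp : p.Prime) {y : BCF} {α β g δ : ℤ} (hd : α * δ - β * g = 1 ∨ α * δ - β * g = -1)
    (h : LL p (TB α β g δ y)) : ∃ r ∈ Finset.range (p + 1), LL p (TBr p r y) := by
  obtain ⟨r, hr, hr'⟩ := r_cover hp α g
  refine ⟨r, hr, ?_⟩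
  have h1 := LL_stab h (α := ra p r * δ - rg p r * β) (β := rb p r * δ - rd p r * β)
    (g := α * rg p r - g * ra p r) (δ := rd p r * α - rb p r * g) hr'
  have h2 : TB (ra p r * δ - rg p r * β) (rb p r * δ - rd p r * β)
    (α * rg p r - g * ra p r) (rd p r * α - rb p r * g) (TB α β g δ y) = smB ((α * δ - β * g) ^ 3) (TBr p r y) := by
    rw [TB_TB, TBr]
    ext <;> simp only [TB, smB] <;> ring
  rw [h2] at h1
  refine (LL_smB ?_).1 h1
  rcases hd with hd | hd <;> rw [hd]
  · norm_num; exact isCoprime_one_right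
  · exact ⟨0, -1, by norm_num⟩

theorem comp_eq (p r s : ℕ) (y : BCF) : TBr p s y = TB (ra p s * rd p r - rg p s * rb p r) (rb p s * rd p r - rd p s * rb p r)
    (rg p s * ra p r - ra p s * rg p r) (rd p s * ra p r - rb p s * rg p r) (TBr p r y) := by
  have h := r_det p r
  rw [TBr, TBr, TB_TB]
  congr 1
  · linear_combination (-ra p s) * h
  · linear_combination (-rb p s) * h
  · linear_combination (-rg p s) * h
  · linear_combination (-rd p s) * h

theorem comp_det (p r s : ℕ) : (ra p s * rd p r - rg p s * rb p r) * (rd p s * ra p r - rb p s * rg p r) -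
   (rb p s * rd p r - rd p s * rb p r) * (rg p s * ra p r - ra p s * rg p r) = 1 := by
  linear_combination (ra p s * rd p s - rb p s * rg p s) * r_det p r + r_det p s

theorem comp_eq' (p r s : ℕ) (x : Fm) : Tr p s x = T (ra p s * rd p r - rg p s * rb p r) (rb p s * rd p r - rd p s * rb p r)
    (rg p s * ra p r - ra p s * rg p r) (rd p s * ra p r - rb p s * rg p r) (Tr p r x) := by
  have h := r_det p r
  rw [Tr, Tr, T_T]
  congr 1
  · linear_combination (-ra p s) * h
  · linear_combination (-rb p s) * h
  · linear_combination (-rg p s) * h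
  · linear_combination (-rd p s) * h

theorem LL_unique {p r s : ℕ} (hp : p.Prime) {y : BCF} (hr : r ∈ Finset.range (p + 1)) (hs : s ∈ Finset.range (p + 1))
    (h1 : LL p (TBr p r y)) (h2 : LL p (TBr p s y)) (hne : r ≠ s) : PD p y := by
  rw [comp_eq p r s] at h2
  exact PD_TBr.1 (LL_uniq hp h1 (comp_det p r s) (r_cross hp hr hs hne) h2)

/-- indicator decomposition -/
theorem ind_decomp {p : ℕ} (hp : p.Prime) (y : BCF) :
    (if BCF.nonmaxAll p y then (1 : ℂ) else 0) = (if PD p y then 1 else 0) +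
      ∑ r ∈ Finset.range (p + 1), ((if LL p (TBr p r y) then 1 else 0) -
        (if LP p (TBr p r y) then 1 else 0)) := by
  have h0 : BCF.nonmaxAll p y ↔ (PD p y ∨ ∃ r ∈ Finset.range (p + 1), LL p (TBr p r y)) := by
    have : BCF.nonmaxAll p y ↔ ¬ BCF.inUp p y := by
      unfold BCF.nonmaxAll
      constructor
      · intro h; exact h p hp dvd_rfl
      · intro h p' hp' hd
        rw [(Nat.prime_dvd_prime_iff_eq hp' hp).1 hd]; exact h
    rw [this, not_inUp]
    apply or_congr Iff.rfl
    constructor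
    · rintro ⟨α, β, g, δ, h1, h2⟩; exact LL_exists hp h1 h2
    · rintro ⟨r, _, h⟩; exact ⟨_, _, _, _, Or.inl (r_det p r), h⟩
  simp only [LP, PD_TBr]
  by_cases hP : PD p y
  · simp [h0, hP]
  · simp only [h0, hP, false_or, and_false, if_false, sub_zero, zero_add]
    by_cases hE : ∃ r ∈ Finset.range (p + 1), LL p (TBr p r y)
    · rw [if_pos hE]
      obtain ⟨r, hr, hL⟩ := hE
      rw [Finset.sum_eq_single r, if_pos hL]
      · intro s hs hne
        rw [if_neg]
        intro hLs
        exact hP (LL_unique hp hs hr hLs hL hne)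
      · intro h; exact absurd hr h
    · rw [if_neg hE]
      symm
      apply Finset.sum_eq_zero
      intro r hr
      rw [if_neg]
      intro h; exact hE ⟨r, hr, h⟩

end DCB

end

section
namespace DCB
open Fm

theorem sum_Bx_prod (N : ℕ) (f1 f2 f3 f4 : ℤ → ℂ) :
    ∑ y ∈ Bx N, f1 y.1 * (f2 y.2.1 * (f3 y.2.2.1 * f4 y.2.2.2)) =
      (∑ k ∈ I N, f1 k) * ((∑ k ∈ I N, f2 k) * ((∑ k ∈ I N, f3 k) * (∑ k ∈ I N, f4 k))) := by
  simp only [Bx]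
  rw [Finset.sum_product, Finset.sum_mul]
  refine Finset.sum_congr rfl fun y1 _ => ?_
  simp only [← Finset.mul_sum]; congr 1
  rw [Finset.sum_product, Finset.sum_mul]
  refine Finset.sum_congr rfl fun y2 _ => ?_
  simp only [← Finset.mul_sum]; congr 1
  rw [Finset.sum_product, Finset.sum_mul]
  refine Finset.sum_congr rfl fun y3 _ => ?_
  simp only [← Finset.mul_sum]

theorem ec_pr (N : ℕ) (x : Fm) (y : BCF) : ec N (pr x y) =
    ec N (x.d * y.1) * (ec N (-x.c * y.2.1) * (ec N (x.b * y.2.2.1) * ec N (-x.a * y.2.2.2))) := by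
  rw [← ec_add, ← ec_add, ← ec_add]; congr 1; simp only [pr]; ring

def Ls (p : ℕ) (x : Fm) : Prop := (p : ℤ) ^ 2 ∣ x.a ∧ (p : ℤ) ^ 2 ∣ x.b ∧ (p : ℤ) ∣ x.c
def Ms (p : ℕ) (x : Fm) : Prop := (p : ℤ) ∣ x.a ∧ (p : ℤ) ∣ x.b ∧ (p : ℤ) ∣ x.c

theorem F_LL {p : ℕ} (hp : p ≠ 0) (x : Fm) :
    ∑ y ∈ Bx (p ^ 2), (if LL p y then 1 else 0) * ec (p ^ 2) (pr x y) = if Ls p x then (p : ℂ) ^ 5 else 0 := by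
  have hp2 : p ^ 2 ≠ 0 := pow_ne_zero _ hp
  have h := sum_Bx_prod (p ^ 2) (fun k => if (p : ℤ) ^ 2 ∣ k then ec (p ^ 2) (x.d * k) else 0)
    (fun k => if (p : ℤ) ∣ k then ec (p ^ 2) (-x.c * k) else 0)
    (fun k => ec (p ^ 2) (x.b * k)) (fun k => ec (p ^ 2) (-x.a * k))
  rw [sI_pp hp, sI_p hp, sI_full hp2, sI_full hp2] at h
  refine Eq.trans (Finset.sum_congr rfl fun y _ => ?_) (h.trans ?_)
  · rw [ec_pr]
    by_cases h1 : (p : ℤ) ^ 2 ∣ y.1 <;> by_cases h2 : (p : ℤ) ∣ y.2.1 <;> simp [LL, h1, h2]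
  · push_cast
    simp only [dvd_neg, Ls]
    by_cases h1 : (p : ℤ) ^ 2 ∣ x.a <;> by_cases h2 : (p : ℤ) ^ 2 ∣ x.b <;> by_cases h3 : (p : ℤ) ∣ x.c <;>
      simp [h1, h2, h3]
    ring

theorem F_LP {p : ℕ} (hp : p ≠ 0) (x : Fm) :
    ∑ y ∈ Bx (p ^ 2), (if LP p y then 1 else 0) * ec (p ^ 2) (pr x y) = if Ms p x then (p : ℂ) ^ 3 else 0 := by
  have h := sum_Bx_prod (p ^ 2) (fun k => if (p : ℤ) ^ 2 ∣ k then ec (p ^ 2) (x.d * k) else 0)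
    (fun k => if (p : ℤ) ∣ k then ec (p ^ 2) (-x.c * k) else 0)
    (fun k => if (p : ℤ) ∣ k then ec (p ^ 2) (x.b * k) else 0)
    (fun k => if (p : ℤ) ∣ k then ec (p ^ 2) (-x.a * k) else 0)
  rw [sI_pp hp, sI_p hp, sI_p hp, sI_p hp] at h
  refine Eq.trans (Finset.sum_congr rfl fun y _ => ?_) (h.trans ?_)
  · rw [ec_pr]
    have h0 : (p : ℤ) ^ 2 ∣ y.1 → (p : ℤ) ∣ y.1 := (dvd_pow_self _ two_ne_zero).trans
    by_cases h1 : (p : ℤ) ^ 2 ∣ y.1 <;> by_cases h2 : (p : ℤ) ∣ y.2.1 <;>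
      by_cases h3 : (p : ℤ) ∣ y.2.2.1 <;> by_cases h4 : (p : ℤ) ∣ y.2.2.2 <;> simp [LP, LL, PD, h1, h2, h3, h4, h0]
  · simp only [dvd_neg, Ms]
    by_cases h1 : (p : ℤ) ∣ x.a <;> by_cases h2 : (p : ℤ) ∣ x.b <;> by_cases h3 : (p : ℤ) ∣ x.c <;>
      simp [h1, h2, h3]
    ring

theorem F_PD {p : ℕ} (hp : p ≠ 0) (x : Fm) :
    ∑ y ∈ Bx (p ^ 2), (if PD p y then 1 else 0) * ec (p ^ 2) (pr x y) = if Dv p x then (p : ℂ) ^ 4 else 0 := by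
  have h := sum_Bx_prod (p ^ 2) (fun k => if (p : ℤ) ∣ k then ec (p ^ 2) (x.d * k) else 0)
    (fun k => if (p : ℤ) ∣ k then ec (p ^ 2) (-x.c * k) else 0)
    (fun k => if (p : ℤ) ∣ k then ec (p ^ 2) (x.b * k) else 0)
    (fun k => if (p : ℤ) ∣ k then ec (p ^ 2) (-x.a * k) else 0)
  rw [sI_p hp, sI_p hp, sI_p hp, sI_p hp] at h
  refine Eq.trans (Finset.sum_congr rfl fun y _ => ?_) (h.trans ?_)
  · rw [ec_pr]
    by_cases h1 : (p : ℤ) ∣ y.1 <;> by_cases h2 : (p : ℤ) ∣ y.2.1 <;>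
      by_cases h3 : (p : ℤ) ∣ y.2.2.1 <;> by_cases h4 : (p : ℤ) ∣ y.2.2.2 <;> simp [PD, h1, h2, h3, h4]
  · simp only [dvd_neg, Dv]
    by_cases h1 : (p : ℤ) ∣ x.a <;> by_cases h2 : (p : ℤ) ∣ x.b <;> by_cases h3 : (p : ℤ) ∣ x.c <;>
      by_cases h4 : (p : ℤ) ∣ x.d <;> simp [h1, h2, h3, h4]
    ring

theorem F_r {p : ℕ} (hp : p ≠ 0) (r : ℕ) (x : Fm) (P : BCF → Prop)
    (hP : ∀ y w, P (addN ((p ^ 2 : ℕ) : ℤ) y w) ↔ P y) :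
    ∑ y ∈ Bx (p ^ 2), (if P (TBr p r y) then 1 else 0) * ec (p ^ 2) (pr x y) =
      ∑ y ∈ Bx (p ^ 2), (if P y then 1 else 0) * ec (p ^ 2) (pr (Tr p r x) y) := by
  have hp2 : p ^ 2 ≠ 0 := pow_ne_zero _ hp
  have hper : Per (p ^ 2) (fun y => (if P y then (1 : ℂ) else 0) * ec (p ^ 2) (pr (Tr p r x) y)) := by
    intro y w
    have e1 := Per_ec hp2 (Tr p r x) y w
    simp only at e1 ⊢
    rw [e1]; simp only [hP]
  have := sum_TB hp2 hper (r_det p r)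
  rw [← this]
  refine Finset.sum_congr rfl fun y _ => ?_
  rw [Tr, pr_T _ _ _ _ (r_det p r)]
  rfl

theorem PhiHat_prime {p : ℕ} (hp : p.Prime) (x : Fm) : BCF.PhiHat p (tob x) =
    (((if Dv p x then ((p : ℝ) ^ 4)⁻¹ else 0) + ∑ r ∈ Finset.range (p + 1),
      ((if Ls p (Tr p r x) then ((p : ℝ) ^ 3)⁻¹ else 0) - (if Ms p (Tr p r x) then ((p : ℝ) ^ 5)⁻¹ else 0)) : ℝ) : ℂ) := by
  have hp0 := hp.ne_zero
  have hpc : (p : ℂ) ≠ 0 := by exact_mod_cast hp0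
  have hN : ((p : ℤ) ^ 2 ∣ ((p ^ 2 : ℕ) : ℤ)) := by push_cast; exact dvd_rfl
  rw [PhiHat_eq]
  simp only [ind_decomp hp, add_mul, Finset.sum_mul, sub_mul]
  rw [Finset.sum_add_distrib, Finset.sum_comm]
  simp only [Finset.sum_sub_distrib]
  have e1 : ∀ r, ∑ y ∈ Bx (p ^ 2), (if LL p (TBr p r y) then 1 else 0) * ec (p ^ 2) (pr x y) =
      if Ls p (Tr p r x) then (p : ℂ) ^ 5 else 0 := by
    intro r
    rw [F_r hp0 r x (LL p) (fun y w => LL_addN hN), F_LL hp0]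
  have e2 : ∀ r, ∑ y ∈ Bx (p ^ 2), (if LP p (TBr p r y) then 1 else 0) * ec (p ^ 2) (pr x y) =
      if Ms p (Tr p r x) then (p : ℂ) ^ 3 else 0 := by
    intro r
    rw [F_r hp0 r x (LP p) (fun y w => by rw [LP, LP, LL_addN hN, PD_addN hN]), F_LP hp0]
  simp only [e1, e2]
  rw [F_PD hp0, mul_add, mul_sub, Finset.mul_sum, Finset.mul_sum]
  push_cast
  congr 1
  · split_ifs
    · push_cast; field_simp
    · simp
  · rw [← Finset.sum_sub_distrib, ← Finset.sum_sub_distrib]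
    refine Finset.sum_congr rfl fun r _ => ?_
    congr 1
    · split_ifs
      · push_cast; field_simp
      · simp
    · split_ifs
      · push_cast; field_simp
      · simp

end DCB

end

section
namespace DCB
open Fm

theorem Ls.Ms {p : ℕ} {x : Fm} (h : Ls p x) : Ms p x :=
  ⟨(dvd_pow_self _ two_ne_zero).trans h.1, (dvd_pow_self _ two_ne_zero).trans h.2.1, h.2.2⟩

theorem Ms.HDv {p : ℕ} {x : Fm} (h : Ms p x) : HDv p x := by
  obtain ⟨ha, hb, hc⟩ := h
  refine ⟨?_, ?_, ?_⟩ <;> simp only [hA, hB, hC]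
  · exact dvd_sub (dvd_pow hb two_ne_zero) (ha.mul_right _)
  · exact dvd_sub (hb.mul_right _) (ha.mul_right _)
  · exact dvd_sub (dvd_pow hc two_ne_zero) (hb.mul_right _)

theorem Ls.HDv {p : ℕ} {x : Fm} (h : Ls p x) : HDv ((p : ℤ) ^ 2) x := by
  obtain ⟨ha, hb, hc⟩ := h
  refine ⟨?_, ?_, ?_⟩ <;> simp only [hA, hB, hC]
  · exact dvd_sub (dvd_pow hb two_ne_zero) (ha.mul_right _)
  · exact dvd_sub (hb.mul_right _) (ha.mul_right _)
  · exact dvd_sub (pow_dvd_pow_of_dvd hc 2) (hb.mul_right _)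

theorem Tr_E (p r : ℕ) (x : Fm) : E x (Tr p r x) := ⟨_, _, _, _, r_det p r, rfl⟩

theorem Ms_unique {p r s : ℕ} (hp : p.Prime) {x : Fm} (hr : r ∈ Finset.range (p + 1)) (hs : s ∈ Finset.range (p + 1))
    (h1 : Ms p (Tr p r x)) (h2 : Ms p (Tr p s x)) (hne : r ≠ s) : Dv p x := by
  have hP := Nat.prime_iff_prime_int.1 hp
  rw [Dv_E (Tr_E p r x)]
  rw [comp_eq' p r s] at h2
  have hg := r_cross hp hr hs hne
  generalize ra p s * rd p r - rg p s * rb p r = α at *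
  generalize rg p s * ra p r - ra p s * rg p r = g at *
  generalize Tr p r x = z at *
  obtain ⟨ha, hb, hc⟩ := h1
  refine ⟨ha, hb, hc, ?_⟩
  have h3 := h2.1
  simp only [T] at h3
  have h4 : (p : ℤ) ∣ z.d * g ^ 3 := by
    refine (dvd_add_right ?_).1 h3
    exact dvd_add (dvd_add (ha.mul_right _) (((hb.mul_left 3).mul_right _).mul_right _))
      (((hc.mul_left 3).mul_right _).mul_right _)
  exact (hP.dvd_or_dvd h4).resolve_right (fun h => hg (hP.dvd_of_dvd_pow h))

theorem Ls_unique {p r s : ℕ} (hp : p.Prime) {x : Fm} (hr : r ∈ Finset.range (p + 1)) (hs : s ∈ Finset.range (p + 1))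
    (h1 : Ls p (Tr p r x)) (h2 : Ls p (Tr p s x)) (hne : r ≠ s) : Dv ((p : ℤ) ^ 2) x := by
  have hP := Nat.prime_iff_prime_int.1 hp
  rw [Dv_E (Tr_E p r x)]
  rw [comp_eq' p r s] at h2
  have hg := r_cross hp hr hs hne
  have hd := comp_det p r s
  generalize ra p s * rd p r - rg p s * rb p r = α at *
  generalize rg p s * ra p r - ra p s * rg p r = g at *
  generalize rb p s * rd p r - rd p s * rb p r = β at *
  generalize rd p s * ra p r - rb p s * rg p r = δ at *
  generalize Tr p r x = z at *
  have hcop : IsCoprime ((p : ℤ) ^ 2) g := ((Prime.coprime_iff_not_dvd hP).2 hg).pow_left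
  obtain ⟨ha, hb, hc⟩ := h1
  have h3 := h2.1
  have h4 := h2.2.1
  simp only [T] at h3 h4
  have e1 : (p : ℤ) ^ 2 ∣ 3 * z.c * α + z.d * g := by
    apply (hcop.pow_right (n := 2)).dvd_of_dvd_mul_left
    have : g ^ 2 * (3 * z.c * α + z.d * g) = (z.a * α ^ 3 + 3 * z.b * α ^ 2 * g + 3 * z.c * α * g ^ 2 + z.d * g ^ 3)
      - z.a * α ^ 3 - z.b * (3 * α ^ 2 * g) := by ring
    rw [this]
    exact dvd_sub (dvd_sub h3 (ha.mul_right _)) (hb.mul_right _)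
  have e2 : (p : ℤ) ^ 2 ∣ z.c := by
    apply hcop.dvd_of_dvd_mul_left
    have : g * z.c = -(z.a * α ^ 2 * β + z.b * (α ^ 2 * δ + 2 * α * β * g) + z.c * (2 * α * g * δ + β * g ^ 2)
      + z.d * g ^ 2 * δ) + z.a * (α ^ 2 * β) + z.b * (α ^ 2 * δ + 2 * α * β * g) + (3 * z.c * α + z.d * g) * (g * δ) := by
      linear_combination (-g * z.c) * hd
    rw [this]
    exact dvd_add (dvd_add (dvd_add (dvd_neg.2 h4) (ha.mul_right _)) (hb.mul_right _)) (e1.mul_right _)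
  have e3 : (p : ℤ) ^ 2 ∣ z.d := by
    apply hcop.dvd_of_dvd_mul_right
    exact (dvd_add_right ((e2.mul_left 3).mul_right _)).1 e1
  exact ⟨ha, hb, e2, e3⟩

def wt (p : ℕ) (x : Fm) : ℝ :=
  if Dv ((p : ℤ) ^ 2) x then 5 * ((p : ℝ) ^ 2)⁻¹ else if Dv p x then 4 * ((p : ℝ) ^ 3)⁻¹
  else if HDv ((p : ℤ) ^ 2) x then ((p : ℝ) ^ 3)⁻¹ else if HDv p x then ((p : ℝ) ^ 5)⁻¹ else 0

theorem PhiHat_wt {p : ℕ} (hp : p.Prime) (x : Fm) : ‖BCF.PhiHat p (tob x)‖ ≤ wt p x := by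
  rw [PhiHat_prime hp, Complex.norm_real, Real.norm_eq_abs]
  have h2 : (2 : ℝ) ≤ p := by exact_mod_cast hp.two_le
  obtain ⟨t, ht⟩ : ∃ t : ℝ, t = (p : ℝ)⁻¹ := ⟨_, rfl⟩
  have ht0 : 0 < t := by rw [ht]; positivity
  have hpt : (p : ℝ) * t = 1 := by rw [ht]; field_simp
  have ht2 : t ≤ 1 / 2 := by
    rw [ht, inv_le_comm₀ (by positivity) (by norm_num)]; linarith
  have ei : ∀ n : ℕ, ((p : ℝ) ^ n)⁻¹ = t ^ n := fun n => by rw [ht, inv_pow]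
  simp only [wt, ei]
  have h53 : t ^ 5 ≤ t ^ 3 := pow_le_pow_of_le_one ht0.le (by linarith) (by norm_num)
  have h43 : t ^ 4 ≤ t ^ 3 := pow_le_pow_of_le_one ht0.le (by linarith) (by norm_num)
  have h32 : t ^ 3 ≤ t ^ 2 := pow_le_pow_of_le_one ht0.le (by linarith) (by norm_num)
  have h3 : 0 < t ^ 3 := by positivity
  have h4 : 0 < t ^ 4 := by positivity
  have h5 : 0 < t ^ 5 := by positivity
  by_cases k0 : Dv (p : ℤ) x
  · by_cases k1 : Dv ((p : ℤ) ^ 2) x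
    · rw [if_pos k1, if_pos k0]
      have hs : |∑ r ∈ Finset.range (p + 1),
          ((if Ls p (Tr p r x) then t ^ 3 else 0) - (if Ms p (Tr p r x) then t ^ 5 else 0))| ≤ (p + 1) * t ^ 3 := by
        refine (Finset.abs_sum_le_sum_abs _ _).trans ?_
        refine (Finset.sum_le_card_nsmul _ _ (t ^ 3) ?_).trans ?_
        · intro r _
          rw [abs_le]; split_ifs <;> constructor <;> linarith
        · rw [Finset.card_range, nsmul_eq_mul]; push_cast; exact le_rfl
      have e : ((p : ℝ) + 1) * t ^ 3 = t ^ 2 + t ^ 3 := by linear_combination t ^ 2 * hpt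
      rw [e] at hs
      rw [abs_le] at hs ⊢
      constructor <;> linarith
    · rw [if_neg k1, if_pos k0, if_pos k0, Finset.sum_sub_distrib]
      have hs : |∑ r ∈ Finset.range (p + 1), (if Ms p (Tr p r x) then t ^ 5 else 0)| ≤ (p + 1) * t ^ 5 := by
        refine (Finset.abs_sum_le_sum_abs _ _).trans ?_
        refine (Finset.sum_le_card_nsmul _ _ (t ^ 5) ?_).trans ?_
        · intro r _
          rw [abs_le]; split_ifs <;> constructor <;> linarith
        · rw [Finset.card_range, nsmul_eq_mul]; push_cast; exact le_rfl
      have e : ((p : ℝ) + 1) * t ^ 5 = t ^ 4 + t ^ 5 := by linear_combination t ^ 4 * hpt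
      rw [e] at hs
      have hl : |∑ r ∈ Finset.range (p + 1), (if Ls p (Tr p r x) then t ^ 3 else 0)| ≤ t ^ 3 := by
        by_cases hE : ∃ r ∈ Finset.range (p + 1), Ls p (Tr p r x)
        · obtain ⟨r, hr, hL⟩ := hE
          rw [Finset.sum_eq_single r, if_pos hL, abs_of_pos h3]
          · intro s hs hne
            rw [if_neg]
            intro hLs
            exact k1 (Ls_unique hp hs hr hLs hL hne)
          · intro h; exact absurd hr h
        · rw [Finset.sum_eq_zero, abs_zero]
          · exact h3.le
          · intro r hr
            rw [if_neg]
            intro h; exact hE ⟨r, hr, h⟩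
      rw [abs_le] at hs hl ⊢
      constructor <;> linarith
  · have k1 : ¬ Dv ((p : ℤ) ^ 2) x := by
      rintro ⟨a1, a2, a3, a4⟩
      have hd : (p : ℤ) ∣ (p : ℤ) ^ 2 := dvd_pow_self _ two_ne_zero
      exact k0 ⟨hd.trans a1, hd.trans a2, hd.trans a3, hd.trans a4⟩
    rw [if_neg k1, if_neg k0, if_neg k0, zero_add]
    by_cases hE : ∃ r ∈ Finset.range (p + 1), Ms p (Tr p r x)
    · obtain ⟨r, hr, hM⟩ := hE
      have hH := (HDv_E (Tr_E p r x)).2 hM.HDv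
      rw [Finset.sum_eq_single r, if_pos hM]
      · by_cases hL : Ls p (Tr p r x)
        · rw [if_pos ((HDv_E (Tr_E p r x)).2 hL.HDv), if_pos hL, abs_le]
          constructor <;> linarith
        · rw [if_neg hL, if_pos hH, zero_sub, abs_neg, abs_of_pos h5]
          split_ifs <;> linarith
      · intro s hs hne
        have : ¬ Ms p (Tr p s x) := fun h => k0 (Ms_unique hp hs hr h hM hne)
        rw [if_neg this, if_neg (fun h => this (Ls.Ms h)), sub_zero]
      · intro h; exact absurd hr h
    · rw [Finset.sum_eq_zero, abs_zero]
      · split_ifs <;> linarith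
      · intro r hr
        have : ¬ Ms p (Tr p r x) := fun h => hE ⟨r, hr, h⟩
        rw [if_neg this, if_neg (fun h => this (Ls.Ms h)), sub_zero]

theorem wt_nonneg (p : ℕ) (x : Fm) : 0 ≤ wt p x := by
  simp only [wt]; split_ifs <;> positivity

theorem PhiHat_one (x : Fm) : ‖BCF.PhiHat 1 (tob x)‖ ≤ 1 := by
  rw [PhiHat_eq]
  have : Bx (1 ^ 2) = {((0 : ℤ), (0 : ℤ), (0 : ℤ), (0 : ℤ))} := by
    ext y; obtain ⟨a, b, c, d⟩ := y
    simp only [Bx, Finset.mem_product, mem_I, Finset.mem_singleton, Prod.mk.injEq]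
    push_cast
    omega
  rw [this, Finset.sum_singleton]
  simp only [pr, mul_zero, sub_zero, add_zero, ec_zero]
  split_ifs <;> simp

theorem PhiHat_bound {q : ℕ} (hq : Squarefree q) (x : Fm) :
    ‖BCF.PhiHat q (tob x)‖ ≤ ∏ p ∈ q.primeFactors, wt p x := by
  induction q using Nat.recOnMul with
  | zero => exact absurd hq not_squarefree_zero
  | one => simpa using PhiHat_one x
  | prime p hp => rw [Nat.Prime.primeFactors hp, Finset.prod_singleton]; exact PhiHat_wt hp x
  | mul a b iha ihb =>
    have hc := Nat.coprime_of_squarefree_mul hq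
    have ha := hq.of_mul_left
    have hb := hq.of_mul_right
    rw [PhiHat_mul ha.ne_zero hb.ne_zero hc, norm_mul, hc.primeFactors_mul,
      Finset.prod_union hc.disjoint_primeFactors]
    exact mul_le_mul (iha ha) (ihb hb) (norm_nonneg _) (Finset.prod_nonneg fun p _ => wt_nonneg p x)

end DCB

end

section
namespace DCB
open Fm

theorem five_pow {q : ℕ} (hq : q ≠ 0) : (5 : ℝ) ^ q.primeFactors.card ≤ (q.divisors.card : ℝ) ^ 3 := by
  have h2 : 2 ^ q.primeFactors.card ≤ q.divisors.card := by
    rw [Nat.card_divisors hq]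
    apply Finset.pow_card_le_prod
    intro p hp
    have := (Nat.mem_primeFactors.1 hp).1.factorization_pos_of_dvd hq (Nat.mem_primeFactors.1 hp).2.1
    omega
  have h2' : (2 : ℝ) ^ q.primeFactors.card ≤ q.divisors.card := by exact_mod_cast h2
  calc (5 : ℝ) ^ q.primeFactors.card ≤ 8 ^ q.primeFactors.card := by gcongr; norm_num
    _ = (2 ^ q.primeFactors.card) ^ 3 := by
      rw [← pow_mul, mul_comm, pow_mul]; norm_num
    _ ≤ _ := by gcongr

def cls (p : ℕ) (x : Fm) : ℕ :=
  if Dv ((p : ℤ) ^ 2) x then 0 else if Dv p x then 1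
  else if HDv ((p : ℤ) ^ 2) x then (if (p : ℤ) ^ 5 ∣ x.D then 2 else 3) else if HDv p x then 4 else 5

def ex (i : ℕ) : ℕ := if i = 0 then 2 else if i = 4 then 5 else 3

theorem wt_cls {p : ℕ} (x : Fm) : wt p x ≤ 5 * ((p : ℝ) ^ ex (cls p x))⁻¹ := by
  have h : ∀ n : ℕ, 0 ≤ ((p : ℝ) ^ n)⁻¹ := fun n => by positivity
  have h3 := h 3
  have h5 := h 5
  simp only [wt, cls]
  split_ifs <;> norm_num [ex] <;> linarith

theorem cls_lt {p : ℕ} {x : Fm} (h : wt p x ≠ 0) : cls p x ∈ Finset.range 5 := by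
  simp only [wt] at h
  simp only [cls]
  split_ifs at h ⊢ <;> simp_all

theorem cls_0 {p : ℕ} {x : Fm} (h : cls p x = 0) : Dv ((p : ℤ) ^ 2) x := by
  simp only [cls] at h; split_ifs at h <;> first | omega | assumption
theorem cls_1 {p : ℕ} {x : Fm} (h : cls p x = 1) : Dv p x := by
  simp only [cls] at h; split_ifs at h <;> first | omega | assumption
theorem cls_2 {p : ℕ} {x : Fm} (h : cls p x = 2) : ¬ Dv p x ∧ HDv ((p : ℤ) ^ 2) x ∧ (p : ℤ) ^ 5 ∣ x.D := by
  simp only [cls] at h; split_ifs at h <;> first | omega | (refine ⟨?_, ?_, ?_⟩ <;> assumption)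
theorem cls_3 {p : ℕ} {x : Fm} (h : cls p x = 3) : ¬ Dv p x ∧ HDv ((p : ℤ) ^ 2) x ∧ ¬ (p : ℤ) ^ 5 ∣ x.D := by
  simp only [cls] at h; split_ifs at h <;> first | omega | (refine ⟨?_, ?_, ?_⟩ <;> assumption)
theorem cls_4 {p : ℕ} {x : Fm} (h : cls p x = 4) : ¬ Dv p x ∧ HDv p x := by
  simp only [cls] at h; split_ifs at h <;> first | omega | (refine ⟨?_, ?_⟩ <;> assumption)

def Pt (q : ℕ) (x : Fm) (i : ℕ) : ℕ := ∏ p ∈ q.primeFactors with cls p x = i, p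

theorem Pt_dvd {q p : ℕ} (hp : p.Prime) {x : Fm} {i : ℕ} (h : p ∣ Pt q x i) : cls p x = i := by
  rw [Pt, (Nat.prime_iff.1 hp).dvd_finsetProd_iff] at h
  obtain ⟨p', hp', hd⟩ := h
  rw [Finset.mem_filter] at hp'
  rw [(Nat.prime_dvd_prime_iff_eq hp (Nat.mem_primeFactors.1 hp'.1).1).1 hd]
  exact hp'.2

theorem Pt_prod {q : ℕ} (hq : Squarefree q) {x : Fm} (h : ∀ p ∈ q.primeFactors, cls p x ∈ Finset.range 5) :
    Pt q x 0 * Pt q x 1 * Pt q x 2 * Pt q x 3 * Pt q x 4 = q := by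
  have h1 := Finset.prod_fiberwise_of_maps_to h (fun p => p)
  rw [Nat.prod_primeFactors_of_squarefree hq] at h1
  simp only [Finset.prod_range_succ, Finset.prod_range_zero, one_mul] at h1
  exact h1

theorem Pt_wt {q : ℕ} {x : Fm} (h : ∀ p ∈ q.primeFactors, cls p x ∈ Finset.range 5) :
    ∏ p ∈ q.primeFactors, wt p x ≤ 5 ^ q.primeFactors.card *
     ((Pt q x 0 : ℝ) ^ 2 * (Pt q x 1 : ℝ) ^ 3 * (Pt q x 2 : ℝ) ^ 3 * (Pt q x 3 : ℝ) ^ 3 * (Pt q x 4 : ℝ) ^ 5)⁻¹ := by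
  have h0 : ∏ p ∈ q.primeFactors, wt p x ≤ ∏ p ∈ q.primeFactors, (5 * ((p : ℝ) ^ ex (cls p x))⁻¹) :=
    Finset.prod_le_prod (fun p _ => wt_nonneg p x) (fun p _ => wt_cls x)
  refine h0.trans (le_of_eq ?_)
  rw [Finset.prod_mul_distrib, Finset.prod_const]
  congr 1
  have h1 := Finset.prod_fiberwise_of_maps_to h (fun p => ((p : ℝ) ^ ex (cls p x))⁻¹)
  rw [← h1]
  have h2 : ∀ i, ∏ p ∈ q.primeFactors with cls p x = i, ((p : ℝ) ^ ex (cls p x))⁻¹ = ((Pt q x i : ℝ) ^ ex i)⁻¹ := by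
    intro i
    rw [Pt, Nat.cast_prod, ← Finset.prod_pow, ← Finset.prod_inv_distrib]
    refine Finset.prod_congr rfl fun p hp => ?_
    rw [(Finset.mem_filter.1 hp).2]
  simp only [h2, Finset.prod_range_succ, Finset.prod_range_zero, one_mul]
  simp only [mul_inv]
  norm_num [ex]

theorem main_sum (ε : ℝ) (hε : 0 < ε) (hε4 : ε ≤ 1 / 4) : ∃ C : ℝ, 0 < C ∧ ∀ q : ℕ, Squarefree q →
    ∀ Y : ℝ, 0 ≤ Y → ∀ S : Finset Fm, Ineq S → (∀ x ∈ S, x.D ≠ 0 ∧ |(x.D : ℝ)| ≤ Y) →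
    ∑ x ∈ S, ∏ p ∈ q.primeFactors, wt p x ≤ C * (q : ℝ) ^ (14 * ε) * (Y / (q : ℝ) ^ 7) := by
  obtain ⟨C, hC, h3⟩ := cnt3 ε hε hε4
  obtain ⟨C1, hC1, ht⟩ := tau_bound ε hε
  refine ⟨C1 ^ 9 * C, by positivity, ?_⟩
  intro q hq Y hY S hI hS
  have hq0 := hq.ne_zero
  have hq1 : (1 : ℝ) ≤ q := by exact_mod_cast Nat.one_le_iff_ne_zero.2 hq0
  obtain ⟨S', hS'⟩ : ∃ S', S' = S.filter (fun x => ∏ p ∈ q.primeFactors, wt p x ≠ 0) := ⟨_, rfl⟩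
  have hsum : ∑ x ∈ S, ∏ p ∈ q.primeFactors, wt p x = ∑ x ∈ S', ∏ p ∈ q.primeFactors, wt p x := by
    rw [hS']; exact (Finset.sum_filter_ne_zero S).symm
  have hsub : S' ⊆ S := by rw [hS']; exact Finset.filter_subset _ _
  have hcl : ∀ x ∈ S', ∀ p ∈ q.primeFactors, cls p x ∈ Finset.range 5 := by
    intro x hx p hp
    rw [hS', Finset.mem_filter] at hx
    exact cls_lt (Finset.prod_ne_zero_iff.1 hx.2 p hp)
  obtain ⟨κ, hκ⟩ : ∃ κ : Fm → ℕ × ℕ × ℕ × ℕ × ℕ, ∀ x, κ x = (Pt q x 0, Pt q x 1, Pt q x 2, Pt q x 3, Pt q x 4) :=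
    ⟨_, fun _ => rfl⟩
  obtain ⟨TT, hTT⟩ : ∃ TT, TT = q.divisors ×ˢ q.divisors ×ˢ q.divisors ×ˢ q.divisors ×ˢ q.divisors := ⟨_, rfl⟩
  have hcard : TT.card = q.divisors.card ^ 5 := by
    rw [hTT]; simp only [Finset.card_product]; ring
  have hmaps : ∀ x ∈ S', κ x ∈ TT := by
    intro x hx
    have := Pt_prod hq (hcl x hx)
    rw [hκ, hTT]
    simp only [Finset.mem_product, Nat.mem_divisors]
    refine ⟨⟨⟨Pt q x 1 * Pt q x 2 * Pt q x 3 * Pt q x 4, ?_⟩, hq0⟩, ⟨⟨Pt q x 0 * Pt q x 2 * Pt q x 3 * Pt q x 4, ?_⟩, hq0⟩,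
      ⟨⟨Pt q x 0 * Pt q x 1 * Pt q x 3 * Pt q x 4, ?_⟩, hq0⟩, ⟨⟨Pt q x 0 * Pt q x 1 * Pt q x 2 * Pt q x 4, ?_⟩, hq0⟩,
      ⟨⟨Pt q x 0 * Pt q x 1 * Pt q x 2 * Pt q x 3, ?_⟩, hq0⟩⟩ <;>
      refine this.symm.trans (by ring)
  rw [hsum, ← Finset.sum_fiberwise_of_maps_to hmaps]
  obtain ⟨τ, hτ⟩ : ∃ τ : ℝ, τ = (q.divisors.card : ℝ) := ⟨_, rfl⟩
  have hτ0 : 0 ≤ τ := by rw [hτ]; positivity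
  have hfib : ∀ t ∈ TT, ∑ x ∈ S' with κ x = t, ∏ p ∈ q.primeFactors, wt p x ≤
      τ ^ 4 * (C * (q : ℝ) ^ (5 * ε)) * (Y / (q : ℝ) ^ 7) := by
    intro t ht
    obtain ⟨F, hF⟩ : ∃ F, F = S'.filter (fun x => κ x = t) := ⟨_, rfl⟩
    rw [← hF]
    rcases F.eq_empty_or_nonempty with h0 | ⟨x0, hx0⟩
    · rw [h0, Finset.sum_empty]; positivity
    have hFm : ∀ x ∈ F, x ∈ S' ∧ κ x = t := by
      intro x hx; rw [hF, Finset.mem_filter] at hx; exact hx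
    obtain ⟨A, B, R, Q1, Q⟩ := t
    have hPt : ∀ x ∈ F, Pt q x 0 = A ∧ Pt q x 1 = B ∧ Pt q x 2 = R ∧ Pt q x 3 = Q1 ∧ Pt q x 4 = Q := by
      intro x hx
      have := (hFm x hx).2
      rw [hκ] at this
      simpa only [Prod.mk.injEq] using this
    have hprod : A * B * R * Q1 * Q = q := by
      have h := Pt_prod hq (hcl x0 (hFm x0 hx0).1)
      obtain ⟨e0, e1, e2, e3, e4⟩ := hPt x0 hx0
      rw [e0, e1, e2, e3, e4] at h; exact h
    have hFI : Ineq F := hI.subset (fun x hx => hsub (hFm x hx).1)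
    have hc := h3 A B R Q1 Q (by rw [hprod]; exact hq) Y hY F hFI (by
      intro x hx
      obtain ⟨e0, e1, e2, e3, e4⟩ := hPt x hx
      refine ⟨?_, ?_, ?_, ⟨?_, ?_⟩, hS x (hsub (hFm x hx).1)⟩
      · intro p hp hd; rw [← e0] at hd; exact cls_0 (Pt_dvd hp hd)
      · intro p hp hd; rw [← e1] at hd; exact cls_1 (Pt_dvd hp hd)
      · intro p hp hd; rw [← e2] at hd; exact cls_2 (Pt_dvd hp hd)
      · intro p hp hd; rw [← e3] at hd; exact cls_3 (Pt_dvd hp hd)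
      · intro p hp hd; rw [← e4] at hd; exact cls_4 (Pt_dvd hp hd))
    have hprod' : (A : ℝ) * B * R * Q1 * Q = q := by exact_mod_cast hprod
    have hA0 : A ≠ 0 := by rintro rfl; apply hq0; rw [← hprod]; ring
    have hB0 : B ≠ 0 := by rintro rfl; apply hq0; rw [← hprod]; ring
    have hR0 : R ≠ 0 := by rintro rfl; apply hq0; rw [← hprod]; ring
    have hQ10 : Q1 ≠ 0 := by rintro rfl; apply hq0; rw [← hprod]; ring
    have hQ0 : Q ≠ 0 := by rintro rfl; apply hq0; rw [← hprod]; ring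
    have hA : (1 : ℝ) ≤ A := by exact_mod_cast Nat.one_le_iff_ne_zero.2 hA0
    have hB : (1 : ℝ) ≤ B := by exact_mod_cast Nat.one_le_iff_ne_zero.2 hB0
    have hR : (1 : ℝ) ≤ R := by exact_mod_cast Nat.one_le_iff_ne_zero.2 hR0
    have hQ1 : (1 : ℝ) ≤ Q1 := by exact_mod_cast Nat.one_le_iff_ne_zero.2 hQ10
    have hQ : (1 : ℝ) ≤ Q := by exact_mod_cast Nat.one_le_iff_ne_zero.2 hQ0
    have hτR : (R.divisors.card : ℝ) ≤ τ := by
      rw [hτ]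
      exact_mod_cast Finset.card_le_card (Nat.divisors_subset_of_dvd hq0 ⟨A * B * Q1 * Q, by rw [← hprod]; ring⟩)
    have hQ1q : (Q1 : ℝ) ≤ q := by
      exact_mod_cast Nat.le_of_dvd (Nat.pos_of_ne_zero hq0) ⟨A * B * R * Q, by rw [← hprod]; ring⟩
    have hQq : (Q : ℝ) ≤ q := by
      exact_mod_cast Nat.le_of_dvd (Nat.pos_of_ne_zero hq0) ⟨A * B * R * Q1, by rw [← hprod]; ring⟩
    have hrp : (Q1 : ℝ) ^ (2 * ε) * (Q : ℝ) ^ (3 * ε) ≤ (q : ℝ) ^ (5 * ε) := by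
      calc (Q1 : ℝ) ^ (2 * ε) * (Q : ℝ) ^ (3 * ε) ≤ (q : ℝ) ^ (2 * ε) * (q : ℝ) ^ (3 * ε) := by gcongr
        _ = _ := by rw [← Real.rpow_add (by linarith)]; congr 1; ring
    have h5 := five_pow hq0
    rw [← hτ] at h5
    have hw : ∀ x ∈ F, ∏ p ∈ q.primeFactors, wt p x ≤
        τ ^ 3 * ((A : ℝ) ^ 2 * (B : ℝ) ^ 3 * (R : ℝ) ^ 3 * (Q1 : ℝ) ^ 3 * (Q : ℝ) ^ 5)⁻¹ := by
      intro x hx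
      obtain ⟨e0, e1, e2, e3, e4⟩ := hPt x hx
      have := Pt_wt (hcl x (hFm x hx).1)
      rw [e0, e1, e2, e3, e4] at this
      refine this.trans ?_
      gcongr
    refine (Finset.sum_le_card_nsmul F _ _ hw).trans ?_
    rw [nsmul_eq_mul]
    calc (F.card : ℝ) * (τ ^ 3 * ((A : ℝ) ^ 2 * (B : ℝ) ^ 3 * (R : ℝ) ^ 3 * (Q1 : ℝ) ^ 3 * (Q : ℝ) ^ 5)⁻¹)
        ≤ ((τ * R) * (C * ((q : ℝ) ^ (5 * ε)) *
        ((Y / ((A : ℝ) ^ 8 * (B : ℝ) ^ 4) / (R : ℝ) ^ 6) / ((Q1 : ℝ) ^ 4 * (Q : ℝ) ^ 2)))) *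
          (τ ^ 3 * ((A : ℝ) ^ 2 * (B : ℝ) ^ 3 * (R : ℝ) ^ 3 * (Q1 : ℝ) ^ 3 * (Q : ℝ) ^ 5)⁻¹) := by
          refine mul_le_mul_of_nonneg_right (hc.trans ?_) (by positivity)
          gcongr
      _ = τ ^ 4 * (C * (q : ℝ) ^ (5 * ε)) * (Y / ((q : ℝ) ^ 7 * ((A : ℝ) ^ 3 * R))) := by
          have a1 : (A : ℝ) ≠ 0 := by linarith
          have a2 : (B : ℝ) ≠ 0 := by linarith
          have a3 : (R : ℝ) ≠ 0 := by linarith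
          have a4 : (Q1 : ℝ) ≠ 0 := by linarith
          have a5 : (Q : ℝ) ≠ 0 := by linarith
          generalize (q : ℝ) ^ (5 * ε) = K
          rw [← hprod']
          field_simp
      _ ≤ _ := by
          apply mul_le_mul_of_nonneg_left _ (by positivity)
          apply div_le_div_of_nonneg_left hY (by positivity)
          have : 1 ≤ (A : ℝ) ^ 3 * R := one_le_mul_of_one_le_of_one_le (one_le_pow₀ hA) hR
          have : 0 ≤ (q : ℝ) ^ 7 := by positivity
          nlinarith
  refine (Finset.sum_le_card_nsmul TT _ _ hfib).trans ?_
  rw [nsmul_eq_mul, hcard]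
  push_cast
  rw [← hτ]
  have htq := ht q hq0
  rw [← hτ] at htq
  calc τ ^ 5 * (τ ^ 4 * (C * (q : ℝ) ^ (5 * ε)) * (Y / (q : ℝ) ^ 7))
      = τ ^ 9 * (C * (q : ℝ) ^ (5 * ε)) * (Y / (q : ℝ) ^ 7) := by ring
    _ ≤ (C1 * (q : ℝ) ^ ε) ^ 9 * (C * (q : ℝ) ^ (5 * ε)) * (Y / (q : ℝ) ^ 7) := by gcongr
    _ = C1 ^ 9 * C * (((q : ℝ) ^ ε) ^ 9 * (q : ℝ) ^ (5 * ε)) * (Y / (q : ℝ) ^ 7) := by ring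
    _ = _ := by
      congr 2
      rw [← Real.rpow_natCast, ← Real.rpow_mul (by linarith), ← Real.rpow_add (by linarith)]
      congr 1; push_cast; ring

end DCB

end

section
namespace DCB
open Fm

def toF (y : BCF) : Fm := ⟨y.1, y.2.1 / 3, y.2.2.1 / 3, y.2.2.2⟩

theorem tob_toF {y : BCF} (h : BCF.inDual y) : tob (toF y) = y := by
  obtain ⟨h1, h2⟩ := h
  ext
  · rfl
  · simp only [tob, toF]; omega
  · simp only [tob, toF]; omega
  · rfl

theorem disc_tob (x : Fm) : BCF.disc (tob x) = -27 * x.D := by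
  simp only [BCF.disc, tob, D, hA, hB, hC]; ring

theorem SLeq_tob {x y : Fm} (h : E x y) : BCF.SLeq (tob x) (tob y) := by
  obtain ⟨α, β, g, δ, hd, rfl⟩ := h
  have hd' : (!![α, g; β, δ] : Matrix (Fin 2) (Fin 2) ℤ).det = 1 := by
    rw [Matrix.det_fin_two_of, ← hd]; ring
  refine ⟨!![α, g; β, δ], hd', ?_⟩
  rw [act_eq, hd']
  ext <;> simp [smB, TB, tob, T] <;> ring

theorem final (ε : ℝ) (hε : 0 < ε) : ∃ C : ℝ,
      ∀ q : ℕ, Squarefree q → ∀ X : ℝ, 0 < X →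
      ∀ S : Finset BCF,
        (∀ x ∈ S, BCF.inDual x ∧ BCF.disc x ≠ 0 ∧ (|BCF.disc x| : ℝ) < (q : ℝ) ^ 8 * X) →
        (∀ x ∈ S, ∀ y ∈ S, x ≠ y → ¬ BCF.SLeq x y) →
        ∑ x ∈ S, ‖BCF.PhiHat q x‖ / (BCF.stabCard x : ℝ) ≤ C * (q : ℝ) ^ ((1:ℝ) + ε) * X := by
  obtain ⟨η, hη⟩ : ∃ η : ℝ, η = min ε 1 / 14 := ⟨_, rfl⟩
  have hη0 : 0 < η := by rw [hη]; have : 0 < min ε 1 := lt_min hε one_pos; positivity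
  have hη1 : η ≤ 1 / 4 := by rw [hη]; have : min ε 1 ≤ 1 := min_le_right _ _; linarith
  have hη2 : 14 * η ≤ ε := by rw [hη]; have : min ε 1 ≤ ε := min_le_left _ _; linarith
  obtain ⟨C, hC, hm⟩ := main_sum η hη0 hη1
  refine ⟨C, ?_⟩
  intro q hq X hX S hS hI
  have hq0 := hq.ne_zero
  have hq1 : (1 : ℝ) ≤ q := by exact_mod_cast Nat.one_le_iff_ne_zero.2 hq0
  have hinj : ∀ x ∈ S, ∀ y ∈ S, toF x = toF y → x = y := by
    intro x hx y hy h
    rw [← tob_toF (hS x hx).1, ← tob_toF (hS y hy).1, h]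
  have hI' : Ineq (S.image toF) := by
    intro x hx y hy h
    rw [Finset.mem_image] at hx hy
    obtain ⟨x, hx, rfl⟩ := hx
    obtain ⟨y, hy, rfl⟩ := hy
    have h1 := SLeq_tob h
    rw [tob_toF (hS x hx).1, tob_toF (hS y hy).1] at h1
    by_contra hne
    exact hI x hx y hy (fun e => hne (by rw [e])) h1
  have h1 := hm q hq ((q : ℝ) ^ 8 * X) (by positivity) (S.image toF) hI' (by
    intro x hx
    rw [Finset.mem_image] at hx
    obtain ⟨x, hx, rfl⟩ := hx
    obtain ⟨k1, k2, k3⟩ := hS x hx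
    have hd := disc_tob (toF x)
    rw [tob_toF k1] at hd
    rw [hd] at k2 k3
    refine ⟨fun h => k2 (by rw [h]; ring), ?_⟩
    push_cast at k3
    rw [abs_mul] at k3
    have e27 : |(-27 : ℝ)| = 27 := by norm_num
    rw [e27] at k3
    have := abs_nonneg ((toF x).D : ℝ)
    linarith)
  rw [Finset.sum_image hinj] at h1
  have h2 : ∑ x ∈ S, ‖BCF.PhiHat q x‖ / (BCF.stabCard x : ℝ) ≤ ∑ x ∈ S, ∏ p ∈ q.primeFactors, wt p (toF x) := by
    apply Finset.sum_le_sum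
    intro x hx
    have h3 := PhiHat_bound hq (toF x)
    rw [tob_toF (hS x hx).1] at h3
    refine le_trans ?_ h3
    rcases Nat.eq_zero_or_pos (BCF.stabCard x) with h0 | h0
    · rw [h0]; simp
    · exact div_le_self (norm_nonneg _) (by exact_mod_cast h0)
  refine h2.trans (h1.trans ?_)
  have hqp : (0 : ℝ) < q := by linarith
  have e : C * (q : ℝ) ^ (14 * η) * ((q : ℝ) ^ 8 * X / (q : ℝ) ^ 7) = C * (q : ℝ) ^ (1 + 14 * η) * X := by
    rw [Real.rpow_add hqp, Real.rpow_one]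
    generalize (q : ℝ) ^ (14 * η) = K
    field_simp
  rw [e]
  gcongr

end DCB

end

open BCF in
/-- Theorem 3.1: partial sums of (absolute values of) the coefficients of the dual
`q`-nonmaximal Shintani zeta function are `≪ q^{1+ε} X`, uniformly in `q` and `X`. -/
theorem dual_coefficient_bound :
    ∀ ε : ℝ, 0 < ε → ∃ C : ℝ,
      ∀ q : ℕ, Squarefree q → ∀ X : ℝ, 0 < X →
      ∀ S : Finset BCF,
        (∀ x ∈ S, inDual x ∧ disc x ≠ 0 ∧ (|disc x| : ℝ) < (q : ℝ) ^ 8 * X) →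
        (∀ x ∈ S, ∀ y ∈ S, x ≠ y → ¬ SLeq x y) →
        ∑ x ∈ S, ‖PhiHat q x‖ / (stabCard x : ℝ) ≤ C * (q : ℝ) ^ ((1:ℝ) + ε) * X := by
  intro ε hε
  exact DCB.final ε hε
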